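/- arXiv:2205.09213 — 11 statements merged into one kernel-verified Lean document; each statement's English description precedes it below -/
import Mathlib

section
/- Let E : ℝ^N → ℝ be continuously differentiable and suppose E satisfies the Łojasiewicz inequality at every critical point. Let u : [0,∞) → ℝ^N be a bounded solution of the gradient system u'(t) = -∇E(u(t)). Then there exists ũ ∈ ℝ^N with ∇E(ũ) = 0 such that ‖u(t) - ũ‖ → 0 as t → ∞. Moreover, if θ is a Łojasiewicz exponent of E at ũ, then ‖u(t) - ũ‖ = O(e^{-δt}) for some δ > 0 if θ = 1/2, and ‖u(t) - ũ‖ = O(t^{-θ/(1-2θ)}) if 0 < θ < 1/2. -/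
open Filter Topology Asymptotics

/-- Linear upper bound from a bound on the derivative. -/
theorem loja_le_lin {f f' : ℝ → ℝ} {s t C : ℝ} (hst : s ≤ t)
    (hf : ∀ x ∈ Set.Icc s t, HasDerivAt f (f' x) x)
    (hC : ∀ x ∈ Set.Ioo s t, f' x ≤ C) : f t ≤ f s + C * (t - s) := by
  have := (convex_Icc s t).image_sub_le_mul_sub_of_deriv_le
    (f := f) (C := C) (fun x hx => (hf x hx).continuousAt.continuousWithinAt)
    (fun x hx => by
      rw [interior_Icc] at hx
      exact (hf x (Set.Ioo_subset_Icc_self hx)).differentiableAt.differentiableWithinAt)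
    (fun x hx => by
      rw [interior_Icc] at hx
      rw [(hf x (Set.Ioo_subset_Icc_self hx)).deriv]
      exact hC x hx)
    s (Set.left_mem_Icc.2 hst) t (Set.right_mem_Icc.2 hst) hst
  linarith

section trap
variable {F : Type*} [NormedAddCommGroup F] [NormedSpace ℝ F]

theorem loja_trap (u : ℝ → F) (G : ℝ → F) (h : ℝ → ℝ) (a : F) (c r θ s : ℝ)
    (hc : 0 < c) (hθ : 0 < θ)
    (hu : ∀ t ≥ s, HasDerivAt u (-(G t)) t)
    (hh : ∀ t ≥ s, HasDerivAt h (-(‖G t‖ ^ 2)) t)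
    (hpos : ∀ t ≥ s, 0 < h t)
    (hL : ∀ t ≥ s, ‖u t - a‖ < r → c * (h t) ^ (1 - θ) ≤ ‖G t‖)
    (hs : ‖u s - a‖ + 2 / (θ * c) * h s ^ θ < r) :
    ∀ t ≥ s, ‖u t - u s‖ ≤ 2 / (θ * c) * h s ^ θ := by
  intro t ht
  have hK : 0 < 2 / (θ * c) := by positivity
  have key := image_norm_le_of_norm_deriv_right_lt_deriv_boundary' (a := s) (b := t)
    (f := fun x => u x - u s) (f' := fun x => -(G x))
    (B := fun x => 2 / (θ * c) * (h s ^ θ - h x ^ θ))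
    (B' := fun x => 2 / (θ * c) * (-(-(‖G x‖ ^ 2) * θ * h x ^ (θ - 1))))
    (fun x hx => (((hu x hx.1).sub_const (u s)).continuousAt).continuousWithinAt)
    (fun x hx => ((hu x hx.1).sub_const (u s)).hasDerivWithinAt)
    (by simp)
    (fun x hx => ((((hh x hx.1).rpow_const (p := θ) (Or.inl (hpos x hx.1).ne')).const_sub
      (h s ^ θ)).const_mul (2 / (θ * c))).continuousAt.continuousWithinAt)
    (fun x hx => ((((hh x hx.1).rpow_const (p := θ) (Or.inl (hpos x hx.1).ne')).const_sub
      (h s ^ θ)).const_mul (2 / (θ * c))).hasDerivWithinAt)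
    (by
      intro x hx hB
      have hp := hpos x hx.1
      have h1 : ‖u x - a‖ < r := by
        have h2 : ‖u x - a‖ ≤ ‖u x - u s‖ + ‖u s - a‖ := by
          simpa using norm_add_le (u x - u s) (u s - a)
        have h3 : 0 < 2 / (θ * c) * h x ^ θ := by positivity
        rw [hB] at h2
        linarith
      have h2 := hL x hx.1 h1
      have h3 : 0 < ‖G x‖ := lt_of_lt_of_le (by positivity) h2
      have h4 : h x ^ (1 - θ) * h x ^ (θ - 1) = 1 := by
        rw [← Real.rpow_add hp]; simp
      have h5 : 0 < h x ^ (θ - 1) := by positivity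
      have h6 : c ≤ ‖G x‖ * h x ^ (θ - 1) := by
        calc c = c * h x ^ (1 - θ) * h x ^ (θ - 1) := by rw [mul_assoc, h4, mul_one]
          _ ≤ _ := by gcongr
      have h7 : 2 / (θ * c) * (-(-(‖G x‖ ^ 2) * θ * h x ^ (θ - 1)))
          = 2 / c * (‖G x‖ * h x ^ (θ - 1)) * ‖G x‖ := by field_simp
      rw [norm_neg]
      rw [h7]
      have h8 : 2 ≤ 2 / c * (‖G x‖ * h x ^ (θ - 1)) := by
        calc 2 = 2 / c * c := by field_simp
          _ ≤ _ := by gcongr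
      nlinarith)
    (Set.right_mem_Icc.2 ht)
  have h3 : 0 < 2 / (θ * c) * h t ^ θ := by have := hpos t ht; positivity
  linarith

/-- Decay of the energy, exponential case. -/
theorem loja_decay_exp (h h' : ℝ → ℝ) (k T : ℝ)
    (hh : ∀ t ≥ T, HasDerivAt h (h' t) t)
    (hd : ∀ t ≥ T, h' t ≤ -(k * h t)) :
    ∀ t ≥ T, h t ≤ h T * Real.exp (k * T) * Real.exp (-(k * t)) := by
  intro t ht
  have := loja_le_lin (f := fun x => h x * Real.exp (k * x))
    (f' := fun x => h' x * Real.exp (k * x) + h x * (Real.exp (k * x) * (k * 1))) (C := 0) ht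
    (fun x hx => (hh x hx.1).mul (((hasDerivAt_id x).const_mul k).exp))
    (fun x hx => by
      have := hd x hx.1.le
      have := Real.exp_pos (k * x)
      nlinarith)
  simp only [zero_mul, add_zero] at this
  rw [Real.exp_neg, ← div_eq_mul_inv, le_div_iff₀ (Real.exp_pos _)]
  exact this

/-- Decay of the energy, polynomial case. -/
theorem loja_decay_poly (h h' : ℝ → ℝ) (k p T : ℝ) (hp : 0 < p)
    (hh : ∀ t ≥ T, HasDerivAt h (h' t) t) (hpos : ∀ t ≥ T, 0 < h t)
    (hd : ∀ t ≥ T, h' t ≤ -(k * h t ^ (1 + p))) :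
    ∀ t ≥ T, p * k * (t - T) ≤ h t ^ (-p) := by
  intro t ht
  have := loja_le_lin (f := fun x => -(h x ^ (-p)))
    (f' := fun x => -(h' x * (-p) * h x ^ (-p - 1))) (C := -(p * k)) ht
    (fun x hx => ((hh x hx.1).rpow_const (Or.inl (hpos x hx.1).ne')).neg)
    (fun x hx => by
      have h1 := hd x hx.1.le
      have h0 := hpos x hx.1.le
      have h4 : h x ^ (1 + p) * h x ^ (-p - 1) = 1 := by
        rw [← Real.rpow_add h0]; ring_nf; simp
      have h5 : 0 < h x ^ (-p - 1) := by positivity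
      have h6 : h' x * h x ^ (-p - 1) ≤ -k := by
        calc h' x * h x ^ (-p - 1) ≤ -(k * h x ^ (1 + p)) * h x ^ (-p - 1) := by gcongr
          _ = -(k * (h x ^ (1 + p) * h x ^ (-p - 1))) := by ring
          _ = -k := by rw [h4, mul_one]
      nlinarith)
  have h0 : 0 < h T ^ (-p) := by have := hpos T le_rfl; positivity
  linarith

/-- Critical point property of cluster points. -/
theorem loja_crit (u : ℝ → F) (g : F → F) (hg : Continuous g) (h : ℝ → ℝ) (a : F) (M : ℝ)
    (hM : ∀ t ≥ 0, ‖g (u t)‖ ≤ M)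
    (hu : ∀ t ≥ 0, HasDerivAt u (-(g (u t))) t)
    (hh : ∀ t ≥ 0, HasDerivAt h (-(‖g (u t)‖ ^ 2)) t)
    (hpos : ∀ t ≥ 0, 0 ≤ h t) (hlim : Tendsto h atTop (𝓝 0))
    (ha : MapClusterPt a atTop u) : g a = 0 := by
  by_contra hne
  have hga : 0 < ‖g a‖ := norm_pos_iff.2 hne
  set m := ‖g a‖ / 2 with hm
  have hm0 : 0 < m := by positivity
  have hev : ∀ᶠ v in 𝓝 a, m < ‖g v‖ :=
    (hg.norm.continuousAt (x := a)).eventually (lt_mem_nhds (by rw [hm]; linarith))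
  obtain ⟨ρ, hρ, hball⟩ := Metric.eventually_nhds_iff.1 hev
  set M' := |M| + 1 with hM'
  have hM'0 : 0 < M' := by positivity
  set δ := ρ / (2 * M') with hδ
  have hδ0 : 0 < δ := by positivity
  have hf := ha.frequently (Metric.ball_mem_nhds a (half_pos hρ))
  have he : ∀ᶠ t in atTop, h t < m ^ 2 * δ :=
    hlim.eventually (gt_mem_nhds (by positivity))
  obtain ⟨s, hs1, hs2, hs0⟩ := (hf.and_eventually (he.and (eventually_ge_atTop 0))).exists
  have hmove := norm_image_sub_le_of_norm_deriv_right_le_segment (a := s) (b := s + δ)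
    (f := u) (f' := fun t => -(g (u t))) (C := M')
    (fun x hx => (hu x (hs0.trans hx.1)).continuousAt.continuousWithinAt)
    (fun x hx => (hu x (hs0.trans hx.1)).hasDerivWithinAt)
    (fun x hx => by
      rw [norm_neg]
      have := hM x (hs0.trans hx.1)
      have := le_abs_self M
      linarith)
  have hdec := loja_le_lin (f := h) (s := s) (t := s + δ) (C := -(m ^ 2)) (by linarith)
    (fun x hx => hh x (hs0.trans hx.1))
    (fun x hx => by
      have h1 := hmove x (Set.Ioo_subset_Icc_self hx)
      have h2 : M' * (x - s) ≤ M' * δ := by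
        have := hx.2
        gcongr
        linarith
      have h3 : M' * δ = ρ / 2 := by rw [hδ]; field_simp
      have h4 : dist (u x) a < ρ := by
        have := dist_triangle (u x) (u s) a
        have h5 : dist (u s) a < ρ / 2 := hs1
        rw [dist_eq_norm (u x) (u s)] at this
        linarith
      have h5 := hball h4
      nlinarith)
  have := hpos (s + δ) (by linarith)
  nlinarith

end trap

/-- Łojasiewicz convergence theorem for gradient flows in `ℝ^N`. -/
theorem loja_convergence_gradient_flow {N : ℕ}
    (E : EuclideanSpace ℝ (Fin N) → ℝ)
    (hE : ContDiff ℝ 1 E)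
    (hLoj : ∀ a, gradient E a = 0 →
      ∃ c > (0:ℝ), ∃ r > (0:ℝ), ∃ θ ∈ Set.Ioc (0:ℝ) (1/2),
        ∀ v, ‖v - a‖ < r → c * |E v - E a| ^ (1 - θ) ≤ ‖gradient E v‖)
    (u : ℝ → EuclideanSpace ℝ (Fin N))
    (hode : ∀ t ≥ (0:ℝ), HasDerivAt u (-(gradient E (u t))) t)
    (hbdd : ∃ C, ∀ t ≥ (0:ℝ), ‖u t‖ ≤ C) :
    ∃ uLim, gradient E uLim = 0 ∧
      Tendsto (fun t => ‖u t - uLim‖) atTop (𝓝 0) ∧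
      ∀ c > (0:ℝ), ∀ r > (0:ℝ), ∀ θ ∈ Set.Ioc (0:ℝ) (1/2),
        (∀ v, ‖v - uLim‖ < r → c * |E v - E uLim| ^ (1 - θ) ≤ ‖gradient E v‖) →
        (θ = 1/2 → ∃ δ > (0:ℝ),
          (fun t => ‖u t - uLim‖) =O[atTop] fun t => Real.exp (-δ * t)) ∧
        (θ < 1/2 →
          (fun t => ‖u t - uLim‖) =O[atTop] fun t : ℝ => t ^ (-θ / (1 - 2*θ))) := by
  set g := gradient E with hgdef
  have hgc : Continuous g := by
    have : Continuous (fun v => (InnerProductSpace.toDual ℝ (EuclideanSpace ℝ (Fin N))).symm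
        (fderiv ℝ E v)) :=
      (LinearIsometryEquiv.continuous _).comp (hE.continuous_fderiv one_ne_zero)
    exact this
  have hgrad : ∀ v, HasGradientAt E (g v) v := fun v =>
    ((hE.differentiable one_ne_zero) v).hasGradientAt
  have he : ∀ t ≥ (0:ℝ), HasDerivAt (fun t => E (u t)) (-(‖g (u t)‖ ^ 2)) t := by
    intro t ht
    have h1 := (hgrad (u t)).hasFDerivAt.comp_hasDerivAt t (hode t ht)
    have h2 : (InnerProductSpace.toDual ℝ (EuclideanSpace ℝ (Fin N)) (g (u t))) (-(g (u t)))
        = -(‖g (u t)‖ ^ 2) := by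
      rw [InnerProductSpace.toDual_apply_apply, inner_neg_right, real_inner_self_eq_norm_sq]
    rw [h2] at h1
    exact h1
  have hanti : ∀ s ≥ (0:ℝ), ∀ t ≥ s, E (u t) ≤ E (u s) := by
    intro s hs t hst
    have := loja_le_lin (f := fun t => E (u t)) (C := 0) hst
      (fun x hx => he x (hs.trans hx.1)) (fun x _ => by simp)
    simpa using this
  obtain ⟨C, hC⟩ := hbdd
  have hcpt := isCompact_closedBall (0 : EuclideanSpace ℝ (Fin N)) C
  obtain ⟨M, hM⟩ := hcpt.exists_bound_of_continuousOn hgc.continuousOn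
  have hmem : ∀ t ≥ (0:ℝ), u t ∈ Metric.closedBall (0 : EuclideanSpace ℝ (Fin N)) C :=
    fun t ht => by simpa using hC t ht
  obtain ⟨a, -, ha⟩ := hcpt.exists_mapClusterPt (f := atTop) (u := u)
    (by
      rw [le_principal_iff, mem_map]
      filter_upwards [eventually_ge_atTop (0:ℝ)] with t ht using hmem t ht)
  have hEc : Continuous E := hE.continuous
  set h : ℝ → ℝ := fun t => E (u t) - E a with hh_def
  have hh : ∀ t ≥ (0:ℝ), HasDerivAt h (-(‖g (u t)‖ ^ 2)) t :=
    fun t ht => (he t ht).sub_const _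
  have hnn : ∀ t ≥ (0:ℝ), 0 ≤ h t := by
    intro t ht
    by_contra hlt
    have hlt' : E (u t) < E a := by simp only [hh_def] at hlt; linarith
    have hf := ha.frequently (hEc.continuousAt.eventually (lt_mem_nhds hlt'))
    obtain ⟨s, hs1, hs2⟩ := (hf.and_eventually (eventually_ge_atTop t)).exists
    have := hanti t ht s hs2
    linarith
  have hlim : Tendsto h atTop (𝓝 0) := by
    rw [Metric.tendsto_atTop]
    intro ε hε
    have hf := ha.frequently (hEc.continuousAt.eventually
      (gt_mem_nhds (show E a < E a + ε by linarith)))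
    obtain ⟨s, hs1, hs2⟩ := (hf.and_eventually (eventually_ge_atTop 0)).exists
    refine ⟨s, fun t ht => ?_⟩
    have h1 := hanti s hs2 t ht
    have h2 := hnn t (hs2.trans ht)
    rw [Real.dist_eq, sub_zero, abs_of_nonneg h2]
    simp only [hh_def]
    linarith
  by_cases hz : ∃ t0 ≥ (0:ℝ), h t0 = 0
  · obtain ⟨t0, ht0, hz⟩ := hz
    have hz' : ∀ t ≥ t0, h t = 0 := by
      intro t ht
      refine le_antisymm ?_ (hnn t (ht0.trans ht))
      have := hanti t0 ht0 t ht
      simp only [hh_def] at hz ⊢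
      linarith
    have hg0 : ∀ t > t0, g (u t) = 0 := by
      intro t ht
      have h1 := hh t (ht0.trans ht.le)
      have h2 : HasDerivAt h 0 t := by
        refine (hasDerivAt_const t (0:ℝ)).congr_of_eventuallyEq ?_
        filter_upwards [lt_mem_nhds ht] with x hx using hz' x hx.le
      have h3 := h1.unique h2
      simpa using h3
    have hconst : ∀ t ≥ t0 + 1, u t = u (t0 + 1) := by
      intro t ht
      refine constant_of_has_deriv_right_zero (a := t0 + 1) (b := t)
        (fun x hx => (hode x (by linarith [hx.1])).continuousAt.continuousWithinAt)
        (fun x hx => ?_) t (Set.right_mem_Icc.2 ht)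
      have h1 := hode x (by linarith [hx.1])
      have h2 : gradient E (u x) = 0 := hg0 x (by linarith [hx.1])
      rw [show g (u x) = 0 from h2, neg_zero] at h1
      exact h1.hasDerivWithinAt
    have hev : (fun t => ‖u t - u (t0 + 1)‖) =ᶠ[atTop] fun _ => (0:ℝ) := by
      filter_upwards [eventually_ge_atTop (t0 + 1)] with t ht
      rw [hconst t ht]; simp
    refine ⟨u (t0 + 1), hg0 _ (by linarith), tendsto_const_nhds.congr' hev.symm, ?_⟩
    intro c hc r hr θ hθ _
    exact ⟨fun _ => ⟨1, one_pos, hev.trans_isBigO (isBigO_zero _ _)⟩,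
      fun _ => hev.trans_isBigO (isBigO_zero _ _)⟩
  have hpos : ∀ t ≥ (0:ℝ), 0 < h t := fun t ht =>
    lt_of_le_of_ne (hnn t ht) (fun hc => hz ⟨t, ht, hc.symm⟩)
  have hga : g a = 0 := loja_crit u g hgc h a M (fun t ht => hM _ (hmem t ht)) hode hh hnn hlim ha
  have htrap : ∀ c > (0:ℝ), ∀ r > (0:ℝ), ∀ θ ∈ Set.Ioc (0:ℝ) (1/2),
      (∀ v, ‖v - a‖ < r → c * |E v - E a| ^ (1 - θ) ≤ ‖g v‖) →
      ∀ s ≥ (0:ℝ), ‖u s - a‖ + 2 / (θ * c) * h s ^ θ < r →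
      ∀ t ≥ s, ‖u t - u s‖ ≤ 2 / (θ * c) * h s ^ θ := by
    intro c hc r hr θ hθ hL s hs hsr
    refine loja_trap u (fun t => g (u t)) h a c r θ s hc hθ.1
      (fun t ht => hode t (hs.trans ht)) (fun t ht => hh t (hs.trans ht))
      (fun t ht => hpos t (hs.trans ht)) ?_ hsr
    intro t ht htr
    have := hL (u t) htr
    rwa [abs_of_nonneg (hnn t (hs.trans ht))] at this
  have hpow : ∀ K θ : ℝ, 0 < θ → Tendsto (fun t => K * h t ^ θ) atTop (𝓝 0) := by
    intro K θ hθ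
    have := (hlim.rpow_const (p := θ) (Or.inr hθ.le)).const_mul K
    simpa [Real.zero_rpow hθ.ne'] using this
  have hconv : Tendsto (fun t => ‖u t - a‖) atTop (𝓝 0) := by
    obtain ⟨c, hc, r, hr, θ, hθ, hL⟩ := hLoj a hga
    rw [Metric.tendsto_atTop]
    intro ε hε
    set η := min (r / 2) (ε / 2) with hη
    have hη0 : 0 < η := by positivity
    have hηr : η ≤ r / 2 := min_le_left _ _
    have hηε : η ≤ ε / 2 := min_le_right _ _
    have hf := ha.frequently (Metric.ball_mem_nhds a hη0)
    have hp := (hpow (2 / (θ * c)) θ hθ.1).eventually (gt_mem_nhds hη0)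
    obtain ⟨s, hs1, hs2, hs0⟩ := (hf.and_eventually (hp.and (eventually_ge_atTop 0))).exists
    have hs1' : ‖u s - a‖ < η := by rw [← dist_eq_norm]; exact hs1
    refine ⟨s, fun t ht => ?_⟩
    have h1 := htrap c hc r hr θ hθ hL s hs0 (by linarith) t ht
    have h2 : ‖u t - a‖ ≤ ‖u t - u s‖ + ‖u s - a‖ := by
      simpa using norm_add_le (u t - u s) (u s - a)
    rw [Real.dist_eq, sub_zero, abs_of_nonneg (norm_nonneg _)]
    linarith
  refine ⟨a, hga, hconv, ?_⟩
  intro c hc r hr θ hθ hL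
  have hua : Tendsto u atTop (𝓝 a) := tendsto_iff_norm_sub_tendsto_zero.2 hconv
  have hev : ∀ᶠ s in atTop, 0 ≤ s ∧ ‖u s - a‖ < r ∧ ‖u s - a‖ ≤ 2 / (θ * c) * h s ^ θ := by
    have h1 : Tendsto (fun s => ‖u s - a‖ + 2 / (θ * c) * h s ^ θ) atTop (𝓝 0) := by
      simpa using hconv.add (hpow (2 / (θ * c)) θ hθ.1)
    filter_upwards [h1.eventually (gt_mem_nhds hr), hconv.eventually (gt_mem_nhds hr),
      eventually_ge_atTop (0:ℝ)] with s hs1 hs2 hs0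
    refine ⟨hs0, hs2, ?_⟩
    have h3 := htrap c hc r hr θ hθ hL s hs0 hs1
    have h4 : Tendsto (fun t => ‖u t - u s‖) atTop (𝓝 ‖a - u s‖) := (hua.sub_const (u s)).norm
    rw [norm_sub_rev]
    refine le_of_tendsto h4 ?_
    filter_upwards [eventually_ge_atTop s] with t ht using h3 t ht
  obtain ⟨T0, hT0⟩ := eventually_atTop.1 hev
  set T := max T0 1 with hT
  have hT1 : 1 ≤ T := le_max_right _ _
  have hTp : ∀ t ≥ T, 0 ≤ t ∧ ‖u t - a‖ < r ∧ ‖u t - a‖ ≤ 2 / (θ * c) * h t ^ θ :=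
    fun t ht => hT0 t ((le_max_left _ _).trans ht)
  have hθ0 := hθ.1
  have hd : ∀ t ≥ T, -(‖g (u t)‖ ^ 2) ≤ -(c ^ 2 * h t ^ (1 + (1 - 2 * θ))) := by
    intro t ht
    obtain ⟨ht0, htr, -⟩ := hTp t ht
    have h1 := hL (u t) htr
    rw [abs_of_nonneg (hnn t ht0)] at h1
    have hp := hpos t ht0
    have h2 : h t ^ (1 + (1 - 2 * θ)) = (h t ^ (1 - θ)) ^ 2 := by
      rw [pow_two, ← Real.rpow_add hp]; ring_nf
    rw [h2, ← mul_pow]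
    have : 0 ≤ c * h t ^ (1 - θ) := by positivity
    exact neg_le_neg (pow_le_pow_left₀ this h1 2)
  have hhT : ∀ t ≥ T, HasDerivAt h (-(‖g (u t)‖ ^ 2)) t := fun t ht => hh t (hTp t ht).1
  constructor
  · intro hhalf
    refine ⟨c ^ 2 / 2, by positivity, ?_⟩
    have hdec := loja_decay_exp h (fun t => -(‖g (u t)‖ ^ 2)) (c ^ 2) T hhT (fun t ht => by
      have := hd t ht
      rw [hhalf] at this
      norm_num at this ⊢
      exact this)
    refine IsBigO.of_bound (2 / (θ * c) * (h T * Real.exp (c ^ 2 * T)) ^ θ) ?_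
    filter_upwards [eventually_ge_atTop T] with t ht
    obtain ⟨ht0, -, hb⟩ := hTp t ht
    have hp := hpos t ht0
    have hpT := hpos T (by linarith)
    rw [norm_norm, Real.norm_eq_abs, abs_of_pos (Real.exp_pos _)]
    refine hb.trans ?_
    rw [mul_assoc]
    refine mul_le_mul_of_nonneg_left ?_ (by positivity)
    refine (Real.rpow_le_rpow hp.le (hdec t ht) hθ0.le).trans_eq ?_
    rw [Real.mul_rpow (by positivity) (by positivity), ← Real.exp_mul, hhalf]
    congr 2
    ring
  · intro hlt
    have hp0 : 0 < 1 - 2 * θ := by linarith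
    have hdec := loja_decay_poly h (fun t => -(‖g (u t)‖ ^ 2)) (c ^ 2) (1 - 2 * θ) T hp0 hhT
      (fun t ht => hpos t (hTp t ht).1) hd
    set κ := (1 - 2 * θ) * c ^ 2 / 2 with hκ
    have hκ0 : 0 < κ := by positivity
    refine IsBigO.of_bound (2 / (θ * c) * κ ^ (-θ / (1 - 2 * θ))) ?_
    filter_upwards [eventually_ge_atTop (2 * T)] with t ht
    have htT : T ≤ t := by linarith
    obtain ⟨ht0, -, hb⟩ := hTp t htT
    have hp := hpos t ht0
    have htp : 0 < t := by linarith
    rw [norm_norm, Real.norm_eq_abs, abs_of_pos (Real.rpow_pos_of_pos htp _)]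
    refine hb.trans ?_
    rw [mul_assoc]
    refine mul_le_mul_of_nonneg_left ?_ (by positivity)
    rw [← Real.mul_rpow hκ0.le htp.le]
    have h1 : κ * t ≤ h t ^ (-(1 - 2 * θ)) := by
      refine le_trans ?_ (hdec t htT)
      have : κ * t = (1 - 2 * θ) * c ^ 2 * (t / 2) := by rw [hκ]; ring
      rw [this]
      gcongr
      linarith
    have h2 : h t ^ θ = (h t ^ (-(1 - 2 * θ))) ^ (-θ / (1 - 2 * θ)) := by
      rw [← Real.rpow_mul hp.le]
      congr 1
      rw [neg_mul, neg_div, mul_neg, neg_neg, mul_div_cancel₀ _ hp0.ne']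
    rw [h2]
    refine Real.rpow_le_rpow_of_nonpos (by positivity) h1 ?_
    exact div_nonpos_of_nonpos_of_nonneg (by linarith) hp0.le
end

section
/- Let E : ℝ^N → ℝ be continuously differentiable (so ∇E is continuous) and let u : [0,∞) → ℝ^N be a bounded solution of u'(t) = -∇E(u(t)). Then ‖u'(t)‖ → 0 as t → ∞, and consequently dist(u(t), 𝓔) → 0 as t → ∞, where 𝓔 = {a ∈ ℝ^N : ∇E(a) = 0} is the set of critical points of E. -/
open Filter Topology

/-- For a bounded solution of the gradient system of a `C¹` energy,
the velocity tends to `0` and the solution approaches the set of critical points. -/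
theorem velocity_tendsto_zero_and_dist_critical {N : ℕ}
    (E : EuclideanSpace ℝ (Fin N) → ℝ)
    (hE : ContDiff ℝ 1 E)
    (u : ℝ → EuclideanSpace ℝ (Fin N))
    (hode : ∀ t ≥ (0:ℝ), HasDerivAt u (-(gradient E (u t))) t)
    (hbdd : ∃ C, ∀ t ≥ (0:ℝ), ‖u t‖ ≤ C) :
    Tendsto (fun t => ‖deriv u t‖) atTop (𝓝 0) ∧
    Tendsto (fun t => Metric.infDist (u t) {a | gradient E a = 0}) atTop (𝓝 0) := by
  obtain ⟨C, hC⟩ := hbdd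
  have hdiff : Differentiable ℝ E := hE.differentiable (by norm_num)
  have hG : Continuous (gradient E) := by
    have h1 : Continuous (fderiv ℝ E) := hE.continuous_fderiv (by norm_num)
    exact (InnerProductSpace.toDual ℝ (EuclideanSpace ℝ (Fin N))).symm.continuous.comp h1
  have hK : IsCompact (Metric.closedBall (0 : EuclideanSpace ℝ (Fin N)) C) :=
    isCompact_closedBall _ _
  have huK : ∀ t ≥ (0:ℝ), u t ∈ Metric.closedBall (0 : EuclideanSpace ℝ (Fin N)) C := by
    intro t ht
    simpa using hC t ht
  obtain ⟨M, hM⟩ := hK.exists_bound_of_continuousOn hG.continuousOn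
  obtain ⟨B, hB⟩ := hK.exists_bound_of_continuousOn hE.continuous.continuousOn
  have hM0 : 0 ≤ M := (norm_nonneg _).trans (hM _ (huK 0 le_rfl))
  have hg : ∀ t ≥ (0:ℝ), HasDerivAt (fun s => E (u s)) (-‖gradient E (u t)‖ ^ 2) t := by
    intro t ht
    have h1 := ((hdiff (u t)).hasGradientAt.hasFDerivAt).comp_hasDerivAt t (hode t ht)
    have h2 : ((InnerProductSpace.toDual ℝ (EuclideanSpace ℝ (Fin N))) (gradient E (u t)))
        (-gradient E (u t)) = -‖gradient E (u t)‖ ^ 2 := by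
      rw [InnerProductSpace.toDual_apply_apply, inner_neg_right, real_inner_self_eq_norm_sq]
    rw [h2] at h1
    exact h1
  have hdec : ∀ c : ℝ, ∀ a b : ℝ, 0 ≤ a → a ≤ b →
      (∀ s ∈ Set.Icc a b, c ≤ ‖gradient E (u s)‖ ^ 2) → E (u b) ≤ E (u a) - c * (b - a) := by
    intro c a b ha hab h
    have := (convex_Icc a b).image_sub_le_mul_sub_of_deriv_le (f := fun s => E (u s)) (C := -c)
      (fun s hs => (hg s (ha.trans hs.1)).continuousAt.continuousWithinAt)
      (fun s hs => by
        rw [interior_Icc] at hs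
        exact (hg s (ha.trans hs.1.le)).differentiableAt.differentiableWithinAt)
      (fun s hs => by
        rw [interior_Icc] at hs
        rw [(hg s (ha.trans hs.1.le)).deriv]
        linarith [h s ⟨hs.1.le, hs.2.le⟩])
      a ⟨le_rfl, hab⟩ b ⟨hab, le_rfl⟩ hab
    linarith
  have hlip : ∀ a b : ℝ, 0 ≤ a → a ≤ b → ‖u b - u a‖ ≤ M * (b - a) := by
    intro a b ha hab
    have := (convex_Icc a b).norm_image_sub_le_of_norm_hasDerivWithin_le (f := u) (C := M)
      (fun s hs => (hode s (ha.trans hs.1)).hasDerivWithinAt)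
      (fun s hs => by
        rw [norm_neg]
        exact hM _ (huK s (ha.trans hs.1)))
      (x := a) (y := b) ⟨le_rfl, hab⟩ ⟨hab, le_rfl⟩
    rwa [Real.norm_of_nonneg (by linarith)] at this
  -- convergence of the energy
  have hconv : ∃ L, Tendsto (fun t => E (u (max t 0))) atTop (𝓝 L) := by
    refine ⟨_, tendsto_atTop_ciInf ?_ ?_⟩
    · intro a b hab
      have := hdec 0 (max a 0) (max b 0) (le_max_right _ _) (max_le_max_right 0 hab)
        (fun s _ => by positivity)
      simpa using this
    · refine ⟨-B, ?_⟩
      rintro _ ⟨t, rfl⟩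
      have := hB _ (huK (max t 0) (le_max_right _ _))
      exact (abs_le.1 this).1
  obtain ⟨L, hL⟩ := hconv
  have hmain : Tendsto (fun t => ‖gradient E (u t)‖) atTop (𝓝 0) := by
    rw [Metric.tendsto_atTop']
    intro ε hε
    obtain ⟨δ, hδ, hδ'⟩ := Metric.uniformContinuousOn_iff.1
      (hK.uniformContinuousOn_of_continuous hG.continuousOn) (ε / 2) (by positivity)
    set h : ℝ := δ / (M + 1) with hh
    have hpos : 0 < h := by positivity
    have hMh : M * h < δ := by
      rw [hh, mul_div_assoc', div_lt_iff₀ (by positivity)]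
      nlinarith
    have hshift : Tendsto (fun t => E (u (max t 0)) - E (u (max (t + h) 0))) atTop (𝓝 0) := by
      simpa using hL.sub (hL.comp (tendsto_atTop_add_const_right atTop h tendsto_id))
    have hev := hshift.eventually_lt_const (show (0:ℝ) < (ε / 2) ^ 2 * h by positivity)
    obtain ⟨T, hT⟩ := eventually_atTop.1 hev
    refine ⟨max T 0, fun t ht => ?_⟩
    have ht0 : 0 ≤ t := (le_max_right _ _).trans ht.le
    have h1 := hT t ((le_max_left _ _).trans ht.le)
    rw [max_eq_left ht0, max_eq_left (by linarith : 0 ≤ t + h)] at h1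
    rw [Real.dist_eq, sub_zero, abs_of_nonneg (norm_nonneg _)]
    by_contra! hcon
    have h2 := hdec ((ε / 2) ^ 2) t (t + h) ht0 (by linarith) (by
      intro s hs
      have h3 := hlip t s ht0 hs.1
      have h4 : dist (u s) (u t) < δ := by
        rw [dist_eq_norm]
        refine (h3.trans ?_).trans_lt hMh
        exact mul_le_mul_of_nonneg_left (by linarith [hs.2]) hM0
      have h5 := hδ' _ (huK s (ht0.trans hs.1)) _ (huK t ht0) h4
      rw [dist_eq_norm, norm_sub_rev] at h5
      have h6 := norm_sub_norm_le (gradient E (u t)) (gradient E (u s))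
      exact pow_le_pow_left₀ (by positivity) (by linarith) 2)
    have h7 : t + h - t = h := by ring
    rw [h7] at h2
    linarith
  refine ⟨?_, ?_⟩
  · refine hmain.congr' ?_
    filter_upwards [eventually_ge_atTop (0:ℝ)] with t ht
    rw [(hode t ht).deriv, norm_neg]
  · rw [Metric.tendsto_nhds]
    intro ε hε
    set S : Set (EuclideanSpace ℝ (Fin N)) := {a | gradient E a = 0} with hS
    have hK' : IsCompact (Metric.closedBall (0 : EuclideanSpace ℝ (Fin N)) C ∩
        {x | ε ≤ Metric.infDist x S}) :=
      hK.inter_right (isClosed_le continuous_const (Metric.continuous_infDist_pt S))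
    rcases Set.eq_empty_or_nonempty (Metric.closedBall (0 : EuclideanSpace ℝ (Fin N)) C ∩
        {x | ε ≤ Metric.infDist x S}) with hemp | hne
    · filter_upwards [eventually_ge_atTop (0:ℝ)] with t ht
      rw [Real.dist_eq, sub_zero, abs_of_nonneg Metric.infDist_nonneg]
      by_contra! hcon
      exact (Set.eq_empty_iff_forall_notMem.1 hemp (u t)) ⟨huK t ht, hcon⟩
    · obtain ⟨x, hx, hmin⟩ := hK'.exists_isMinOn hne hG.norm.continuousOn
      have hxpos : 0 < ‖gradient E x‖ := by
        rw [norm_pos_iff]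
        intro h0
        have h1 : Metric.infDist x S = 0 := Metric.infDist_zero_of_mem h0
        have h2 : ε ≤ Metric.infDist x S := hx.2
        linarith
      filter_upwards [eventually_ge_atTop (0:ℝ), hmain.eventually_lt_const hxpos] with t ht hlt
      rw [Real.dist_eq, sub_zero, abs_of_nonneg Metric.infDist_nonneg]
      by_contra! hcon
      have h3 : ‖gradient E x‖ ≤ ‖gradient E (u t)‖ := hmin ⟨huK t ht, hcon⟩
      linarith
end

section
/- Let H = H₊ - H₋ where H₊, H₋ : ℝ^N → ℝ are C¹, H₊ is κ-convex, H₋ is μ-convex, and κ + μ > 0. If the sequence {u^n}_{n≥0} satisfies the DC algorithm relation ∇H₊(u^{n+1}) = ∇H₋(u^n) for all n, then for every n, H(u^{n+1}) - H(u^n) ≤ -((κ+μ)/2)·‖u^{n+1} - u^n‖²; in particular H(u^{n+1}) ≤ H(u^n). -/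
lemma dc_aux {N : ℕ} (f : EuclideanSpace ℝ (Fin N) → ℝ) (c : ℝ)
    (hf : ContDiff ℝ 1 f)
    (hc : ConvexOn ℝ Set.univ (fun x => f x - c/2 * ‖x‖^2))
    (x y : EuclideanSpace ℝ (Fin N)) :
    f x + inner ℝ (gradient f x) (y - x) + c/2 * ‖y - x‖^2 ≤ f y := by
  have hline : HasDerivAt (fun t : ℝ => AffineMap.lineMap x y t) (y - x) 0 :=
    AffineMap.hasDerivAt_lineMap
  have hg : HasFDerivAt f (fderiv ℝ f x) (AffineMap.lineMap x y (0:ℝ)) := by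
    rw [AffineMap.lineMap_apply_zero]
    exact (hf.differentiable (by norm_num) x).hasFDerivAt
  have h1 := hg.comp_hasDerivAt (0:ℝ) hline
  have h2 := hline.norm_sq
  have h3 := h1.sub (h2.const_mul (c/2))
  have hconv := hc.comp_affineMap (AffineMap.lineMap x y : ℝ →ᵃ[ℝ] _)
  have h4 := hconv.le_slope_of_hasDerivAt (x := 0) (y := 1) (by simp) (by simp) one_pos h3
  have h5 : inner ℝ (gradient f x) (y - x) = fderiv ℝ f x (y - x) := by
    simp [gradient]
  have h6 : ‖y‖^2 = ‖x‖^2 + 2 * inner ℝ x (y - x) + ‖y - x‖^2 := by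
    rw [← norm_add_sq_real]; simp
  simp only [slope_def_field, Function.comp, AffineMap.lineMap_apply_zero,
    AffineMap.lineMap_apply_one, h6] at h4
  rw [h5]
  linarith

/-- Energy monotonicity of the DC algorithm: for a convex splitting
`H = H₊ - H₋` with `H₊` `κ`-convex, `H₋` `μ`-convex and `κ + μ > 0`, the DC iteration
`∇H₊(uⁿ⁺¹) = ∇H₋(uⁿ)` decreases the energy by at least `((κ+μ)/2)‖uⁿ⁺¹ - uⁿ‖²`. -/
theorem dc_algorithm_energy_decrease {N : ℕ}
    (Hp Hm : EuclideanSpace ℝ (Fin N) → ℝ) (κ μ : ℝ)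
    (hHp : ContDiff ℝ 1 Hp) (hHm : ContDiff ℝ 1 Hm)
    (hκconv : ConvexOn ℝ Set.univ (fun x => Hp x - κ/2 * ‖x‖^2))
    (hμconv : ConvexOn ℝ Set.univ (fun x => Hm x - μ/2 * ‖x‖^2))
    (hκμ : 0 < κ + μ)
    (H : EuclideanSpace ℝ (Fin N) → ℝ) (hHdef : ∀ x, H x = Hp x - Hm x)
    (u : ℕ → EuclideanSpace ℝ (Fin N))
    (hDC : ∀ n, gradient Hp (u (n+1)) = gradient Hm (u n)) :
    ∀ n, H (u (n+1)) - H (u n) ≤ -((κ + μ)/2) * ‖u (n+1) - u n‖^2 ∧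
      H (u (n+1)) ≤ H (u n) := by
  intro n
  have h1 := dc_aux Hp κ hHp hκconv (u (n+1)) (u n)
  have h2 := dc_aux Hm μ hHm hμconv (u n) (u (n+1))
  rw [hDC n, ← neg_sub (u (n+1)) (u n), inner_neg_right, norm_neg] at h1
  have h3 : H (u (n+1)) - H (u n) ≤ -((κ + μ)/2) * ‖u (n+1) - u n‖^2 := by
    rw [hHdef, hHdef]
    linarith
  refine ⟨h3, ?_⟩
  have : 0 ≤ (κ + μ)/2 * ‖u (n+1) - u n‖^2 := by positivity
  linarith
end

section
/- Let H : ℝ^N → ℝ satisfy the Łojasiewicz inequality at every critical point, with H = H₊ - H₋ where H₊ is κ-convex and L-smooth and H₋ is μ-convex. Let b : ℝ^N → ℝ be differentiable with ∇b Lipschitz with constant β, where β ∈ (0, (κ+μ)/2). Then every bounded sequence {u^n}_{n≥0} (with u^{-1} := u^0) satisfying the DC algorithm with momentum ∇H₊(u^{n+1}) = ∇H₋(u^n) + ∇b(u^n) - ∇b(u^{n-1}) converges. -/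
open Filter Topology

lemma dcm_first_order {N : ℕ} (f : EuclideanSpace ℝ (Fin N) → ℝ) (κ : ℝ)
    (hf : Differentiable ℝ f)
    (hc : ConvexOn ℝ Set.univ (fun x => f x - κ/2 * ‖x‖^2))
    (x y : EuclideanSpace ℝ (Fin N)) :
    f x + inner ℝ (gradient f x) (y - x) + κ/2 * ‖y - x‖^2 ≤ f y := by
  have h1 := hc.comp_affineMap (AffineMap.lineMap x y : ℝ →ᵃ[ℝ] EuclideanSpace ℝ (Fin N))
  have hl : HasDerivAt (fun t : ℝ => AffineMap.lineMap x y t) (y - x) (0:ℝ) :=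
    AffineMap.hasDerivAt_lineMap
  have hg : HasDerivAt (f ∘ (fun t : ℝ => AffineMap.lineMap x y t)) (fderiv ℝ f x (y - x)) (0:ℝ) := by
    refine HasFDerivAt.comp_hasDerivAt (0:ℝ) ?_ hl
    simpa using (hf x).hasFDerivAt
  have hn := (hl.norm_sq).const_mul (κ/2)
  have hd := hg.sub hn
  have h2 := h1.le_slope_of_hasDerivAt (x := 0) (y := 1) (by simp) (by simp) one_pos hd
  simp [slope_def_field] at h2
  have h3 : ‖y - x‖^2 = ‖y‖^2 - 2 * inner ℝ y x + ‖x‖^2 := norm_sub_sq_real y x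
  have h4 : inner ℝ x (y - x) = inner ℝ y x - ‖x‖^2 := by
    rw [inner_sub_right, real_inner_self_eq_norm_sq, real_inner_comm]
  rw [h4] at h2
  rw [h3, inner_gradient_left, map_sub]
  nlinarith

lemma dcm_trap {X : Type*} [PseudoMetricSpace X] (u : ℕ → X) (a : X) (P : ℕ → ℝ) (ρ : ℝ)
    (hρ : 0 < ρ) (n0 : ℕ) (hP0 : ∀ n, 0 ≤ P n) (hP : Tendsto P atTop (𝓝 0))
    (ha : MapClusterPt a atTop u)
    (h : ∀ n ≥ n0, dist (u n) a < ρ → dist (u (n+1)) (u n) ≤ P n - P (n+1)) :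
    Tendsto u atTop (𝓝 a) := by
  rw [Metric.tendsto_atTop]
  intro ε hε
  set η := min ε ρ with hη
  have hη0 : 0 < η := lt_min hε hρ
  have h1 : ∀ᶠ n in atTop, P n < η/2 := hP.eventually (gt_mem_nhds (by positivity))
  have h2 : ∃ᶠ n in atTop, dist (u n) a < η/2 :=
    ha.frequently (Metric.ball_mem_nhds a (by positivity : 0 < η/2))
  obtain ⟨n, hn1, hn2, hn3⟩ := (h2.and_eventually (h1.and (eventually_ge_atTop n0))).exists
  have key : ∀ k, n ≤ k → dist (u k) a + P k < η := by
    intro k hk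
    induction k, hk using Nat.le_induction with
    | base => linarith
    | succ k hk ih =>
      have hd : dist (u k) a < ρ := by
        have := hP0 k; have := min_le_right ε ρ; linarith
      have := h k (by omega) hd
      have := dist_triangle (u (k+1)) (u k) a
      linarith
  refine ⟨n, fun k hk => ?_⟩
  have := key k hk; have := hP0 k; have := min_le_left ε ρ
  linarith

lemma dcm_kl (θ δ C d e r r' : ℝ) (hθ0 : 0 < θ) (hθ : θ ≤ 1/2) (hδ : 0 < δ) (hC : 0 < C)
    (hd : 0 ≤ d) (he : 0 ≤ e) (hr : 0 ≤ r) (hr' : 0 ≤ r')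
    (h1 : δ * d^2 ≤ r - r') (h2 : r ^ (1 - θ) ≤ C * (d + e)) :
    d ≤ (e + 4 * (C/(θ*δ)) * r^θ) - (d + 4 * (C/(θ*δ)) * r'^θ) := by
  have hle : r' ≤ r := by nlinarith [mul_nonneg hδ.le (sq_nonneg d)]
  have hD : 0 ≤ r^θ - r'^θ := sub_nonneg.2 (Real.rpow_le_rpow hr' hle hθ0.le)
  have hmain : θ * (r - r') ≤ r^(1-θ) * (r^θ - r'^θ) := by
    rcases hr.eq_or_lt with h0 | h0
    · have : r' = 0 := by linarith
      subst this; rw [← h0]; simp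
    · have hb := rpow_one_add_le_one_add_mul_self (s := r'/r - 1)
        (by have : 0 ≤ r'/r := by positivity
            linarith) hθ0.le (by linarith)
      rw [add_sub_cancel, Real.div_rpow hr' hr, div_le_iff₀ (by positivity)] at hb
      have hm : r^(1-θ) * r^θ = r := by
        rw [← Real.rpow_add h0]; simp
      have h5 : r^(1-θ) * r'^θ ≤ r^(1-θ) * ((1 + θ * (r'/r - 1)) * r^θ) :=
        mul_le_mul_of_nonneg_left hb (by positivity)
      have h6 : r^(1-θ) * ((1 + θ * (r'/r - 1)) * r^θ) = r + θ * (r' - r) := by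
        calc _ = (r^(1-θ) * r^θ) * (1 + θ * (r'/r - 1)) := by ring
          _ = _ := by rw [hm]; field_simp
      rw [mul_sub (r^(1-θ)), hm]; linarith
  set D := r^θ - r'^θ with hDdef
  have h7 : θ * δ * d^2 ≤ C * (d + e) * D := by
    have := mul_le_mul_of_nonneg_right h2 hD
    nlinarith
  set K := C/(θ*δ) with hK
  have hK0 : 0 ≤ K * D := by positivity
  have h8 : d^2 ≤ K * D * (d + e) := by
    have : K * D * (d+e) = C * (d+e) * D / (θ * δ) := by rw [hK]; field_simp
    rw [this, le_div_iff₀ (by positivity)]; linarith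
  have h9 : d ≤ e/2 + 2 * (K * D) := by
    by_contra hcon
    push Not at hcon
    have hpos : 0 < d := by linarith
    have : K * D * (d+e) ≤ (d/2 - e/4) * (d + e) :=
      mul_le_mul_of_nonneg_right (by linarith) (by linarith)
    nlinarith [sq_nonneg (d - 2*e), mul_pos hpos hpos]
  have : K * D = K * r^θ - K * r'^θ := by rw [hDdef]; ring
  linarith

lemma dcm_pow (p h e g β c L d : ℝ) (hp : 1/2 ≤ p) (hp1 : p ≤ 1) (hc : 0 < c) (hL : 0 < L)
    (hβ : 0 < β) (hd : 0 ≤ d)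
    (he : 0 ≤ e) (he1 : e ≤ 1) (hr : 0 ≤ h + β/2 * e^2) (h1 : c * |h|^p ≤ g)
    (h2 : g ≤ L * d + β * e) :
    (h + β/2 * e^2)^p ≤ ((L + β)/c + (β/2)^p) * (d + e) := by
  have hp0 : 0 ≤ p := by linarith
  have a1 : (h + β/2 * e^2)^p ≤ (|h| + β/2 * e^2)^p :=
    Real.rpow_le_rpow hr (by linarith [le_abs_self h]) hp0
  have a2 : (|h| + β/2 * e^2)^p ≤ |h|^p + (β/2 * e^2)^p :=
    Real.rpow_add_le_add_rpow (abs_nonneg h) (by positivity) hp0 hp1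
  have a3 : (β/2 * e^2)^p = (β/2)^p * (e^2)^p := Real.mul_rpow (by positivity) (by positivity)
  have a4 : (e^2)^p ≤ e := by
    rw [← Real.rpow_natCast, ← Real.rpow_mul he]
    calc _ ≤ e ^ (1:ℝ) := Real.rpow_le_rpow_of_exponent_ge' he he1 zero_le_one (by push_cast; linarith)
      _ = e := Real.rpow_one e
  have a5 : |h|^p ≤ (L + β)/c * (d + e) := by
    rw [div_mul_eq_mul_div, le_div_iff₀ hc]
    nlinarith [mul_nonneg hL.le he, mul_nonneg hβ.le hd]
  have a6 : (β/2)^p * (e^2)^p ≤ (β/2)^p * (d+e) :=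
    mul_le_mul_of_nonneg_left (by linarith) (by positivity)
  linarith

/-- Convergence of the DC algorithm with momentum: with `H = H₊ - H₋`
satisfying the Łojasiewicz inequality at every critical point, `H₊` `κ`-convex and
`L`-smooth, `H₋` `μ`-convex, and momentum `b` whose gradient is `β`-Lipschitz with
`β ∈ (0, (κ+μ)/2)`, every bounded sequence of the momentum iteration
`∇H₊(uⁿ⁺¹) = ∇H₋(uⁿ) + ∇b(uⁿ) - ∇b(uⁿ⁻¹)` (with `u⁻¹ := u⁰`) converges. -/
theorem dc_momentum_convergence {N : ℕ}
    (Hp Hm : EuclideanSpace ℝ (Fin N) → ℝ) (κ μ L : ℝ)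
    (hHp : ContDiff ℝ 1 Hp) (hHm : ContDiff ℝ 1 Hm)
    (hκconv : ConvexOn ℝ Set.univ (fun x => Hp x - κ/2 * ‖x‖^2))
    (hμconv : ConvexOn ℝ Set.univ (fun x => Hm x - μ/2 * ‖x‖^2))
    (hL : 0 < L)
    (hLsmooth : LipschitzWith (Real.toNNReal L) (gradient Hp))
    (H : EuclideanSpace ℝ (Fin N) → ℝ) (hHdef : ∀ x, H x = Hp x - Hm x)
    (hLoj : ∀ a, gradient H a = 0 →
      ∃ c > (0:ℝ), ∃ r > (0:ℝ), ∃ θ ∈ Set.Ioc (0:ℝ) (1/2),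
        ∀ v, ‖v - a‖ < r → c * |H v - H a| ^ (1 - θ) ≤ ‖gradient H v‖)
    (b : EuclideanSpace ℝ (Fin N) → ℝ) (hb : Differentiable ℝ b)
    (β : ℝ) (hβ0 : 0 < β) (hβ : β < (κ + μ)/2)
    (hbLip : LipschitzWith (Real.toNNReal β) (gradient b))
    (u : ℕ → EuclideanSpace ℝ (Fin N))
    (hbdd : ∃ C, ∀ n, ‖u n‖ ≤ C)
    (hmom : ∀ n, gradient Hp (u (n+1))
      = gradient Hm (u n) + gradient b (u n) - gradient b (u (n - 1))) :
    ∃ uLim, Tendsto u atTop (𝓝 uLim) := by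
  have dHp : Differentiable ℝ Hp := hHp.differentiable one_ne_zero
  have dHm : Differentiable ℝ Hm := hHm.differentiable one_ne_zero
  have gH : ∀ x, gradient H x = gradient Hp x - gradient Hm x := by
    intro x
    have : H = fun x => Hp x - Hm x := funext hHdef
    rw [this]
    unfold gradient
    rw [fderiv_fun_sub (dHp x) (dHm x), map_sub]
  have cH : Continuous H := by
    rw [show H = fun x => Hp x - Hm x from funext hHdef]
    exact dHp.continuous.sub dHm.continuous
  have cgHm : Continuous (gradient Hm) := by
    unfold gradient
    exact (LinearIsometryEquiv.continuous _).comp (hHm.continuous_fderiv one_ne_zero)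
  have cgH : Continuous (gradient H) := by
    rw [show gradient H = fun x => gradient Hp x - gradient Hm x from funext gH]
    exact hLsmooth.continuous.sub cgHm
  have lipP : ∀ x y, ‖gradient Hp x - gradient Hp y‖ ≤ L * ‖x - y‖ := by
    intro x y
    have := hLsmooth.dist_le_mul x y
    rwa [dist_eq_norm, dist_eq_norm, Real.coe_toNNReal L hL.le] at this
  have lipB : ∀ x y, ‖gradient b x - gradient b y‖ ≤ β * ‖x - y‖ := by
    intro x y
    have := hbLip.dist_le_mul x y
    rwa [dist_eq_norm, dist_eq_norm, Real.coe_toNNReal β hβ0.le] at this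
  set e : ℕ → ℝ := fun n => ‖u n - u (n-1)‖ with hedef
  have he0 : ∀ n, 0 ≤ e n := fun n => norm_nonneg _
  have hes : ∀ n, e (n+1) = ‖u (n+1) - u n‖ := fun n => rfl
  set E : ℕ → ℝ := fun n => H (u n) + β/2 * (e n)^2 with hE
  set δ := (κ+μ)/2 - β with hδdef
  have hδ : 0 < δ := by simp only [hδdef]; linarith
  have desc : ∀ n, δ * (e (n+1))^2 ≤ E n - E (n+1) := by
    intro n
    have f1 := dcm_first_order Hp κ dHp hκconv (u (n+1)) (u n)
    have f2 := dcm_first_order Hm μ dHm hμconv (u n) (u (n+1))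
    rw [hmom n] at f1
    have hneg : u n - u (n+1) = -(u (n+1) - u n) := by abel
    rw [hneg, norm_neg, inner_neg_right, ← hes n, add_sub_assoc, inner_add_left] at f1
    rw [← hes n] at f2
    have f3 : inner ℝ (gradient b (u n) - gradient b (u (n-1))) (u (n+1) - u n)
        ≤ β * e n * e (n+1) :=
      (real_inner_le_norm _ _).trans
        (mul_le_mul_of_nonneg_right (lipB _ _) (norm_nonneg _))
    simp only [hE, hHdef, hδdef]
    nlinarith [mul_nonneg hβ0.le (sq_nonneg (e n - e (n+1)))]
  have gbd : ∀ n, ‖gradient H (u n)‖ ≤ L * e (n+1) + β * e n := by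
    intro n
    have : gradient H (u n) = -(gradient Hp (u (n+1)) - gradient Hp (u n))
        + (gradient b (u n) - gradient b (u (n-1))) := by
      rw [gH, hmom n]; abel
    rw [this]
    refine (norm_add_le _ _).trans ?_
    rw [norm_neg]
    exact add_le_add (lipP _ _) (lipB _ _)
  have anti : Antitone E := antitone_nat_of_succ_le (fun n => by
    have := desc n
    have : 0 ≤ δ * (e (n+1))^2 := by positivity
    linarith)
  obtain ⟨R, hR⟩ := hbdd
  have hmem : ∀ n, u n ∈ Metric.closedBall (0 : EuclideanSpace ℝ (Fin N)) R := fun n => by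
    simpa using hR n
  have hcpt := isCompact_closedBall (0 : EuclideanSpace ℝ (Fin N)) R
  have bdd : BddBelow (Set.range E) := by
    obtain ⟨m, hm⟩ := hcpt.bddBelow_image cH.continuousOn
    refine ⟨m, ?_⟩
    rintro _ ⟨n, rfl⟩
    have h1 : m ≤ H (u n) := hm (Set.mem_image_of_mem H (hmem n))
    have h2 : 0 ≤ β/2 * (e n)^2 := by positivity
    simp only [hE]; linarith
  obtain ⟨l, hl⟩ : ∃ l, Tendsto E atTop (𝓝 l) := ⟨_, tendsto_atTop_ciInf anti bdd⟩
  have hlE : ∀ n, 0 ≤ E n - l := fun n => sub_nonneg.2 (anti.le_of_tendsto hl n)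
  have hl1 : Tendsto (fun n => E (n+1)) atTop (𝓝 l) := hl.comp (tendsto_add_atTop_nat 1)
  have hsq : Tendsto (fun n => (e (n+1))^2) atTop (𝓝 0) := by
    have h0 : Tendsto (fun n => (E n - E (n+1))/δ) atTop (𝓝 0) := by
      simpa using (hl.sub hl1).div_const δ
    refine squeeze_zero (fun n => sq_nonneg _) (fun n => ?_) h0
    rw [le_div_iff₀ hδ]; linarith [desc n]
  have he1t : Tendsto (fun n => e (n+1)) atTop (𝓝 0) := by
    have := hsq.sqrt
    simpa [Real.sqrt_sq (he0 _)] using this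
  have het : Tendsto e atTop (𝓝 0) := (tendsto_add_atTop_iff_nat 1).1 he1t
  have hHt : Tendsto (fun n => H (u n)) atTop (𝓝 l) := by
    have := hl.sub ((het.pow 2).const_mul (β/2))
    simpa [hE] using this
  have hgt : Tendsto (fun n => gradient H (u n)) atTop (𝓝 0) := by
    apply squeeze_zero_norm gbd
    simpa using (he1t.const_mul L).add (het.const_mul β)
  obtain ⟨a, -, φ, hφ, hφa⟩ := hcpt.tendsto_subseq hmem
  have ha : MapClusterPt a atTop u := hφa.mapClusterPt.of_comp hφ.tendsto_atTop
  have hga : gradient H a = 0 :=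
    tendsto_nhds_unique ((cgH.tendsto a).comp hφa) (hgt.comp hφ.tendsto_atTop)
  have hHa : H a = l :=
    tendsto_nhds_unique ((cH.tendsto a).comp hφa) (hHt.comp hφ.tendsto_atTop)
  obtain ⟨c, hc, ρ, hρ, θ, ⟨hθ0, hθ⟩, hloj⟩ := hLoj a hga
  obtain ⟨n0, hn0⟩ := eventually_atTop.1 (het.eventually (gt_mem_nhds one_pos))
  set C := (L + β)/c + (β/2)^(1-θ) with hC
  have hC0 : 0 < C := by positivity
  refine ⟨a, dcm_trap u a (fun n => e n + 4 * (C/(θ*δ)) * (E n - l)^θ) ρ hρ n0 ?_ ?_ ha ?_⟩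
  · intro n
    have := he0 n
    have := Real.rpow_nonneg (hlE n) θ
    positivity
  · have h1 : Tendsto (fun n => E n - l) atTop (𝓝 0) := by simpa using hl.sub_const l
    have h2 := h1.rpow_const (p := θ) (Or.inr hθ0.le)
    rw [Real.zero_rpow hθ0.ne'] at h2
    simpa using het.add (h2.const_mul (4 * (C/(θ*δ))))
  · intro n hn hda
    rw [dist_eq_norm] at hda
    rw [dist_eq_norm, ← hes n]
    have h1 := hloj (u n) hda
    rw [hHa] at h1
    have hEl : E n - l = (H (u n) - l) + β/2 * (e n)^2 := by simp only [hE]; ring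
    apply dcm_kl θ δ C (e (n+1)) (e n) (E n - l) (E (n+1) - l) hθ0 hθ hδ hC0 (he0 _) (he0 _)
      (hlE _) (hlE _) (by linarith [desc n])
    rw [hEl]
    exact dcm_pow (1-θ) (H (u n) - l) (e n) _ β c L (e (n+1)) (by linarith) (by linarith) hc hL hβ0
      (he0 _) (he0 _) (hn0 n hn).le (hEl ▸ hlE n) h1 (gbd n)
end

section
/- Let N ∈ ℕ, a, d ∈ ℝ^N_+, and let B ∈ ℝ^{N×N} be a symmetric matrix. Let f : [0,∞) → ℝ^N_+ be a bounded differentiable solution of the Lotka-Volterra system f_i'(t) = d_i·f_i(t)·(a_i - Σ_{j=1}^N B_{ij} f_j(t)) for all i. Then the ω-limit set of f consists of a single point; i.e., lim_{t→∞} f(t) exists. -/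
open Filter Topology

namespace LV

variable {N : ℕ}

/-- residual -/
noncomputable def R (a : Fin N → ℝ) (B : Matrix (Fin N) (Fin N) ℝ) (f : Fin N → ℝ) (i : Fin N) : ℝ :=
  a i - ∑ j, B i j * f j

/-- potential -/
noncomputable def V (a : Fin N → ℝ) (B : Matrix (Fin N) (Fin N) ℝ) (f : Fin N → ℝ) : ℝ :=
  ∑ i, f i * (a i + R a B f i) / 2

lemma trap (a : Fin N → ℝ) (B : Matrix (Fin N) (Fin N) ℝ) (hB : B.IsSymm) (f g : Fin N → ℝ) :
    V a B f - V a B g = ∑ i, (R a B f i + R a B g i) * (f i - g i) / 2 := by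
  have key : ∑ i, f i * (∑ j, B i j * g j) = ∑ i, g i * (∑ j, B i j * f j) := by
    simp_rw [Finset.mul_sum]
    rw [Finset.sum_comm]
    refine Finset.sum_congr rfl fun i _ => Finset.sum_congr rfl fun j _ => ?_
    rw [hB.apply i j]; ring
  have h2 : ∑ i, (R a B f i + R a B g i) * (f i - g i) / 2 - (V a B f - V a B g)
      = (∑ i, g i * (∑ j, B i j * f j) - ∑ i, f i * (∑ j, B i j * g j)) / 2 := by
    unfold V
    rw [← Finset.sum_sub_distrib, ← Finset.sum_sub_distrib, ← Finset.sum_sub_distrib,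
      Finset.sum_div]
    refine Finset.sum_congr rfl fun i _ => ?_
    unfold R; ring
  rw [key] at h2
  linarith

/-- Error bound for a linear system. -/
lemma errbound (L : (Fin N → ℝ) →L[ℝ] (Fin N → ℝ)) (b : Fin N → ℝ) :
    (∃ h0, L h0 = b ∧ ∃ C > 0, ∀ f, ∃ h, L h = b ∧ ‖f - h‖ ≤ C * ‖L f - b‖) ∨
    (∃ δ > 0, ∀ f, δ ≤ ‖L f - b‖) := by
  by_cases hb : ∃ h0, L h0 = b
  · left
    obtain ⟨h0, hh0⟩ := hb
    refine ⟨h0, hh0, ?_⟩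
    obtain ⟨C, hC, hpre⟩ := ContinuousLinearMap.exists_preimage_norm_le (L.rangeRestrict)
      (by rintro ⟨y, x, rfl⟩; exact ⟨x, rfl⟩)
    refine ⟨C, hC, fun f => ?_⟩
    obtain ⟨x, hx, hxn⟩ := hpre ⟨L (f - h0), ⟨f - h0, rfl⟩⟩
    have hx' : L x = L (f - h0) := congrArg Subtype.val hx
    refine ⟨f - x, ?_, ?_⟩
    · rw [map_sub, hx', map_sub, hh0]; abel
    · have : ‖x‖ ≤ C * ‖L (f - h0)‖ := hxn
      rw [map_sub, hh0] at this
      simpa using this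
  · right
    have hcl : IsClosed (LinearMap.range (L : (Fin N → ℝ) →ₗ[ℝ] (Fin N → ℝ)) : Set (Fin N → ℝ)) :=
      Submodule.closed_of_finiteDimensional _
    have hbn : b ∉ (LinearMap.range (L : (Fin N → ℝ) →ₗ[ℝ] (Fin N → ℝ)) : Set (Fin N → ℝ)) := by
      rintro ⟨x, hx⟩; exact hb ⟨x, hx⟩
    obtain ⟨δ, hδ, hball⟩ := Metric.isOpen_iff.1 hcl.isOpen_compl b hbn
    refine ⟨δ, hδ, fun f => ?_⟩
    by_contra hlt
    push Not at hlt
    have : L f ∈ Metric.ball b δ := by rw [mem_ball_iff_norm]; exact hlt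
    exact hball this ⟨f, rfl⟩

/-- The pattern map -/
noncomputable def LK (B : Matrix (Fin N) (Fin N) ℝ) (K : Finset (Fin N)) :
    (Fin N → ℝ) →L[ℝ] (Fin N → ℝ) :=
  LinearMap.toContinuousLinearMap
    (LinearMap.pi fun i => if i ∈ K then LinearMap.proj i else
      (LinearMap.proj i).comp (Matrix.mulVecLin B))

lemma LK_apply (B : Matrix (Fin N) (Fin N) ℝ) (K : Finset (Fin N)) (f : Fin N → ℝ) (i : Fin N) :
    LK B K f i = if i ∈ K then f i else ∑ j, B i j * f j := by
  unfold LK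
  by_cases h : i ∈ K <;> simp [h, Matrix.mulVec, dotProduct]

lemma patternA (a : Fin N → ℝ) (B : Matrix (Fin N) (Fin N) ℝ) (hB : B.IsSymm)
    (K : Finset (Fin N)) :
    ∃ v C δ : ℝ, 0 ≤ C ∧ 0 < δ ∧ ∀ (f : Fin N → ℝ) (η : ℝ), 0 ≤ η → η < δ → (∀ i, 0 ≤ f i) →
      (∀ i ∈ K, f i ≤ η) → (∀ i ∉ K, |R a B f i| ≤ η) → (∀ i, f i * R a B f i ^ 2 ≤ η ^ 3) →
      |V a B f - v| ≤ C * η ^ 2 := by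
  have hres : ∀ (f : Fin N → ℝ) (η : ℝ), 0 ≤ η → (∀ i, 0 ≤ f i) →
      (∀ i ∈ K, f i ≤ η) → (∀ i ∉ K, |R a B f i| ≤ η) →
      ‖LK B K f - (fun i => if i ∈ K then 0 else a i)‖ ≤ η := by
    intro f η hη hf h1 h2
    rw [pi_norm_le_iff_of_nonneg hη]
    intro i
    rw [Pi.sub_apply, LK_apply, Real.norm_eq_abs]
    by_cases h : i ∈ K
    · simp only [h, if_true, sub_zero]
      rw [abs_of_nonneg (hf i)]; exact h1 i h
    · simp only [h, if_false]
      rw [abs_sub_comm]; exact h2 i h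
  have hsol : ∀ h : Fin N → ℝ, LK B K h = (fun i => if i ∈ K then 0 else a i) →
      (∀ i ∈ K, h i = 0) ∧ (∀ i ∉ K, R a B h i = 0) := by
    intro h hh
    constructor
    · intro i hi
      have := congrFun hh i
      rw [LK_apply] at this
      simpa [hi] using this
    · intro i hi
      have := congrFun hh i
      rw [LK_apply] at this
      simp only [hi, if_false] at this
      unfold R; linarith
  rcases errbound (LK B K) (fun i => if i ∈ K then 0 else a i) with
    ⟨h0, hh0, C, hC, hbd⟩ | ⟨δ, hδ, hbd⟩
  · set β : ℝ := ∑ i, ∑ j, |B i j| with hβ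
    have hβ0 : 0 ≤ β := Finset.sum_nonneg fun i _ => Finset.sum_nonneg fun j _ => abs_nonneg _
    refine ⟨V a B h0, N * (2 + β * C + C), 1, by positivity, one_pos, ?_⟩
    intro f η hη _ hf h1 h2 h3
    obtain ⟨h, hh, hfh⟩ := hbd f
    have hfh' : ‖f - h‖ ≤ C * η := hfh.trans (mul_le_mul_of_nonneg_left (hres f η hη hf h1 h2) hC.le)
    obtain ⟨s1, s2⟩ := hsol h hh
    obtain ⟨s1', s2'⟩ := hsol h0 hh0
    have hV : V a B h = V a B h0 := by
      rw [← sub_eq_zero, trap a B hB]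
      refine Finset.sum_eq_zero fun i _ => ?_
      by_cases hi : i ∈ K
      · simp [s1 i hi, s1' i hi]
      · simp [s2 i hi, s2' i hi]
    rw [← hV, trap a B hB]
    have hdiff : ∀ i, |f i - h i| ≤ C * η := fun i => by
      have := norm_le_pi_norm (f - h) i
      rw [Pi.sub_apply, Real.norm_eq_abs] at this
      exact this.trans hfh'
    have hRd : ∀ i, |R a B h i - R a B f i| ≤ β * (C * η) := by
      intro i
      have e : R a B h i - R a B f i = ∑ j, B i j * (f j - h j) := by
        unfold R
        simp_rw [mul_sub]
        rw [Finset.sum_sub_distrib]; ring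
      rw [e]
      calc |∑ j, B i j * (f j - h j)| ≤ ∑ j, |B i j * (f j - h j)| := Finset.abs_sum_le_sum_abs _ _
        _ ≤ ∑ j, |B i j| * (C * η) := Finset.sum_le_sum fun j _ => by
            rw [abs_mul]; exact mul_le_mul_of_nonneg_left (hdiff j) (abs_nonneg _)
        _ = (∑ j, |B i j|) * (C * η) := by rw [Finset.sum_mul]
        _ ≤ β * (C * η) := by
            refine mul_le_mul_of_nonneg_right ?_ (by positivity)
            exact Finset.single_le_sum (f := fun i => ∑ j, |B i j|)
              (fun i _ => Finset.sum_nonneg fun j _ => abs_nonneg _) (Finset.mem_univ i)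
    refine (Finset.abs_sum_le_sum_abs _ _).trans ?_
    have hterm : ∀ i ∈ Finset.univ, |(R a B f i + R a B h i) * (f i - h i) / 2|
        ≤ (2 + β * C + C) * η ^ 2 := by
      intro i _
      have p1 : 0 ≤ β * C * η ^ 2 := by positivity
      have p2 : 0 ≤ C * η ^ 2 := by positivity
      have p3 : 0 ≤ η ^ 2 := by positivity
      rw [abs_div, abs_two]
      by_cases hi : i ∈ K
      · rw [s1 i hi, sub_zero]
        have e : (R a B f i + R a B h i) * f i = 2 * (f i * R a B f i)
          + f i * (R a B h i - R a B f i) := by ring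
        have q1 : |f i * R a B f i| ≤ η ^ 2 := by
          apply abs_le_of_sq_le_sq _ p3
          have := mul_le_mul (h1 i hi) (h3 i) (mul_nonneg (hf i) (sq_nonneg _)) hη
          nlinarith
        have q2 : |f i * (R a B h i - R a B f i)| ≤ η * (β * (C * η)) := by
          rw [abs_mul, abs_of_nonneg (hf i)]
          exact mul_le_mul (h1 i hi) (hRd i) (abs_nonneg _) hη
        have q3 := abs_add_le (2 * (f i * R a B f i)) (f i * (R a B h i - R a B f i))
        rw [abs_mul 2, abs_two] at q3
        rw [e]
        nlinarith
      · rw [s2 i hi, add_zero, abs_mul]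
        have := mul_le_mul (h2 i hi) (hdiff i) (abs_nonneg _) hη
        nlinarith
    refine (Finset.sum_le_sum hterm).trans ?_
    simp [mul_assoc]
  · refine ⟨0, 0, δ, le_rfl, hδ, ?_⟩
    intro f η hη hlt hf h1 h2 _
    exact absurd ((hbd f).trans (hres f η hη hf h1 h2)) (not_le.2 hlt)

lemma patternB (a : Fin N → ℝ) (B : Matrix (Fin N) (Fin N) ℝ) (hB : B.IsSymm) (W : ℝ)
    (K : Finset (Fin N)) :
    ∃ C ρ : ℝ, 0 ≤ C ∧ 0 < ρ ∧ ∀ (f : Fin N → ℝ) (η : ℝ), 0 ≤ η → (∀ i, 0 ≤ f i) →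
      (∀ i ∈ K, f i ≤ η) → (∀ i ∉ K, |R a B f i| ≤ η) → (∀ i, f i * R a B f i ^ 2 ≤ η ^ 3) →
      |V a B f - W| < ρ → |V a B f - W| ≤ C * η ^ 2 := by
  obtain ⟨v, C, δ, hC, hδ, h⟩ := patternA a B hB K
  obtain ⟨ρ, hρ, hρ'⟩ : ∃ ρ : ℝ, 0 < ρ ∧ ∀ x : ℝ, |x - W| < ρ → |x - W| ≤ |x - v| := by
    by_cases hv : v = W
    · exact ⟨1, one_pos, fun x _ => by rw [hv]⟩
    · refine ⟨|v - W| / 2, by have := abs_pos.2 (sub_ne_zero.2 hv); linarith, fun x hx => ?_⟩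
      have := abs_sub_le v x W
      rw [abs_sub_comm v x] at this
      linarith
  refine ⟨C + ρ / δ ^ 2, ρ, by positivity, hρ, ?_⟩
  intro f η hη hf h1 h2 h3 hlt
  have p1 : 0 ≤ C * η ^ 2 := by positivity
  have p2 : 0 ≤ ρ / δ ^ 2 * η ^ 2 := by positivity
  rw [add_mul]
  rcases lt_or_ge η δ with hd | hd
  · have := h f η hη hd hf h1 h2 h3
    have := hρ' _ hlt
    linarith
  · have : ρ ≤ ρ / δ ^ 2 * η ^ 2 := by
      rw [div_mul_eq_mul_div, le_div_iff₀ (by positivity)]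
      have : δ ^ 2 ≤ η ^ 2 := by gcongr
      nlinarith
    linarith

lemma loja (a : Fin N → ℝ) (B : Matrix (Fin N) (Fin N) ℝ) (hB : B.IsSymm) (W : ℝ) :
    ∃ C ρ : ℝ, 0 ≤ C ∧ 0 < ρ ∧ ∀ (f : Fin N → ℝ) (η : ℝ), 0 ≤ η → (∀ i, 0 ≤ f i) →
      (∀ i, f i * R a B f i ^ 2 ≤ η ^ 3) →
      |V a B f - W| < ρ → |V a B f - W| ≤ C * η ^ 2 := by
  choose C ρ hC hρ h using patternB a B hB W
  obtain ⟨K0, hK0⟩ := Finite.exists_min ρ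
  refine ⟨∑ K, C K, ρ K0, Finset.sum_nonneg fun K _ => hC K, hρ K0, ?_⟩
  intro f η hη hf h3 hlt
  have hmain := h (Finset.univ.filter fun i => f i ≤ η) f η hη hf (by simp) (by
    intro i hi
    simp only [Finset.mem_filter, Finset.mem_univ, true_and, not_le] at hi
    apply abs_le_of_sq_le_sq _ hη
    have hfi : 0 < f i := lt_of_le_of_lt hη hi
    have : f i * R a B f i ^ 2 ≤ f i * η ^ 2 := by
      refine (h3 i).trans ?_
      nlinarith [sq_nonneg η]
    exact le_of_mul_le_mul_left this hfi) h3 (lt_of_lt_of_le hlt (hK0 _))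
  refine hmain.trans (mul_le_mul_of_nonneg_right ?_ (sq_nonneg _))
  exact Finset.single_le_sum (f := C) (fun K _ => hC K) (Finset.mem_univ _)

lemma mono_conv (g g' : ℝ → ℝ) (T M : ℝ) (hg : ∀ t ≥ T, HasDerivAt g (g' t) t)
    (hg' : ∀ t ≥ T, 0 ≤ g' t) (hM : ∀ t ≥ T, g t ≤ M) :
    ∃ l, Tendsto g atTop (𝓝 l) ∧ (∀ t ≥ T, g t ≤ l) ∧ MonotoneOn g (Set.Ici T) := by
  have hmono : MonotoneOn g (Set.Ici T) := by
    refine monotoneOn_of_deriv_nonneg (convex_Ici T)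
      (fun t ht => (hg t ht).continuousAt.continuousWithinAt) ?_ ?_
    · intro t ht
      rw [interior_Ici] at ht
      exact (hg t (le_of_lt ht)).differentiableAt.differentiableWithinAt
    · intro t ht
      rw [interior_Ici] at ht
      rw [(hg t (le_of_lt ht)).deriv]
      exact hg' t (le_of_lt ht)
  have hm : Monotone (fun t => g (max t T)) := fun s t hst =>
    hmono (Set.mem_Ici.2 (le_max_right s T)) (Set.mem_Ici.2 (le_max_right t T)) (max_le_max_right T hst)
  have hbd : BddAbove (Set.range fun t => g (max t T)) :=
    ⟨M, by rintro _ ⟨t, rfl⟩; exact hM _ (le_max_right _ _)⟩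
  refine ⟨_, (tendsto_atTop_ciSup hm hbd).congr' ?_, ?_, hmono⟩
  · filter_upwards [eventually_ge_atTop T] with t ht
    rw [max_eq_left ht]
  · intro t ht
    have := le_ciSup hbd t
    simpa [max_eq_left ht] using this

lemma V_deriv (a : Fin N → ℝ) (B : Matrix (Fin N) (Fin N) ℝ) (hB : B.IsSymm)
    (f : ℝ → Fin N → ℝ) (f' : Fin N → ℝ) (t : ℝ)
    (h : ∀ i, HasDerivAt (fun s => f s i) (f' i) t) :
    HasDerivAt (fun s => V a B (f s)) (∑ i, R a B (f t) i * f' i) t := by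
  have hR : ∀ i, HasDerivAt (fun s => R a B (f s) i) (-∑ j, B i j * f' j) t := by
    intro i
    unfold R
    exact (HasDerivAt.fun_sum fun j _ => (h j).const_mul (B i j)).const_sub (a i)
  have hV : HasDerivAt (fun s => V a B (f s))
      (∑ i, (f' i * (a i + R a B (f t) i) + f t i * (-∑ j, B i j * f' j)) / 2) t := by
    unfold V
    exact HasDerivAt.fun_sum fun i _ => ((h i).mul ((hR i).const_add (a i))).div_const 2
  convert hV using 1
  have key : ∑ i, f t i * (∑ j, B i j * f' j) = ∑ i, f' i * (∑ j, B i j * f t j) := by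
    simp_rw [Finset.mul_sum]
    rw [Finset.sum_comm]
    refine Finset.sum_congr rfl fun i _ => Finset.sum_congr rfl fun j _ => ?_
    rw [hB.apply i j]; ring
  have h2 : ∑ i, (f' i * (a i + R a B (f t) i) + f t i * (-∑ j, B i j * f' j)) / 2
      - ∑ i, R a B (f t) i * f' i
      = (∑ i, f' i * (∑ j, B i j * f t j) - ∑ i, f t i * (∑ j, B i j * f' j)) / 2 := by
    rw [← Finset.sum_sub_distrib, ← Finset.sum_sub_distrib, Finset.sum_div]
    refine Finset.sum_congr rfl fun i _ => ?_
    unfold R; ring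
  rw [key] at h2
  linarith

end LV

open LV in
/-- Every bounded positive solution of a Lotka–Volterra system with
symmetric interaction matrix converges: the ω-limit set is a single point. -/
theorem lotka_volterra_symmetric_convergence {N : ℕ}
    (a d : Fin N → ℝ) (ha : ∀ i, 0 < a i) (hd : ∀ i, 0 < d i)
    (B : Matrix (Fin N) (Fin N) ℝ) (hB : B.IsSymm)
    (f : ℝ → Fin N → ℝ)
    (hpos : ∀ t ≥ (0:ℝ), ∀ i, 0 < f t i)
    (hbdd : ∃ C, ∀ t ≥ (0:ℝ), ∀ i, |f t i| ≤ C)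
    (hode : ∀ t ≥ (0:ℝ), ∀ i, HasDerivAt (fun s => f s i)
      (d i * f t i * (a i - ∑ j, B i j * f t j)) t) :
    ∃ ftil : Fin N → ℝ, Tendsto f atTop (𝓝 ftil) := by
  suffices H : ∀ i, ∃ l, Tendsto (fun t => f t i) atTop (𝓝 l) by
    choose l hl using H
    exact ⟨l, tendsto_pi_nhds.2 hl⟩
  rcases isEmpty_or_nonempty (Fin N) with hN | hN
  · intro i; exact isEmptyElim i
  obtain ⟨M, hM⟩ := hbdd
  have hM0 : 0 ≤ M := (abs_nonneg _).trans (hM 0 le_rfl hN.some)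
  obtain ⟨i0, hi0⟩ := Finite.exists_min d
  obtain ⟨i1, hi1⟩ := Finite.exists_max d
  set D : ℝ → ℝ := fun t => ∑ i, d i * f t i * R a B (f t) i ^ 2 with hD
  have hDterm : ∀ t ≥ (0:ℝ), ∀ i, d i * f t i * R a B (f t) i ^ 2 ≤ D t := fun t ht i =>
    Finset.single_le_sum (f := fun i => d i * f t i * R a B (f t) i ^ 2)
      (fun i _ => mul_nonneg (mul_pos (hd i) (hpos t ht i)).le (sq_nonneg _)) (Finset.mem_univ i)
  have hD0 : ∀ t ≥ (0:ℝ), 0 ≤ D t := fun t ht =>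
    Finset.sum_nonneg fun i _ => mul_nonneg (mul_pos (hd i) (hpos t ht i)).le (sq_nonneg _)
  have hVd : ∀ t ≥ (0:ℝ), HasDerivAt (fun s => V a B (f s)) (D t) t := by
    intro t ht
    convert V_deriv a B hB f _ t (hode t ht) using 1
    refine Finset.sum_congr rfl fun i _ => ?_
    unfold R; ring
  -- bound for V
  have hVb : ∀ t ≥ (0:ℝ), V a B (f t) ≤ ∑ i, M * (a i + (a i + ∑ j, |B i j| * M)) / 2 := by
    intro t ht
    unfold V
    refine Finset.sum_le_sum fun i _ => ?_
    have h1 : R a B (f t) i ≤ a i + ∑ j, |B i j| * M := by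
      unfold R
      have : -∑ j, B i j * f t j ≤ ∑ j, |B i j| * M := by
        rw [← Finset.sum_neg_distrib]
        refine Finset.sum_le_sum fun j _ => ?_
        calc -(B i j * f t j) ≤ |B i j * f t j| := neg_le_abs _
          _ = |B i j| * |f t j| := abs_mul _ _
          _ ≤ _ := mul_le_mul_of_nonneg_left (hM t ht j) (abs_nonneg _)
      linarith
    have h2 : f t i ≤ M := (le_abs_self _).trans (hM t ht i)
    have h3 : 0 ≤ a i + (a i + ∑ j, |B i j| * M) := by
      have : 0 ≤ ∑ j, |B i j| * M := Finset.sum_nonneg fun j _ => by positivity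
      have := ha i
      linarith
    have h4 : f t i * (a i + R a B (f t) i) ≤ f t i * (a i + (a i + ∑ j, |B i j| * M)) :=
      mul_le_mul_of_nonneg_left (by linarith) (hpos t ht i).le
    have h5 := mul_le_mul_of_nonneg_right h2 h3
    linarith
  obtain ⟨W, hW, hWle, hVmono⟩ := mono_conv _ D 0 _ hVd hD0 hVb
  -- speed bound
  set G : ℝ := Real.sqrt (d i1 * M) with hG
  have hspeed : ∀ t ≥ (0:ℝ), ∀ i,
      |d i * f t i * (a i - ∑ j, B i j * f t j)| ≤ G * Real.sqrt (D t) := by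
    intro t ht i
    rw [hG, ← Real.sqrt_mul (mul_nonneg (hd i1).le hM0)]
    apply Real.abs_le_sqrt
    have h1 := hDterm t ht i
    have h2 : d i * f t i ≤ d i1 * M :=
      mul_le_mul (hi1 i) ((le_abs_self _).trans (hM t ht i)) (hpos t ht i).le (hd i1).le
    have h3 := mul_le_mul h2 h1
      (mul_nonneg (mul_pos (hd i) (hpos t ht i)).le (sq_nonneg _)) (mul_nonneg (hd i1).le hM0)
    refine le_trans (le_of_eq ?_) h3
    unfold R; ring
  by_cases hz : ∃ t0 ≥ (0:ℝ), V a B (f t0) = W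
  · obtain ⟨t0, ht0, hVt0⟩ := hz
    have hconst : ∀ t ≥ t0, V a B (f t) = W := fun t ht =>
      le_antisymm (hWle t (ht0.trans ht)) (hVt0 ▸ hVmono ht0 (ht0.trans ht) ht)
    have hDz : ∀ t ≥ t0 + 1, D t = 0 := by
      intro t ht
      have e : (fun s => V a B (f s)) =ᶠ[𝓝 t] fun _ => W := by
        filter_upwards [eventually_gt_nhds (show t0 < t by linarith)] with s hs
        exact hconst s hs.le
      exact (hVd t (by linarith)).unique ((hasDerivAt_const t W).congr_of_eventuallyEq e)
    intro i
    obtain ⟨l, hl, -⟩ := mono_conv (fun s => f s i) (fun t => 0) (t0 + 1) M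
      (fun t ht => by
        have h0 : (0:ℝ) ≤ t := by linarith
        have h1 := hspeed t h0 i
        rw [hDz t ht, Real.sqrt_zero, mul_zero] at h1
        have h2 := hode t h0 i
        rwa [abs_nonpos_iff.1 h1] at h2)
      (fun _ _ => le_rfl)
      (fun t ht => (le_abs_self _).trans (hM t (by linarith) i))
    exact ⟨l, hl⟩
  · push Not at hz
    have hw : ∀ t ≥ (0:ℝ), 0 < W - V a B (f t) := fun t ht =>
      sub_pos.2 (lt_of_le_of_ne (hWle t ht) (hz t ht))
    obtain ⟨C, ρ, hC, hρ, hL⟩ := loja a B hB W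
    obtain ⟨T, hT0, hT⟩ : ∃ T ≥ (0:ℝ), ∀ t ≥ T, |V a B (f t) - W| < ρ := by
      obtain ⟨T, hT⟩ := eventually_atTop.1 (Metric.tendsto_nhds.1 hW ρ hρ)
      exact ⟨max T 0, le_max_right _ _, fun t ht => by
        have := hT t ((le_max_left _ _).trans ht)
        rwa [Real.dist_eq] at this⟩
    set u : ℝ → ℝ := fun t => (W - V a B (f t)) ^ (1/4 : ℝ) with hu
    have hupos : ∀ t ≥ (0:ℝ), 0 < u t := fun t ht => Real.rpow_pos_of_pos (hw t ht) _
    have hu4 : ∀ t ≥ (0:ℝ), u t ^ 4 = W - V a B (f t) := by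
      intro t ht
      rw [hu]
      simp only
      rw [← Real.rpow_natCast, ← Real.rpow_mul (hw t ht).le]
      norm_num
    have hud : ∀ t ≥ (0:ℝ), HasDerivAt u (-(D t / (4 * u t ^ 3))) t := by
      intro t ht
      have h1 := ((hVd t ht).const_sub W).rpow_const (p := (1/4:ℝ)) (Or.inl (hw t ht).ne')
      convert h1 using 1
      have e : (W - V a B (f t)) ^ ((1/4:ℝ) - 1) = (u t ^ 3)⁻¹ := by
        rw [hu]
        simp only
        rw [← Real.rpow_natCast, ← Real.rpow_mul (hw t ht).le, ← Real.rpow_neg (hw t ht).le]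
        norm_num
      rw [e]
      have := (hupos t ht).ne'
      field_simp
    -- Lojasiewicz
    set A : ℝ := Real.sqrt (Real.sqrt (C ^ 3 / d i0 ^ 2)) with hA
    have hA0 : 0 ≤ A := Real.sqrt_nonneg _
    have hA4 : A ^ 4 = C ^ 3 / d i0 ^ 2 := by
      have : A ^ 4 = (A ^ 2) ^ 2 := by ring
      rw [this, hA, Real.sq_sqrt (Real.sqrt_nonneg _), Real.sq_sqrt (by positivity)]
    have hloj : ∀ t ≥ T, u t ^ 3 ≤ A * Real.sqrt (D t) := by
      intro t ht
      have ht0 : (0:ℝ) ≤ t := hT0.trans ht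
      have hDd : 0 ≤ D t / d i0 := div_nonneg (hD0 t ht0) (hd i0).le
      set η : ℝ := (D t / d i0) ^ (1/3 : ℝ) with hη
      have hη0 : 0 ≤ η := Real.rpow_nonneg hDd _
      have hη3 : η ^ 3 = D t / d i0 := by
        rw [hη, ← Real.rpow_natCast, ← Real.rpow_mul hDd]
        norm_num
      have h1 := hL (f t) η hη0 (fun i => (hpos t ht0 i).le) (fun i => by
        rw [hη3, le_div_iff₀ (hd i0)]
        refine le_trans ?_ (hDterm t ht0 i)
        have := mul_le_mul_of_nonneg_left (hi0 i)
          (mul_nonneg (hpos t ht0 i).le (sq_nonneg (R a B (f t) i)))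
        linarith) (hT t ht)
      rw [abs_sub_comm, abs_of_pos (hw t ht0), ← hu4 t ht0] at h1
      have h2 : (u t ^ 4) ^ 3 ≤ (C * η ^ 2) ^ 3 :=
        pow_le_pow_left₀ (by have := hupos t ht0; positivity) h1 3
      have h3 : (C * η ^ 2) ^ 3 = (A * Real.sqrt (D t)) ^ 4 := by
        have e1 : (C * η ^ 2) ^ 3 = C ^ 3 * (η ^ 3) ^ 2 := by ring
        have e2 : (A * Real.sqrt (D t)) ^ 4 = A ^ 4 * (Real.sqrt (D t) ^ 2) ^ 2 := by ring
        rw [e1, e2, hη3, hA4, Real.sq_sqrt (hD0 t ht0)]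
        ring
      have h4 : (u t ^ 3) ^ 4 ≤ (A * Real.sqrt (D t)) ^ 4 := by
        rw [← h3]; refine le_trans (le_of_eq ?_) h2; ring
      exact le_of_pow_le_pow_left₀ (by norm_num) (mul_nonneg hA0 (Real.sqrt_nonneg _)) h4
    have hu0 : Tendsto u atTop (𝓝 0) := by
      have h1 : Tendsto (fun t => W - V a B (f t)) atTop (𝓝 (W - W)) := hW.const_sub W
      rw [sub_self] at h1
      have h2 := h1.rpow_const (p := (1/4:ℝ)) (Or.inr (by norm_num))
      rwa [Real.zero_rpow (by norm_num)] at h2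
    intro i
    set Q : ℝ := 4 * G * A with hQ
    have hG0 : 0 ≤ G := Real.sqrt_nonneg _
    have hQ0 : 0 ≤ Q := by positivity
    obtain ⟨l, hl, -⟩ := mono_conv (fun s => f s i - Q * u s)
      (fun t => d i * f t i * (a i - ∑ j, B i j * f t j) - Q * (-(D t / (4 * u t ^ 3)))) T M
      (fun t ht => (hode t (hT0.trans ht) i).sub ((hud t (hT0.trans ht)).const_mul Q))
      (fun t ht => by
        have ht0 : (0:ℝ) ≤ t := hT0.trans ht
        have h1 := (abs_le.1 (hspeed t ht0 i)).1
        have hu3 : 0 < u t ^ 3 := pow_pos (hupos t ht0) 3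
        have h2 : Real.sqrt (D t) ≤ A * (D t / u t ^ 3) := by
          rw [← mul_div_assoc, le_div_iff₀ hu3]
          have := mul_le_mul_of_nonneg_left (hloj t ht) (Real.sqrt_nonneg (D t))
          have e := Real.mul_self_sqrt (hD0 t ht0)
          calc _ ≤ _ := this
            _ = A * (Real.sqrt (D t) * Real.sqrt (D t)) := by ring
            _ = _ := by rw [e]
        have h3 := mul_le_mul_of_nonneg_left h2 hG0
        have h4 : Q * (-(D t / (4 * u t ^ 3))) = - (G * (A * (D t / u t ^ 3))) := by
          rw [hQ]; field_simp
        rw [h4]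
        linarith)
      (fun t ht => by
        have ht0 : (0:ℝ) ≤ t := hT0.trans ht
        have h1 := (le_abs_self _).trans (hM t ht0 i)
        have h2 := mul_nonneg hQ0 (hupos t ht0).le
        linarith)
    refine ⟨l + Q * 0, ?_⟩
    have := hl.add (hu0.const_mul Q)
    simpa using this
end

section
/- Let a, d ∈ ℝ^N_+ and B ∈ ℝ^{N×N} symmetric, and let u : [0,∞) → ℝ^N be a bounded differentiable solution of u_i'(t) = (1/2)·d_i·u_i(t)·(a_i - Σ_{j=1}^N B_{ij}·u_j(t)²) for all i (the de-singularized Lotka-Volterra system, which is the gradient flow u' = -diag(d)∇H(u) of the polynomial energy H(u) = -(1/4)Σ_i u_i² a_i + (1/8)Σ_{i,j} B_{ij} u_i² u_j²). Then u(t) converges to some ũ as t → ∞, and with θ a Łojasiewicz exponent of H at ũ: ‖u(t) - ũ‖ = O(e^{-δt}) for some δ > 0 if θ = 1/2, and ‖u(t) - ũ‖ = O(t^{-θ/(1-2θ)}) if 0 < θ < 1/2. -/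
open Filter Topology Asymptotics

/-- growth rate -/
def lvg {N : ℕ} (a : Fin N → ℝ) (B : Matrix (Fin N) (Fin N) ℝ) (x : Fin N → ℝ) (i : Fin N) : ℝ :=
  a i - ∑ j, B i j * x j

/-- quadratic energy -/
noncomputable def lvq {N : ℕ} (a : Fin N → ℝ) (B : Matrix (Fin N) (Fin N) ℝ) (x : Fin N → ℝ) : ℝ :=
  -(1/4) * ∑ i, x i * a i + (1/8) * ∑ i, ∑ j, B i j * x i * x j

lemma lvq_diff {N : ℕ} (a : Fin N → ℝ) (B : Matrix (Fin N) (Fin N) ℝ) (hB : B.IsSymm)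
    (x y : Fin N → ℝ) :
    lvq a B x - lvq a B y = -(1/8) * ∑ i, (lvg a B x i + lvg a B y i) * (x i - y i) := by
  have hsym : ∑ i, ∑ j, B i j * x i * y j = ∑ i, ∑ j, B i j * y i * x j := by
    rw [Finset.sum_comm]
    refine Finset.sum_congr rfl fun i _ => Finset.sum_congr rfl fun j _ => ?_
    rw [hB.apply i j]; ring
  have e : ∀ i, (lvg a B x i + lvg a B y i) * (x i - y i) =
      2 * (x i * a i) - 2 * (y i * a i) - ∑ j, B i j * x i * x j + ∑ j, B i j * y i * y j
      - ∑ j, B i j * x i * y j + ∑ j, B i j * y i * x j := by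
    intro i
    have h1 : ∀ p q : Fin N → ℝ, ∑ j, B i j * p i * q j = p i * ∑ j, B i j * q j := by
      intro p q; rw [Finset.mul_sum]; exact Finset.sum_congr rfl fun j _ => by ring
    simp only [h1, lvg]; ring
  simp only [e, Finset.sum_add_distrib, Finset.sum_sub_distrib, ← Finset.mul_sum, hsym, lvq]
  ring

lemma lin_gen_inv {N : ℕ} (L : (Fin N → ℝ) →ₗ[ℝ] (Fin N → ℝ)) :
    ∃ C : ℝ, 0 ≤ C ∧ ∀ y, ∃ e, L e = L y ∧ ‖e‖ ≤ C * ‖L y‖ := by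
  obtain ⟨R, hR⟩ := L.rangeRestrict.exists_rightInverse_of_surjective L.range_rangeRestrict
  refine ⟨‖LinearMap.toContinuousLinearMap R‖, ContinuousLinearMap.opNorm_nonneg _, fun y => 
    ⟨R (L.rangeRestrict y), ?_, ?_⟩⟩
  · have := congrArg (fun f => ((f (L.rangeRestrict y) : _) : Fin N → ℝ)) hR
    simpa using this
  · exact (LinearMap.toContinuousLinearMap R).le_opNorm (L.rangeRestrict y)

lemma loj_S {N : ℕ} (a : Fin N → ℝ) (B : Matrix (Fin N) (Fin N) ℝ) (hB : B.IsSymm)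
    (xs : Fin N → ℝ) (S : Finset (Fin N)) :
    ∃ C : ℝ, 0 ≤ C ∧ ∃ η > (0:ℝ), ∀ (x : Fin N → ℝ) (w : ℝ), 0 ≤ w → w < η → ‖x - xs‖ < η →
      (∀ i, 0 ≤ x i) → (∀ i, x i * (lvg a B x i)^2 ≤ 4 * w^6) →
      (∀ i ∈ S, |lvg a B x i| ≤ w^2) → (∀ i ∉ S, x i ≤ 4 * w^2) →
      |lvq a B x - lvq a B xs| ≤ C * w^4 := by
  obtain ⟨M, hM0, hM⟩ : ∃ M : ℝ, 0 ≤ M ∧ ∀ (y : Fin N → ℝ) i, |∑ j, B i j * y j| ≤ M * ‖y‖ := by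
    refine ⟨‖LinearMap.toContinuousLinearMap B.mulVecLin‖, norm_nonneg _, fun y i => ?_⟩
    have h1 := (LinearMap.toContinuousLinearMap B.mulVecLin).le_opNorm y
    exact (norm_le_pi_norm (B.mulVec y) i).trans h1
  have hg : ∀ x y : Fin N → ℝ, ∀ i, lvg a B x i - lvg a B y i = - ∑ j, B i j * (x - y) j := by
    intro x y i
    simp only [lvg, Pi.sub_apply, mul_sub, Finset.sum_sub_distrib]; ring
  by_cases h1 : ∀ i ∈ S, lvg a B xs i = 0
  swap
  · push Not at h1
    obtain ⟨i, hi, hne⟩ := h1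
    have hpos := abs_pos.2 hne
    refine ⟨0, le_rfl, min 1 (|lvg a B xs i| / (1 + M)), by positivity, ?_⟩
    intro x w hw0 hw hx _ _ hS _
    exfalso
    have hw1 : w < 1 := hw.trans_le (min_le_left _ _)
    have hw2 := hw.trans_le (min_le_right _ _)
    have hx2 := hx.trans_le (min_le_right _ _)
    have hMM := hM (x - xs) i
    have h3 := hS i hi
    have h4 : |lvg a B xs i| ≤ w^2 + M * ‖x - xs‖ := by
      have := hg x xs i
      have h5 : lvg a B xs i = lvg a B x i + ∑ j, B i j * (x - xs) j := by linarith
      rw [h5]; exact (abs_add_le _ _).trans (add_le_add h3 hMM)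
    have h6 : w^2 ≤ w := by nlinarith
    have h7 : M * ‖x - xs‖ ≤ M * (|lvg a B xs i| / (1 + M)) := by gcongr
    have h8 : |lvg a B xs i| / (1 + M) + M * (|lvg a B xs i| / (1 + M)) = |lvg a B xs i| := by
      field_simp
    linarith
  by_cases h2 : ∀ i ∉ S, xs i = 0
  swap
  · push Not at h2
    obtain ⟨i, hi, hne⟩ := h2
    have hpos := abs_pos.2 hne
    refine ⟨0, le_rfl, min 1 (|xs i| / 5), by positivity, ?_⟩
    intro x w hw0 hw hx hx0 _ _ hS
    exfalso
    have hw1 : w < 1 := hw.trans_le (min_le_left _ _)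
    have hw2 := hw.trans_le (min_le_right _ _)
    have hx2 := hx.trans_le (min_le_right _ _)
    have h3 := hS i hi
    have h4 : |x i - xs i| ≤ ‖x - xs‖ := norm_le_pi_norm (x - xs) i
    have h6 : w^2 ≤ w := by nlinarith
    have h7 : |xs i| ≤ |x i| + |x i - xs i| := by
      have := abs_sub (x i) (x i - xs i); simpa using this
    rw [abs_of_nonneg (hx0 i)] at h7
    linarith
  -- the consistent case
  let L : (Fin N → ℝ) →ₗ[ℝ] (Fin N → ℝ) := LinearMap.pi fun i =>
    if i ∈ S then (LinearMap.proj i).comp B.mulVecLin else LinearMap.proj i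
  have hLin : ∀ y, ∀ i ∈ S, L y i = ∑ j, B i j * y j := by
    intro y i hi; simp [L, hi, Matrix.mulVec, dotProduct]
  have hLnin : ∀ y, ∀ i ∉ S, L y i = y i := by
    intro y i hi; simp [L, hi]
  obtain ⟨C, hC0, hC⟩ := lin_gen_inv L
  refine ⟨N * (8 + 16 * M * C + 4 * C), by positivity, 1, one_pos, ?_⟩
  intro x w hw0 hw hx hx0 hG hS hS'
  obtain ⟨e, he, hen⟩ := hC (x - xs)
  have hLn : ‖L (x - xs)‖ ≤ 4 * w^2 := by
    rw [pi_norm_le_iff_of_nonneg (by positivity)]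
    intro i
    by_cases hi : i ∈ S
    · have := hg x xs i
      rw [hLin _ i hi, Real.norm_eq_abs, ← abs_neg, ← this, h1 i hi, sub_zero]
      exact (hS i hi).trans (by nlinarith [sq_nonneg w])
    · rw [hLnin _ i hi, Pi.sub_apply, h2 i hi, sub_zero, Real.norm_eq_abs, abs_of_nonneg (hx0 i)]
      exact hS' i hi
  have hen' : ‖e‖ ≤ 4 * C * w^2 := hen.trans (by nlinarith)
  set z : Fin N → ℝ := x - e with hz
  have hLz : L (z - xs) = 0 := by
    rw [show z - xs = (x - xs) - e by rw [hz]; abel, map_sub, he, sub_self]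
  have hz1 : ∀ i ∈ S, lvg a B z i = 0 := by
    intro i hi
    have h3 := hLin (z - xs) i hi
    have h4 := hg z xs i
    rw [← h3, hLz, h1 i hi] at h4
    simpa using h4
  have hz2 : ∀ i ∉ S, z i = 0 := by
    intro i hi
    have h3 := hLnin (z - xs) i hi
    rw [hLz, Pi.sub_apply, h2 i hi] at h3
    simpa using h3.symm
  have hq1 : lvq a B z - lvq a B xs = 0 := by
    rw [lvq_diff a B hB, Finset.sum_eq_zero, mul_zero]
    intro i _
    by_cases hi : i ∈ S
    · rw [hz1 i hi, h1 i hi]; simp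
    · rw [hz2 i hi, h2 i hi]; simp
  have hq2 : lvq a B x - lvq a B xs = lvq a B x - lvq a B z := by linarith
  rw [hq2, lvq_diff a B hB, abs_mul]
  have hterm : ∀ i ∈ Finset.univ, |(lvg a B x i + lvg a B z i) * (x i - z i)| ≤ 
      (8 + 16 * M * C + 4 * C) * w^4 := by
    intro i _
    by_cases hi : i ∈ S
    · rw [hz1 i hi, add_zero, abs_mul]
      have h3 : |x i - z i| ≤ 4 * C * w^2 := by
        have : x i - z i = e i := by simp [hz]
        rw [this]; exact (norm_le_pi_norm e i).trans hen'
      calc _ ≤ w^2 * (4 * C * w^2) := mul_le_mul (hS i hi) h3 (abs_nonneg _) (by positivity)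
        _ = 4 * C * w^4 := by ring
        _ ≤ _ := by
          have : 0 ≤ (8 + 16 * M * C) * w^4 := by positivity
          linarith
    · rw [hz2 i hi, sub_zero]
      have h3 : lvg a B z i = lvg a B x i + ∑ j, B i j * e j := by
        have := hg x z i
        have h4 : x - z = e := by rw [hz]; abel
        rw [h4] at this; linarith
      have h5 : |lvg a B x i * x i| ≤ 4 * w^4 := by
        apply abs_le_of_sq_le_sq _ (by positivity)
        have := mul_le_mul (hS' i hi) (hG i) (mul_nonneg (hx0 i) (sq_nonneg _)) (by positivity)
        nlinarith
      have h6 : |(∑ j, B i j * e j) * x i| ≤ 16 * M * C * w^4 := by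
        rw [abs_mul, abs_of_nonneg (hx0 i)]
        calc _ ≤ (M * (4 * C * w^2)) * (4 * w^2) := 
              mul_le_mul ((hM e i).trans (by gcongr)) (hS' i hi) (hx0 i) (by positivity)
          _ = _ := by ring
      rw [h3, show (lvg a B x i + (lvg a B x i + ∑ j, B i j * e j)) * x i 
        = lvg a B x i * x i + lvg a B x i * x i + (∑ j, B i j * e j) * x i by ring]
      have h7 := abs_add_three (lvg a B x i * x i) (lvg a B x i * x i) ((∑ j, B i j * e j) * x i)
      have : 0 ≤ 4 * C * w^4 := by positivity
      linarith
  have hs := (Finset.abs_sum_le_sum_abs _ _).trans (Finset.sum_le_sum hterm)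
  rw [Finset.sum_const, Finset.card_univ, Fintype.card_fin, nsmul_eq_mul] at hs
  have h9 : |(-(1/8) : ℝ)| ≤ 1 := by norm_num [abs_of_neg]
  calc _ ≤ 1 * _ := mul_le_mul h9 hs (abs_nonneg _) one_pos.le
    _ = _ := by ring

lemma loj_alg {N : ℕ} (a : Fin N → ℝ) (B : Matrix (Fin N) (Fin N) ℝ) (hB : B.IsSymm)
    (xs : Fin N → ℝ) :
    ∃ C : ℝ, 0 ≤ C ∧ ∃ η > (0:ℝ), ∀ (x : Fin N → ℝ) (w : ℝ), 0 ≤ w → w < η → ‖x - xs‖ < η →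
      (∀ i, 0 ≤ x i) → (∀ i, x i * (lvg a B x i)^2 ≤ 4 * w^6) →
      |lvq a B x - lvq a B xs| ≤ C * w^4 := by
  choose C hC0 η hη h using loj_S a B hB xs
  have hev : ∀ᶠ e in 𝓝[>] (0:ℝ), ∀ S, e < η S := 
    eventually_all.2 fun S => nhdsWithin_le_nhds (eventually_lt_nhds (hη S))
  obtain ⟨e, he, hpos⟩ := (hev.and self_mem_nhdsWithin).exists
  refine ⟨∑ S, C S, Finset.sum_nonneg fun S _ => hC0 S, e, hpos, ?_⟩
  intro x w hw0 hw hx hx0 hG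
  classical
  let S : Finset (Fin N) := Finset.univ.filter fun i => |lvg a B x i| ≤ w^2
  have := h S x w hw0 (hw.trans (he S)) (hx.trans (he S)) hx0 hG (fun i hi => by simpa [S] using hi) ?_
  · refine this.trans ?_
    gcongr
    exact Finset.single_le_sum (fun S _ => hC0 S) (Finset.mem_univ S)
  · intro i hi
    have hi' : w^2 < |lvg a B x i| := by simpa [S] using hi
    rcases hw0.eq_or_lt with h0 | h0
    · have := hG i
      rw [← h0] at this hi' ⊢
      have hne : 0 < (lvg a B x i)^2 := by
        rw [← sq_abs]; exact pow_pos (lt_of_le_of_lt (by positivity) hi') 2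
      nlinarith [hx0 i]
    · have h4 : w^4 ≤ (lvg a B x i)^2 := by
        rw [← sq_abs (lvg a B x i)]; nlinarith [sq_nonneg w]
      have h5 : x i * w^4 ≤ 4 * w^2 * w^4 := by
        have := mul_le_mul_of_nonneg_left h4 (hx0 i)
        have := hG i
        nlinarith
      exact le_of_mul_le_mul_right h5 (by positivity)

lemma loj_length {E : Type*} [NormedAddCommGroup E] [NormedSpace ℝ E]
    (u u' : ℝ → E) (y p G : ℝ → ℝ) (K k c θ : ℝ) (hK : 0 < K) (hk : 0 < k) (hc : 0 < c)
    (hθ : 0 < θ)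
    (hu : ∀ t ≥ (0:ℝ), HasDerivAt u (u' t) t) (hy : ∀ t ≥ (0:ℝ), HasDerivAt y (-(p t)) t)
    (hpos : ∀ t ≥ (0:ℝ), 0 < y t) (hG : ∀ t, 0 ≤ G t)
    (huG : ∀ t ≥ (0:ℝ), ‖u' t‖ ≤ K * G t) (hp : ∀ t ≥ (0:ℝ), k * (G t)^2 ≤ p t)
    (s t : ℝ) (hs : 0 ≤ s) (hst : s ≤ t)
    (hL : ∀ τ ∈ Set.Ico s t, c * (y τ)^(1-θ) ≤ G τ) :
    ‖u t - u s‖ ≤ K / (k * c * θ) * (y s)^θ := by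
  set D := K / (k * c * θ) with hD
  have hD0 : 0 < D := by positivity
  have hdB : ∀ τ ≥ (0:ℝ), HasDerivAt (fun τ => D * ((y s)^θ - (y τ)^θ))
      (D * (θ * (y τ)^(θ-1) * p τ)) τ := by
    intro τ hτ
    have := (((hy τ hτ).rpow_const (p := θ) (Or.inl (hpos τ hτ).ne')).const_sub ((y s)^θ)).const_mul D
    exact this.congr_deriv (by ring)
  have key := image_norm_le_of_norm_deriv_right_le_deriv_boundary' (f := fun τ => u τ - u s)
    (f' := u') (a := s) (b := t) (B := fun τ => D * ((y s)^θ - (y τ)^θ))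
    (B' := fun τ => D * (θ * (y τ)^(θ-1) * p τ))
    (fun τ hτ => ((hu τ (hs.trans hτ.1)).sub_const _).continuousAt.continuousWithinAt)
    (fun τ hτ => ((hu τ (hs.trans hτ.1)).sub_const _).hasDerivWithinAt)
    (by simp)
    (fun τ hτ => (hdB τ (hs.trans hτ.1)).continuousAt.continuousWithinAt)
    (fun τ hτ => (hdB τ (hs.trans hτ.1)).hasDerivWithinAt)
    (by
      intro τ hτ
      have h0 := hs.trans hτ.1
      have hyp := hpos τ h0
      refine (huG τ h0).trans ?_
      have h1 : (y τ)^(θ-1) * (y τ)^(1-θ) = 1 := by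
        rw [← Real.rpow_add hyp]; simp
      have h2 := hL τ hτ
      have h3 : k * (G τ * (c * (y τ)^(1-θ))) ≤ p τ := by
        refine le_trans ?_ (hp τ h0)
        rw [sq]; have := hG τ; gcongr
      have hA : 0 < (y τ)^(θ-1) := Real.rpow_pos_of_pos hyp _
      calc K * G τ = D * (θ * (y τ)^(θ-1) * (k * (G τ * (c * (y τ)^(1-θ))))) := by
            rw [show D * (θ * (y τ)^(θ-1) * (k * (G τ * (c * (y τ)^(1-θ))))) =
              D * θ * k * c * G τ * ((y τ)^(θ-1) * (y τ)^(1-θ)) by ring, h1, hD]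
            field_simp
        _ ≤ _ := by gcongr)
    (x := t) ⟨hst, le_rfl⟩
  refine key.trans ?_
  have := Real.rpow_nonneg (hpos t (hs.trans hst)).le θ
  show D * ((y s)^θ - (y t)^θ) ≤ D * (y s)^θ
  gcongr; linarith

lemma loj_conv {E : Type*} [NormedAddCommGroup E] [NormedSpace ℝ E]
    (u u' : ℝ → E) (y p G : ℝ → ℝ) (K k c θ : ℝ) (hK : 0 < K) (hk : 0 < k) (hc : 0 < c)
    (hθ : 0 < θ)
    (hu : ∀ t ≥ (0:ℝ), HasDerivAt u (u' t) t) (hy : ∀ t ≥ (0:ℝ), HasDerivAt y (-(p t)) t)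
    (hpos : ∀ t ≥ (0:ℝ), 0 < y t) (hG : ∀ t, 0 ≤ G t)
    (huG : ∀ t ≥ (0:ℝ), ‖u' t‖ ≤ K * G t) (hp : ∀ t ≥ (0:ℝ), k * (G t)^2 ≤ p t)
    (hy0 : Tendsto y atTop (𝓝 0)) (v : E) (hv : MapClusterPt v atTop u)
    (r : ℝ) (hr : 0 < r) (hL : ∀ τ ≥ (0:ℝ), ‖u τ - v‖ < r → c * (y τ)^(1-θ) ≤ G τ) :
    Tendsto u atTop (𝓝 v) := by
  rw [Metric.tendsto_atTop]
  intro ε hε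
  set D := K / (k * c * θ) with hD
  have hD0 : 0 < D := by positivity
  set ρ := min ε r
  have hρ : 0 < ρ := lt_min hε hr
  have hlim : Tendsto (fun t => D * (y t)^θ) atTop (𝓝 0) := by
    have := (hy0.rpow_const (p := θ) (Or.inr hθ.le)).const_mul D
    simpa [Real.zero_rpow hθ.ne'] using this
  have hev : ∀ᶠ t in atTop, D * (y t)^θ < ρ/3 ∧ 0 ≤ t :=
    (hlim.eventually_lt_const (by positivity)).and (eventually_ge_atTop 0)
  have hfr : ∃ᶠ t in atTop, u t ∈ Metric.ball v (ρ/3) :=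
    (mapClusterPt_iff_frequently.1 hv) _ (Metric.ball_mem_nhds v (by positivity))
  obtain ⟨T, hT1, hT2, hT0⟩ := (hfr.and_eventually hev).exists
  rw [mem_ball_iff_norm] at hT1
  refine ⟨T, fun t ht => ?_⟩
  rw [dist_eq_norm]
  refine lt_of_lt_of_le ?_ (min_le_left ε r)
  by_contra! hcon
  have hcont : ContinuousOn (fun τ => ‖u τ - v‖) (Set.Icc T t) := fun τ hτ =>
    (((hu τ (hT0.trans hτ.1)).continuousAt.sub continuousAt_const).norm).continuousWithinAt
  have hcl : IsCompact (Set.Icc T t ∩ (fun τ => ‖u τ - v‖) ⁻¹' Set.Ici ρ) :=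
    isCompact_Icc.of_isClosed_subset (hcont.preimage_isClosed_of_isClosed isClosed_Icc isClosed_Ici)
      Set.inter_subset_left
  obtain ⟨t1, ⟨⟨ht1, ht1'⟩, h1⟩, hmin⟩ := hcl.exists_isLeast ⟨t, ⟨ht, le_rfl⟩, hcon⟩
  have hlen := loj_length u u' y p G K k c θ hK hk hc hθ hu hy hpos hG huG hp T t1 hT0 ht1 (by
    intro τ hτ
    apply hL τ (hT0.trans hτ.1)
    refine lt_of_lt_of_le ?_ (min_le_right ε r)
    by_contra! h
    exact absurd (hmin ⟨⟨hτ.1, hτ.2.le.trans ht1'⟩, h⟩) (not_le.2 hτ.2))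
  have h1' : ρ ≤ ‖u t1 - v‖ := h1
  have := norm_add_le (u t1 - u T) (u T - v)
  rw [sub_add_sub_cancel] at this
  linarith

lemma loj_rate {E : Type*} [NormedAddCommGroup E] [NormedSpace ℝ E]
    (u u' : ℝ → E) (y p G : ℝ → ℝ) (K k c θ : ℝ) (hK : 0 < K) (hk : 0 < k) (hc : 0 < c)
    (hθ : 0 < θ)
    (hu : ∀ t ≥ (0:ℝ), HasDerivAt u (u' t) t) (hy : ∀ t ≥ (0:ℝ), HasDerivAt y (-(p t)) t)
    (hpos : ∀ t ≥ (0:ℝ), 0 < y t) (hG : ∀ t, 0 ≤ G t)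
    (huG : ∀ t ≥ (0:ℝ), ‖u' t‖ ≤ K * G t) (hp : ∀ t ≥ (0:ℝ), k * (G t)^2 ≤ p t)
    (v : E) (hv : Tendsto u atTop (𝓝 v))
    (r : ℝ) (hr : 0 < r) (hL : ∀ τ ≥ (0:ℝ), ‖u τ - v‖ < r → c * (y τ)^(1-θ) ≤ G τ) :
    (θ = 1/2 → ∃ δ > (0:ℝ),
          (fun t => ‖u t - v‖) =O[atTop] fun t => Real.exp (-δ * t)) ∧
        (θ < 1/2 →
          (fun t => ‖u t - v‖) =O[atTop] fun t : ℝ => t ^ (-θ / (1 - 2*θ))) := by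
  obtain ⟨T, hT0, hT⟩ : ∃ T ≥ (0:ℝ), ∀ t ≥ T, c * (y t)^(1-θ) ≤ G t := by
    obtain ⟨T, hT⟩ := Metric.tendsto_atTop.1 hv r hr
    refine ⟨max T 0, le_max_right _ _, fun t ht => ?_⟩
    apply hL t ((le_max_right _ _).trans ht)
    rw [← dist_eq_norm]; exact hT t ((le_max_left _ _).trans ht)
  set D := K / (k * c * θ) with hD
  have hD0 : 0 < D := by positivity
  have hdist : ∀ s ≥ T, ‖u s - v‖ ≤ D * (y s)^θ := by
    intro s hs
    have h1 : Tendsto (fun t => ‖u t - u s‖) atTop (𝓝 ‖v - u s‖) := (hv.sub_const _).norm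
    rw [norm_sub_rev]
    refine le_of_tendsto h1 ?_
    filter_upwards [eventually_ge_atTop s] with t ht
    exact loj_length u u' y p G K k c θ hK hk hc hθ hu hy hpos hG huG hp s t (hT0.trans hs) ht
      (fun τ hτ => hT τ (hs.trans hτ.1))
  have hpy : ∀ t ≥ T, k * c^2 * (y t)^(2-2*θ) ≤ p t := by
    intro t ht
    have h0 : 0 ≤ t := hT0.trans ht
    have h1 : (y t)^(2-2*θ) = ((y t)^(1-θ))^2 := by
      rw [← Real.rpow_natCast, ← Real.rpow_mul (hpos t h0).le]; congr 1; push_cast; ring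
    have h2 : 0 ≤ (y t)^(1-θ) := Real.rpow_nonneg (hpos t h0).le _
    have h3 : (c * (y t)^(1-θ))^2 ≤ (G t)^2 := by
      have := hT t ht; gcongr
    calc _ = k * (c * (y t)^(1-θ))^2 := by rw [h1]; ring
      _ ≤ k * (G t)^2 := by gcongr
      _ ≤ _ := hp t h0
  constructor
  · intro hθ2
    set κ := k * c^2 with hκ
    have hκ0 : 0 < κ := by positivity
    refine ⟨κ/2, by positivity, ?_⟩
    have hder : ∀ t ≥ T, HasDerivAt (fun t => y t * Real.exp (κ * t)) 
        (-(p t) * Real.exp (κ * t) + y t * (Real.exp (κ * t) * κ)) t := by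
      intro t ht
      have h1 : HasDerivAt (fun t => κ * t) κ t := by simpa using (hasDerivAt_id t).const_mul κ
      exact (hy t (hT0.trans ht)).mul h1.exp
    have hanti : AntitoneOn (fun t => y t * Real.exp (κ * t)) (Set.Ici T) := by
      refine antitoneOn_of_hasDerivWithinAt_nonpos (convex_Ici T) 
        (fun t ht => (hder t ht).continuousAt.continuousWithinAt) 
        (fun t ht => (hder t (interior_subset ht)).hasDerivWithinAt) ?_
      intro t ht
      have ht' : T ≤ t := interior_subset ht
      have h1 := hpy t ht'
      rw [hθ2] at h1
      norm_num at h1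
      have := Real.exp_pos (κ * t)
      nlinarith
    refine IsBigO.of_bound (D * (y T * Real.exp (κ * T))^θ) ?_
    filter_upwards [eventually_ge_atTop T] with t ht
    rw [norm_norm, Real.norm_eq_abs, abs_of_pos (Real.exp_pos _)]
    have h1 := hanti (Set.self_mem_Ici) ht ht
    simp only at h1
    have h2 : y t ≤ (y T * Real.exp (κ * T)) * Real.exp (-(κ * t)) := by
      rw [Real.exp_neg, ← div_eq_mul_inv, le_div_iff₀ (Real.exp_pos _)]; exact h1
    have hyT := hpos T hT0
    have hyt := hpos t (hT0.trans ht)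
    calc _ ≤ D * (y t)^θ := hdist t ht
      _ ≤ D * ((y T * Real.exp (κ * T)) * Real.exp (-(κ * t)))^θ := by gcongr
      _ = _ := by
        rw [Real.mul_rpow (by positivity) (by positivity), ← Real.exp_mul, hθ2, ← mul_assoc]
        congr 2; ring
  · intro hθ2
    set q := 1 - 2*θ with hq
    have hq0 : 0 < q := by rw [hq]; linarith
    set m := q * (k * c^2) with hm
    have hm0 : 0 < m := by positivity
    have hder : ∀ t ≥ T, HasDerivAt (fun t => (y t)^(-q) - m * t) 
        (-(p t) * (-q) * (y t)^(-q-1) - m) t := by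
      intro t ht
      have h1 : HasDerivAt (fun t => m * t) m t := by simpa using (hasDerivAt_id t).const_mul m
      exact ((hy t (hT0.trans ht)).rpow_const (Or.inl (hpos t (hT0.trans ht)).ne')).sub h1
    have hmono : MonotoneOn (fun t => (y t)^(-q) - m * t) (Set.Ici T) := by
      refine monotoneOn_of_hasDerivWithinAt_nonneg (convex_Ici T) 
        (fun t ht => (hder t ht).continuousAt.continuousWithinAt) 
        (fun t ht => (hder t (interior_subset ht)).hasDerivWithinAt) ?_
      intro t ht
      have ht' : T ≤ t := interior_subset ht
      have hyt := hpos t (hT0.trans ht')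
      have h1 := hpy t ht'
      have h2 : (y t)^(2-2*θ) * (y t)^(-q-1) = 1 := by
        rw [← Real.rpow_add hyt, hq]; ring_nf; simp
      have h3 : 0 < (y t)^(-q-1) := Real.rpow_pos_of_pos hyt _
      have h4 := mul_le_mul_of_nonneg_right h1 (mul_pos hq0 h3).le
      have h5 : k * c ^ 2 * y t ^ (2 - 2 * θ) * (q * y t ^ (-q - 1)) = m := by
        rw [show k * c ^ 2 * y t ^ (2 - 2 * θ) * (q * y t ^ (-q - 1)) 
          = k * c^2 * q * (y t ^ (2 - 2 * θ) * y t ^ (-q - 1)) by ring, h2, hm]; ring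
      rw [h5] at h4
      linarith
    refine IsBigO.of_bound (D * (m/2)^(-θ/q)) ?_
    filter_upwards [eventually_ge_atTop T, eventually_ge_atTop (2*T), eventually_gt_atTop 0] 
      with t ht ht2 ht0
    rw [norm_norm, Real.norm_eq_abs, abs_of_pos (Real.rpow_pos_of_pos ht0 _)]
    have h1 := hmono (Set.self_mem_Ici) ht ht
    simp only at h1
    have hyT := Real.rpow_pos_of_pos (hpos T hT0) (-q)
    have hyt := hpos t (hT0.trans ht)
    have h2 : m/2 * t ≤ (y t)^(-q) := by nlinarith
    have h3 : (y t)^θ = ((y t)^(-q))^(-θ/q) := by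
      rw [← Real.rpow_mul hyt.le]; congr 1; field_simp
    calc _ ≤ D * (y t)^θ := hdist t ht
      _ ≤ D * (m/2 * t)^(-θ/q) := by
        rw [h3]
        apply mul_le_mul_of_nonneg_left _ hD0.le
        exact Real.rpow_le_rpow_of_nonpos (by positivity) h2 
          (div_nonpos_of_nonpos_of_nonneg (by linarith) hq0.le)
      _ = _ := by
        rw [Real.mul_rpow (by positivity) ht0.le, mul_assoc]

/-- the gradient field -/
noncomputable def lvF {N : ℕ} (a : Fin N → ℝ) (B : Matrix (Fin N) (Fin N) ℝ)
    (v : EuclideanSpace ℝ (Fin N)) : EuclideanSpace ℝ (Fin N) :=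
  WithLp.toLp 2 (fun i => -(1/2) * v i * lvg a B (fun j => (v j)^2) i)

lemma lvF_apply {N : ℕ} (a : Fin N → ℝ) (B : Matrix (Fin N) (Fin N) ℝ)
    (v : EuclideanSpace ℝ (Fin N)) (i : Fin N) :
    lvF a B v i = -(1/2) * v i * lvg a B (fun j => (v j)^2) i := rfl

lemma lvF_cont {N : ℕ} (a : Fin N → ℝ) (B : Matrix (Fin N) (Fin N) ℝ) :
    Continuous (lvF a B) := by
  unfold lvF lvg
  fun_prop

lemma lv_grad {N : ℕ} (a : Fin N → ℝ) (B : Matrix (Fin N) (Fin N) ℝ) (hB : B.IsSymm)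
    (v : EuclideanSpace ℝ (Fin N)) :
    HasGradientAt (fun v : EuclideanSpace ℝ (Fin N) => lvq a B (fun i => (v i)^2)) (lvF a B v) v := by
  rw [hasGradientAt_iff_hasFDerivAt]
  have hx : ∀ i, HasFDerivAt (fun v : EuclideanSpace ℝ (Fin N) => (v i)^2)
      ((2 * v i) • (EuclideanSpace.proj i : EuclideanSpace ℝ (Fin N) →L[ℝ] ℝ)) v := by
    intro i
    have h := (EuclideanSpace.proj i : EuclideanSpace ℝ (Fin N) →L[ℝ] ℝ).hasFDerivAt (x := v)
    simpa using h.pow 2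
  have h1 := (HasFDerivAt.fun_sum fun i (_ : i ∈ Finset.univ) => (hx i).mul_const (a i)).const_mul (-(1/4))
  have h2 := (HasFDerivAt.fun_sum fun i (_ : i ∈ Finset.univ) => 
    (HasFDerivAt.fun_sum fun j (_ : j ∈ Finset.univ) => 
      ((hx i).const_mul (B i j)).mul (hx j))).const_mul (1/8)
  refine (h1.add h2).congr_fderiv ?_
  ext w
  have hs : ∑ i, ∑ j, B i j * (v i)^2 * (v j * w j) = ∑ i, ∑ j, B i j * (v i * w i) * (v j)^2 := by
    rw [Finset.sum_comm]
    refine Finset.sum_congr rfl fun i _ => Finset.sum_congr rfl fun j _ => ?_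
    rw [hB.apply i j]; ring
  have e1 : ∑ i, ∑ j, (B i j * (v i)^2 * (2 * v j * w j) + (v j)^2 * (B i j * (2 * v i * w i)))
      = 4 * ∑ i, ∑ j, B i j * (v i * w i) * (v j)^2 := by
    have : ∀ i j, (B i j * (v i)^2 * (2 * v j * w j) + (v j)^2 * (B i j * (2 * v i * w i)))
      = 2 * (B i j * (v i)^2 * (v j * w j)) + 2 * (B i j * (v i * w i) * (v j)^2) := by
      intro i j; ring
    simp only [this, Finset.sum_add_distrib, ← Finset.mul_sum, hs]; ring
  have e2 : inner ℝ (lvF a B v) w = ∑ i, (-(1/2) * (a i * (v i * w i)) + 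
      (1/2) * ∑ j, B i j * (v i * w i) * (v j)^2) := by
    rw [PiLp.inner_apply]
    refine Finset.sum_congr rfl fun i _ => ?_
    have : ∑ j, B i j * (v i * w i) * (v j)^2 = (v i * w i) * ∑ j, B i j * (v j)^2 := by
      rw [Finset.mul_sum]; exact Finset.sum_congr rfl fun j _ => by ring
    rw [this, lvF_apply]
    simp [lvg]; ring
  have e3 : ∑ i, a i * (2 * v i * w i) = 2 * ∑ i, a i * (v i * w i) := by
    rw [Finset.mul_sum]; exact Finset.sum_congr rfl fun j _ => by ring
  rw [InnerProductSpace.toDual_apply_apply, e2, Finset.sum_add_distrib, ← Finset.mul_sum, ← Finset.mul_sum]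
  simp only [add_apply, smul_apply, 
    sum_apply, smul_eq_mul, PiLp.proj_apply, e1, e3]
  ring

lemma lv_norm_sq {N : ℕ} (z : EuclideanSpace ℝ (Fin N)) : ‖z‖^2 = ∑ i, (z i)^2 := by
  rw [EuclideanSpace.norm_sq_eq]; simp

lemma lv_loj {N : ℕ} (a : Fin N → ℝ) (B : Matrix (Fin N) (Fin N) ℝ) (hB : B.IsSymm)
    (v : EuclideanSpace ℝ (Fin N)) (hv : lvF a B v = 0) :
    ∃ c > (0:ℝ), ∃ r > (0:ℝ), ∀ z : EuclideanSpace ℝ (Fin N), ‖z - v‖ < r → 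
      c * |lvq a B (fun i => (z i)^2) - lvq a B (fun i => (v i)^2)| ^ (1 - (1/4:ℝ)) 
        ≤ ‖lvF a B z‖ := by
  obtain ⟨C, hC0, η, hη, h⟩ := loj_alg a B hB (fun i => (v i)^2)
  have hc1 : Continuous (fun z => ‖lvF a B z‖^(1/3:ℝ)) := 
    (lvF_cont a B).norm.rpow_const fun _ => Or.inr (by norm_num)
  have hc2 : Continuous (fun z : EuclideanSpace ℝ (Fin N) => 
      ‖(fun i => (z i)^2) - (fun i => (v i)^2)‖) := by fun_prop
  have ev1 : ∀ᶠ z in 𝓝 v, ‖lvF a B z‖^(1/3:ℝ) < η := by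
    refine hc1.continuousAt.eventually_lt_const ?_
    simp only [hv]
    rw [norm_zero, Real.zero_rpow (by norm_num)]; exact hη
  have ev2 : ∀ᶠ z : EuclideanSpace ℝ (Fin N) in 𝓝 v, 
      ‖(fun i => (z i)^2) - (fun i => (v i)^2)‖ < η := by
    refine hc2.continuousAt.eventually_lt_const ?_
    simpa using hη
  obtain ⟨r, hr, hrr⟩ := Metric.eventually_nhds_iff.1 (ev1.and ev2)
  refine ⟨((C+1)^(3/4:ℝ))⁻¹, by positivity, r, hr, fun z hz => ?_⟩
  obtain ⟨hz1, hz2⟩ := hrr (by rwa [dist_eq_norm])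
  set w := ‖lvF a B z‖^(1/3:ℝ) with hw
  have hw0 : 0 ≤ w := by positivity
  have hw3 : w^3 = ‖lvF a B z‖ := by
    rw [hw, ← Real.rpow_natCast, ← Real.rpow_mul (norm_nonneg _)]; norm_num
  have key := h (fun i => (z i)^2) w hw0 hz1 hz2 (fun i => sq_nonneg _) (by
    intro i
    have h1 : (lvF a B z i)^2 ≤ ‖lvF a B z‖^2 := by
      rw [lv_norm_sq]
      exact Finset.single_le_sum (f := fun i => (lvF a B z i)^2) (fun i _ => sq_nonneg _) (Finset.mem_univ i)
    rw [← hw3, lvF_apply] at h1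
    nlinarith)
  rw [inv_mul_le_iff₀ (by positivity), ← hw3]
  calc _ ≤ ((C+1) * w^4)^(3/4:ℝ) := by
        norm_num
        apply Real.rpow_le_rpow (abs_nonneg _) _ (by norm_num)
        refine key.trans ?_
        gcongr; linarith
    _ = _ := by
        rw [Real.mul_rpow (by positivity) (by positivity)]
        congr 1
        rw [← Real.rpow_natCast, ← Real.rpow_mul hw0, ← Real.rpow_natCast]; norm_num

theorem desingularized_lotka_volterra_convergence {N : ℕ}
    (a d : Fin N → ℝ) (ha : ∀ i, 0 < a i) (hd : ∀ i, 0 < d i)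
    (B : Matrix (Fin N) (Fin N) ℝ) (hB : B.IsSymm)
    (H : EuclideanSpace ℝ (Fin N) → ℝ)
    (hHdef : ∀ v, H v
      = -(1/4) * ∑ i, (v i)^2 * a i + (1/8) * ∑ i, ∑ j, B i j * (v i)^2 * (v j)^2)
    (u : ℝ → EuclideanSpace ℝ (Fin N))
    (hbdd : ∃ C, ∀ t ≥ (0:ℝ), ‖u t‖ ≤ C)
    (hode : ∀ t ≥ (0:ℝ), ∀ i, HasDerivAt (fun s => u s i)
      ((1/2) * d i * u t i * (a i - ∑ j, B i j * (u t j)^2)) t) :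
    ∃ uLim, Tendsto u atTop (𝓝 uLim) ∧
      ∀ c > (0:ℝ), ∀ r > (0:ℝ), ∀ θ ∈ Set.Ioc (0:ℝ) (1/2),
        (∀ v, ‖v - uLim‖ < r → c * |H v - H uLim| ^ (1 - θ) ≤ ‖gradient H v‖) →
        (θ = 1/2 → ∃ δ > (0:ℝ),
          (fun t => ‖u t - uLim‖) =O[atTop] fun t => Real.exp (-δ * t)) ∧
        (θ < 1/2 →
          (fun t => ‖u t - uLim‖) =O[atTop] fun t : ℝ => t ^ (-θ / (1 - 2*θ))) := by
  have hH : H = fun v : EuclideanSpace ℝ (Fin N) => lvq a B (fun i => (v i)^2) := by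
    funext v; rw [hHdef]; rfl
  have hgr : ∀ v, HasGradientAt H (lvF a B v) v := fun v => by rw [hH]; exact lv_grad a B hB v
  have hgrad : ∀ v, gradient H v = lvF a B v := fun v => (hgr v).gradient
  have hHc : Continuous H := 
    continuous_iff_continuousAt.2 fun v => (hgr v).differentiableAt.continuousAt
  have hFc := lvF_cont a B
  -- constants
  obtain ⟨k, hk, hkd⟩ : ∃ k > (0:ℝ), ∀ i, k ≤ d i := by
    have hev : ∀ᶠ e in 𝓝[>] (0:ℝ), ∀ i, e < d i := 
      eventually_all.2 fun i => nhdsWithin_le_nhds (eventually_lt_nhds (hd i))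
    obtain ⟨e, he, hpos⟩ := (hev.and self_mem_nhdsWithin).exists
    exact ⟨e, hpos, fun i => (he i).le⟩
  obtain ⟨K, hK, hKd⟩ : ∃ K > (0:ℝ), ∀ i, d i ≤ K := by
    have h0 : 0 ≤ ∑ i, d i := Finset.sum_nonneg fun i _ => (hd i).le
    refine ⟨1 + ∑ i, d i, by linarith, fun i => ?_⟩
    have := Finset.single_le_sum (f := d) (fun i _ => (hd i).le) (Finset.mem_univ i)
    linarith
  let P : EuclideanSpace ℝ (Fin N) → ℝ := fun v => ∑ i, d i * (lvF a B v i)^2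
  have hPc : Continuous P := by
    have : ∀ i, Continuous fun v => lvF a B v i := fun i => 
      (EuclideanSpace.proj i : EuclideanSpace ℝ (Fin N) →L[ℝ] ℝ).continuous.comp hFc
    fun_prop
  have hPk : ∀ v, k * ‖lvF a B v‖^2 ≤ P v := by
    intro v
    rw [lv_norm_sq, Finset.mul_sum]
    exact Finset.sum_le_sum fun i _ => mul_le_mul_of_nonneg_right (hkd i) (sq_nonneg _)
  have hP0 : ∀ v, 0 ≤ P v := fun v => le_trans (by positivity) (hPk v)
  let u' : ℝ → EuclideanSpace ℝ (Fin N) := fun t => WithLp.toLp 2 fun i => -(d i * lvF a B (u t) i)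
  have hu'a : ∀ t i, u' t i = -(d i * lvF a B (u t) i) := fun t i => rfl
  have hu : ∀ t ≥ (0:ℝ), HasDerivAt u (u' t) t := by
    intro t ht
    rw [hasDerivAt_iff_hasFDerivAt, ← hasFDerivWithinAt_univ, hasFDerivWithinAt_euclidean]
    intro i
    rw [hasFDerivWithinAt_univ]
    have h1 := (hode t ht i).hasFDerivAt
    refine h1.congr_fderiv ?_
    ext
    simp [hu'a, lvF_apply, lvg]
    ring
  have huG : ∀ t ≥ (0:ℝ), ‖u' t‖ ≤ K * ‖lvF a B (u t)‖ := by
    intro t _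
    refine (sq_le_sq₀ (norm_nonneg _) (by positivity)).1 ?_
    rw [mul_pow, lv_norm_sq, lv_norm_sq, Finset.mul_sum]
    refine Finset.sum_le_sum fun i _ => ?_
    rw [hu'a, neg_sq, mul_pow]
    have h1 := hKd i
    have h2 := (hd i).le
    gcongr
  have hh : ∀ t ≥ (0:ℝ), HasDerivAt (fun t => H (u t)) (-(P (u t))) t := by
    intro t ht
    have h1 := (hgr (u t)).hasFDerivAt.comp_hasDerivAt t (hu t ht)
    refine h1.congr_deriv ?_
    rw [InnerProductSpace.toDual_apply_apply, PiLp.inner_apply]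
    simp only [P, hu'a, ← Finset.sum_neg_distrib]
    refine Finset.sum_congr rfl fun i _ => ?_
    simp; ring
  have hanti : AntitoneOn (fun t => H (u t)) (Set.Ici 0) := by
    refine antitoneOn_of_hasDerivWithinAt_nonpos (convex_Ici 0) 
        (fun t ht => (hh t ht).continuousAt.continuousWithinAt) 
        (fun t ht => (hh t (interior_subset ht)).hasDerivWithinAt) ?_
    intro t _
    have := hP0 (u t)
    linarith
  obtain ⟨C, hC⟩ := hbdd
  have hcomp : IsCompact (Metric.closedBall (0 : EuclideanSpace ℝ (Fin N)) C) :=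
    isCompact_closedBall _ _
  have humem : ∀ t ≥ (0:ℝ), u t ∈ Metric.closedBall (0 : EuclideanSpace ℝ (Fin N)) C := by
    intro t ht; simpa using hC t ht
  obtain ⟨ℓ, hℓ⟩ : ∃ ℓ, Tendsto (fun t => H (u t)) atTop (𝓝 ℓ) := by
    have hm : Antitone fun t : ℝ => H (u (max t 0)) := fun s t hst => 
      hanti (le_max_right s 0) (le_max_right t 0) (max_le_max_right 0 hst)
    obtain ⟨b, hb⟩ := (hcomp.image hHc).bddBelow
    have hbb : BddBelow (Set.range fun t : ℝ => H (u (max t 0))) := by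
      refine ⟨b, ?_⟩
      rintro _ ⟨t, rfl⟩
      exact hb ⟨_, humem _ (le_max_right _ _), rfl⟩
    refine ⟨_, (tendsto_atTop_ciInf hm hbb).congr' ?_⟩
    filter_upwards [eventually_ge_atTop 0] with t ht
    rw [max_eq_left ht]
  have hge : ∀ t ≥ (0:ℝ), ℓ ≤ H (u t) := by
    intro t ht
    refine le_of_tendsto hℓ ?_
    filter_upwards [eventually_ge_atTop t] with s hs
    exact hanti ht (ht.trans hs) hs
  by_cases hzero : ∃ τ ≥ (0:ℝ), H (u τ) = ℓ
  · obtain ⟨τ, hτ0, hτ⟩ := hzero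
    have hconst : ∀ t ≥ τ, H (u t) = ℓ := fun t ht => 
      le_antisymm (hτ ▸ hanti hτ0 (hτ0.trans ht) ht) (hge t (hτ0.trans ht))
    have hu0 : ∀ t > τ, u' t = 0 := by
      intro t ht
      have h1 : HasDerivAt (fun t => H (u t)) 0 t := by
        refine (hasDerivAt_const t ℓ).congr_of_eventuallyEq ?_
        filter_upwards [eventually_gt_nhds ht] with s hs
        exact hconst s hs.le
      have h0 : 0 ≤ t := hτ0.trans ht.le
      have h2 := (hh t h0).unique h1
      have h3 := hPk (u t)
      have h4 : ‖lvF a B (u t)‖^2 ≤ 0 := by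
        by_contra! h5
        have := mul_pos hk h5
        linarith
      have h5 : ‖lvF a B (u t)‖ = 0 := by
        exact pow_eq_zero_iff (two_ne_zero) |>.1 (le_antisymm h4 (sq_nonneg _))
      have h6 := huG t h0
      rw [h5, mul_zero] at h6
      exact norm_le_zero_iff.1 h6
    have huc : ∀ t ≥ τ + 1, u t = u (τ + 1) := by
      intro t ht
      have h1 := norm_image_sub_le_of_norm_deriv_right_le_segment (f := u) (f' := u') (a := τ + 1)
        (b := t) (C := 0) 
        (fun s hs => (hu s (by linarith [hs.1])).continuousAt.continuousWithinAt)
        (fun s hs => (hu s (by linarith [hs.1])).hasDerivWithinAt)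
        (fun s hs => by rw [hu0 s (by linarith [hs.1])]; simp) t ⟨ht, le_rfl⟩
      rw [zero_mul] at h1
      exact sub_eq_zero.1 (norm_le_zero_iff.1 h1)
    have hev : u =ᶠ[atTop] fun _ => u (τ + 1) := by
      filter_upwards [eventually_ge_atTop (τ + 1)] with t ht using huc t ht
    have hev2 : (fun t => ‖u t - u (τ + 1)‖) =ᶠ[atTop] fun _ => (0:ℝ) := by
      filter_upwards [hev] with t ht
      rw [ht]; simp
    refine ⟨u (τ + 1), tendsto_const_nhds.congr' hev.symm, ?_⟩
    intro c _ r _ θ _ _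
    exact ⟨fun _ => ⟨1, one_pos, hev2.trans_isBigO (isBigO_zero _ _)⟩, 
      fun _ => hev2.trans_isBigO (isBigO_zero _ _)⟩
  push Not at hzero
  have hpos : ∀ t ≥ (0:ℝ), 0 < H (u t) - ℓ := fun t ht => 
    sub_pos.2 (lt_of_le_of_ne (hge t ht) (hzero t ht).symm)
  have hy : ∀ t ≥ (0:ℝ), HasDerivAt (fun t => H (u t) - ℓ) (-(P (u t))) t := fun t ht => 
    (hh t ht).sub_const ℓ
  -- critical cluster point
  obtain ⟨v, hvF, hvc⟩ : ∃ v, lvF a B v = 0 ∧ MapClusterPt v atTop u := by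
    have hex : ∀ n : ℕ, ∃ ξ ∈ Set.Ioo (n:ℝ) (n+1), P (u ξ) = H (u n) - H (u (n+1)) := by
      intro n
      have hn : (0:ℝ) ≤ n := n.cast_nonneg
      obtain ⟨ξ, h1, h2⟩ := exists_hasDerivAt_eq_slope (fun t => H (u t)) (fun t => -(P (u t))) 
        (a := (n:ℝ)) (b := n+1) (by linarith) 
        (fun s hs => (hh s (hn.trans hs.1)).continuousAt.continuousWithinAt)
        (fun s hs => hh s (hn.trans hs.1.le))
      refine ⟨ξ, h1, ?_⟩
      simp at h2
      linarith
    choose ξ hξ hξP using hex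
    have hξt : Tendsto ξ atTop atTop := 
      tendsto_atTop_mono (fun n => (hξ n).1.le) tendsto_natCast_atTop_atTop
    have hPt : Tendsto (fun n => P (u (ξ n))) atTop (𝓝 0) := by
      simp only [hξP]
      have h1 : Tendsto (fun n : ℕ => H (u (n:ℝ))) atTop (𝓝 ℓ) := 
        hℓ.comp tendsto_natCast_atTop_atTop
      have h2 : Tendsto (fun n : ℕ => H (u ((n:ℝ)+1))) atTop (𝓝 ℓ) := 
        hℓ.comp (tendsto_atTop_add_const_right _ 1 tendsto_natCast_atTop_atTop)
      simpa using h1.sub h2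
    obtain ⟨v, -, φ, hφ, hφv⟩ := hcomp.tendsto_subseq (x := fun n => u (ξ n)) 
      (fun n => humem _ ((n.cast_nonneg).trans (hξ n).1.le))
    refine ⟨v, ?_, ?_⟩
    · have h1 : Tendsto (fun n => P (u (ξ (φ n)))) atTop (𝓝 (P v)) := 
        (hPc.tendsto v).comp hφv
      have h2 := tendsto_nhds_unique h1 (hPt.comp hφ.tendsto_atTop)
      have h3 := hPk v
      have h4 : ‖lvF a B v‖^2 ≤ 0 := by
        by_contra! h5
        have := mul_pos hk h5
        linarith
      exact norm_eq_zero.1 (pow_eq_zero_iff (two_ne_zero) |>.1 (le_antisymm h4 (sq_nonneg _)))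
    · exact MapClusterPt.of_comp (hξt.comp hφ.tendsto_atTop) hφv.mapClusterPt
  have hHv : H v = ℓ := by
    have h1 : MapClusterPt (H v) atTop (fun t => H (u t)) := hvc.continuousAt_comp hHc.continuousAt
    by_contra hne
    obtain ⟨U, V, hU, hV, hvU, hlV, hdis⟩ := t2_separation hne
    obtain ⟨t, ht1, ht2⟩ := ((mapClusterPt_iff_frequently.1 h1 U (hU.mem_nhds hvU)).and_eventually
      (hℓ (hV.mem_nhds hlV))).exists
    exact Set.disjoint_left.1 hdis ht1 ht2
  obtain ⟨c, hc, r, hr, hloj⟩ := lv_loj a B hB v hvF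
  have hy0 : Tendsto (fun t => H (u t) - ℓ) atTop (𝓝 0) := by
    simpa using hℓ.sub_const ℓ
  have hconv : Tendsto u atTop (𝓝 v) := 
    loj_conv u u' (fun t => H (u t) - ℓ) (fun t => P (u t)) (fun t => ‖lvF a B (u t)‖) 
      K k c (1/4) hK hk hc (by norm_num) hu hy hpos (fun _ => norm_nonneg _) huG 
      (fun t _ => hPk (u t)) hy0 v hvc r hr (by
        intro τ hτ hlt
        have h1 := hloj (u τ) hlt
        have h2 : |H (u τ) - H v| = H (u τ) - ℓ := by rw [hHv, abs_of_pos (hpos τ hτ)]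
        rw [← h2]
        simpa only [hH] using h1)
  refine ⟨v, hconv, ?_⟩
  intro c hc r hr θ hθ hL
  exact loj_rate u u' (fun t => H (u t) - ℓ) (fun t => P (u t)) (fun t => ‖lvF a B (u t)‖) 
      K k c θ hK hk hc hθ.1 hu hy hpos (fun _ => norm_nonneg _) huG 
      (fun t _ => hPk (u t)) v hconv r hr (by
        intro τ hτ hlt
        have h1 := hL (u τ) hlt
        rwa [hHv, abs_of_pos (hpos τ hτ), hgrad] at h1)
end

section
/- Let Ĥ : ℝ^N → ℝ be C¹ and satisfy the Łojasiewicz inequality at every critical point, and let μ̂, ν̂ > 0. Let u : [0,∞) → ℝ^N be a bounded differentiable solution of the de-singularized regularized Lotka-Volterra system u_i'(t) = -(1/(μ̂ + ν̂·u_i(t)²))·∇Ĥ(u(t))_i for all i. Then u(t) converges to some ũ with ∇Ĥ(ũ) = 0 as t → ∞, and with θ a Łojasiewicz exponent of Ĥ at ũ: ‖u(t) - ũ‖ = O(e^{-δt}) for some δ > 0 if θ = 1/2, and ‖u(t) - ũ‖ = O(t^{-θ/(1-2θ)}) if 0 < θ < 1/2. -/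
open Filter Topology Asymptotics

theorem rlv_anti {h D : ℝ → ℝ} (hh : ∀ t ≥ (0:ℝ), HasDerivAt h (-(D t)) t)
    (hD : ∀ t ≥ (0:ℝ), 0 ≤ D t) : AntitoneOn h (Set.Ici 0) := by
  apply antitoneOn_of_deriv_nonpos (convex_Ici 0)
  · intro t ht
    exact (hh t ht).continuousAt.continuousWithinAt
  · intro t ht
    rw [interior_Ici] at ht
    exact (hh t (le_of_lt ht)).differentiableAt.differentiableWithinAt
  · intro t ht
    rw [interior_Ici] at ht
    rw [(hh t (le_of_lt ht)).deriv]
    linarith [hD t (le_of_lt ht)]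

theorem rlv_lim {h : ℝ → ℝ} (ha : AntitoneOn h (Set.Ici 0)) {l : ℝ}
    (hc : MapClusterPt l atTop h) : (∀ t ≥ (0:ℝ), l ≤ h t) ∧ Tendsto h atTop (𝓝 l) := by
  have key : ∀ t ≥ (0:ℝ), ∀ ε > (0:ℝ), ∃ s ≥ t, |h s - l| < ε := by
    intro t ht ε hε
    have h1 := (mapClusterPt_iff_frequently.1 hc) (Metric.ball l ε) (Metric.ball_mem_nhds l hε)
    obtain ⟨s, hs1, hs2⟩ := (h1.and_eventually (eventually_ge_atTop t)).exists
    exact ⟨s, hs2, by simpa [Real.dist_eq] using hs1⟩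
  have h1 : ∀ t ≥ (0:ℝ), l ≤ h t := by
    intro t ht
    refine le_of_forall_pos_le_add fun ε hε => ?_
    obtain ⟨s, hs, hs2⟩ := key t ht ε hε
    have := ha (Set.mem_Ici.2 ht) (Set.mem_Ici.2 (ht.trans hs)) hs
    have := (abs_lt.1 hs2).1
    linarith
  refine ⟨h1, ?_⟩
  rw [Metric.tendsto_atTop]
  intro ε hε
  obtain ⟨s, hs, hs2⟩ := key 0 le_rfl ε hε
  refine ⟨s, fun t ht => ?_⟩
  have h3 := ha (Set.mem_Ici.2 hs) (Set.mem_Ici.2 (le_trans hs ht)) ht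
  have h4 := h1 t (le_trans hs ht)
  rw [Real.dist_eq, abs_of_nonneg (by linarith)]
  linarith [(abs_lt.1 hs2).2]

theorem rlv_len {E : Type*} [NormedAddCommGroup E] [NormedSpace ℝ E]
    {u v : ℝ → E} {e D g : ℝ → ℝ} {κ K c r θ : ℝ} {a : E}
    (hκ : 0 < κ) (hK : 0 < K) (hc : 0 < c) (hθ : 0 < θ)
    (hu : ∀ t ≥ (0:ℝ), HasDerivAt u (v t) t)
    (he : ∀ t ≥ (0:ℝ), HasDerivAt e (-(D t)) t)
    (hD : ∀ t ≥ (0:ℝ), κ * g t ^ 2 ≤ D t)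
    (hv : ∀ t ≥ (0:ℝ), ‖v t‖ ≤ K * g t)
    (hpos : ∀ t ≥ (0:ℝ), 0 < e t)
    (hL : ∀ t ≥ (0:ℝ), ‖u t - a‖ < r → c * e t ^ (1 - θ) ≤ g t)
    {s : ℝ} (hs : 0 ≤ s) (hsr : ‖u s - a‖ + (2 * K / (θ * κ * c)) * e s ^ θ < r)
    {t : ℝ} (ht : s ≤ t) :
    ‖u t - u s‖ ≤ (2 * K / (θ * κ * c)) * (e s ^ θ - e t ^ θ) := by
  set L := 2 * K / (θ * κ * c) with hLdef
  have hLpos : 0 < L := by positivity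
  have hB : ∀ x ≥ (0:ℝ), HasDerivAt (fun x => L * (e s ^ θ - e x ^ θ))
      (L * (θ * e x ^ (θ - 1) * D x)) x := by
    intro x hx
    have h1 := (((he x hx).rpow_const (p := θ) (Or.inl (hpos x hx).ne')).const_sub
      (e s ^ θ)).const_mul L
    exact h1.congr_deriv (by ring)
  refine image_norm_le_of_norm_deriv_right_lt_deriv_boundary'
    (f := fun x => u x - u s) (f' := v) (a := s) (b := t)
    (B := fun x => L * (e s ^ θ - e x ^ θ))
    (B' := fun x => L * (θ * e x ^ (θ - 1) * D x)) ?_ ?_ ?_ ?_ ?_ ?_ ⟨ht, le_rfl⟩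
  · intro x hx
    exact ((hu x (hs.trans hx.1)).continuousAt.sub continuousAt_const).continuousWithinAt
  · intro x hx
    exact ((hu x (hs.trans hx.1)).sub_const _).hasDerivWithinAt
  · simp
  · intro x hx
    exact (hB x (hs.trans hx.1)).continuousAt.continuousWithinAt
  · intro x hx
    exact (hB x (hs.trans hx.1)).hasDerivWithinAt
  · intro x hx heq
    have hx0 : 0 ≤ x := hs.trans hx.1
    have hex := hpos x hx0
    have h1 : 0 < e x ^ θ := Real.rpow_pos_of_pos hex _
    have hball : ‖u x - a‖ < r := by
      have : ‖u x - a‖ ≤ ‖u x - u s‖ + ‖u s - a‖ := norm_sub_le_norm_sub_add_norm_sub _ _ _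
      rw [heq] at this
      nlinarith
    have h2 := hL x hx0 hball
    have h3 : 0 < e x ^ (1 - θ) := Real.rpow_pos_of_pos hex _
    have h4 : 0 < e x ^ (θ - 1) := Real.rpow_pos_of_pos hex _
    have h5 : e x ^ (θ - 1) * e x ^ (1 - θ) = 1 := by
      rw [← Real.rpow_add hex]; simp
    have hg : 0 < g x := lt_of_lt_of_le (by positivity) h2
    have h6 : c ≤ e x ^ (θ - 1) * g x := by
      have := mul_le_mul_of_nonneg_left h2 h4.le
      calc c = e x ^ (θ - 1) * (c * e x ^ (1 - θ)) := by linear_combination (-c) * h5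
        _ ≤ _ := this
    calc ‖v x‖ ≤ K * g x := hv x hx0
      _ < 2 * K * g x := by nlinarith [mul_pos hK hg]
      _ = L * (θ * κ * (c * g x)) := by rw [hLdef]; field_simp
      _ ≤ L * (θ * κ * ((e x ^ (θ - 1) * g x) * g x)) := by gcongr
      _ = L * (θ * e x ^ (θ - 1) * (κ * g x ^ 2)) := by ring
      _ ≤ _ := by
        have := hD x hx0
        gcongr

theorem rlv_dich {E : Type*} [NormedAddCommGroup E] [NormedSpace ℝ E]
    {u v : ℝ → E} {e D g : ℝ → ℝ} {κ K c r θ : ℝ} {a : E}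
    (hκ : 0 < κ) (hK : 0 < K) (hc : 0 < c) (hθ : 0 < θ) (hr : 0 < r)
    (hu : ∀ t ≥ (0:ℝ), HasDerivAt u (v t) t)
    (he : ∀ t ≥ (0:ℝ), HasDerivAt e (-(D t)) t)
    (hD : ∀ t ≥ (0:ℝ), κ * g t ^ 2 ≤ D t)
    (hv : ∀ t ≥ (0:ℝ), ‖v t‖ ≤ K * g t)
    (hL : ∀ t ≥ (0:ℝ), ‖u t - a‖ < r → c * |e t| ^ (1 - θ) ≤ g t)
    (hcl : MapClusterPt a atTop u) (hcl2 : MapClusterPt 0 atTop e) :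
    (∃ T, ∀ t ≥ T, u t = a) ∨ ((∀ t ≥ (0:ℝ), 0 < e t) ∧ ∃ S ≥ (0:ℝ), ∀ t ≥ S,
      ‖u t - a‖ < r ∧ ‖u t - a‖ ≤ (2 * K / (θ * κ * c)) * e t ^ θ) := by
  have hanti := rlv_anti he (fun t ht => le_trans (by positivity) (hD t ht))
  obtain ⟨hnn, hlim⟩ := rlv_lim hanti hcl2
  have hfreq : ∀ t : ℝ, ∀ ε > (0:ℝ), ∃ s ≥ t, ‖u s - a‖ < ε := by
    intro t ε hε
    have h1 := (mapClusterPt_iff_frequently.1 hcl) (Metric.ball a ε) (Metric.ball_mem_nhds a hε)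
    obtain ⟨s, hs1, hs2⟩ := (h1.and_eventually (eventually_ge_atTop t)).exists
    exact ⟨s, hs2, by simpa [dist_eq_norm] using hs1⟩
  by_cases hz : ∃ T ≥ (0:ℝ), e T = 0
  · left
    obtain ⟨T, hT, hT0⟩ := hz
    have hzero : ∀ t ≥ T, e t = 0 := fun t ht =>
      le_antisymm (hT0 ▸ hanti (Set.mem_Ici.2 hT) (Set.mem_Ici.2 (hT.trans ht)) ht)
        (hnn t (hT.trans ht))
    have hv0 : ∀ t > T, v t = 0 := by
      intro t ht
      have ht0 : 0 ≤ t := hT.trans ht.le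
      have h1 : HasDerivAt e 0 t := by
        refine (hasDerivAt_const t (0:ℝ)).congr_of_eventuallyEq ?_
        filter_upwards [lt_mem_nhds ht] with x hx using hzero x (le_of_lt hx)
      have h2 := (he t ht0).unique h1
      have h3 := hD t ht0
      have h4 : g t ^ 2 ≤ 0 := by
        by_contra! h
        nlinarith [mul_pos hκ h]
      have h5 : g t = 0 := by nlinarith [sq_nonneg (g t)]
      have := hv t ht0
      rw [h5, mul_zero] at this
      exact norm_le_zero_iff.1 this
    have hconst : ∀ t ≥ T + 1, u t = u (T + 1) := by
      intro t ht
      refine constant_of_has_deriv_right_zero (a := T + 1) (b := t) ?_ ?_ t ⟨ht, le_rfl⟩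
      · intro x hx
        exact (hu x (by linarith [hx.1])).continuousAt.continuousWithinAt
      · intro x hx
        have := hu x (by linarith [hx.1])
        rw [hv0 x (by linarith [hx.1])] at this
        exact this.hasDerivWithinAt
    refine ⟨T + 1, fun t ht => ?_⟩
    rw [hconst t ht]
    by_contra hne
    have hp : 0 < ‖u (T + 1) - a‖ := norm_pos_iff.2 (sub_ne_zero.2 hne)
    obtain ⟨s, hs, hs2⟩ := hfreq (T + 1) _ hp
    rw [hconst s hs] at hs2
    exact lt_irrefl _ hs2
  · right
    push Not at hz
    have hpos : ∀ t ≥ (0:ℝ), 0 < e t := fun t ht => lt_of_le_of_ne (hnn t ht) (hz t ht).symm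
    refine ⟨hpos, ?_⟩
    have hL' : ∀ t ≥ (0:ℝ), ‖u t - a‖ < r → c * e t ^ (1 - θ) ≤ g t := by
      intro t ht h
      have := hL t ht h
      rwa [abs_of_pos (hpos t ht)] at this
    set L := 2 * K / (θ * κ * c) with hLdef
    have hLpos : 0 < L := by positivity
    have hlim2 : Tendsto (fun t => L * e t ^ θ) atTop (𝓝 0) := by
      have := (hlim.rpow_const (p := θ) (Or.inr hθ.le)).const_mul L
      simpa [Real.zero_rpow hθ.ne'] using this
    obtain ⟨S0, hS0⟩ := eventually_atTop.1 (hlim2.eventually (gt_mem_nhds (show (0:ℝ) < r / 4 by linarith)))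
    obtain ⟨S, hS, hSa⟩ := hfreq (max S0 0) (r / 4) (by linarith)
    have hSn : 0 ≤ S := (le_max_right _ _).trans hS
    have hSS : S0 ≤ S := (le_max_left _ _).trans hS
    have hsmall : ∀ t ≥ S, ‖u t - a‖ + L * e t ^ θ < r := by
      intro t ht
      have h1 := rlv_len hκ hK hc hθ hu he hD hv hpos hL' hSn
        (by have := hS0 S hSS; linarith) ht
      rw [← hLdef] at h1
      have h2 : 0 < e t ^ θ := Real.rpow_pos_of_pos (hpos t (hSn.trans ht)) _
      have h3 : ‖u t - a‖ ≤ ‖u t - u S‖ + ‖u S - a‖ := norm_sub_le_norm_sub_add_norm_sub _ _ _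
      have h4 := hS0 S hSS
      have h5 := hS0 t (hSS.trans ht)
      have := mul_pos hLpos h2
      nlinarith
    refine ⟨S, hSn, fun t ht => ⟨?_, ?_⟩⟩
    · have h2 : 0 < e t ^ θ := Real.rpow_pos_of_pos (hpos t (hSn.trans ht)) _
      have := mul_pos hLpos h2
      linarith [hsmall t ht]
    · refine le_of_forall_pos_le_add fun ε hε => ?_
      obtain ⟨s, hs, hs2⟩ := hfreq t ε hε
      have h1 := rlv_len hκ hK hc hθ hu he hD hv hpos hL' (hSn.trans ht) (hsmall t ht) hs
      rw [← hLdef] at h1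
      have h2 : 0 < e s ^ θ := Real.rpow_pos_of_pos (hpos s ((hSn.trans ht).trans hs)) _
      have := mul_pos hLpos h2
      have h3 : ‖u t - a‖ ≤ ‖u t - u s‖ + ‖u s - a‖ := norm_sub_le_norm_sub_add_norm_sub _ _ _
      rw [norm_sub_rev (u t) (u s)] at h3
      nlinarith

/-- decay, exponential -/
theorem rlv_exp {e D : ℝ → ℝ} {k S : ℝ} (hS : 0 ≤ S)
    (he : ∀ t ≥ (0:ℝ), HasDerivAt e (-(D t)) t)
    (hD : ∀ t ≥ S, k * e t ≤ D t) {t : ℝ} (ht : S ≤ t) :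
    e t ≤ e S * Real.exp (k * S) * Real.exp (-k * t) := by
  have hd : ∀ x ≥ S, HasDerivAt (fun x => e x * Real.exp (k * x))
      (-(D x) * Real.exp (k * x) + e x * (Real.exp (k * x) * (k * 1))) x := fun x hx =>
    (he x (hS.trans hx)).mul (((hasDerivAt_id x).const_mul k).exp)
  have hanti : AntitoneOn (fun x => e x * Real.exp (k * x)) (Set.Ici S) := by
    apply antitoneOn_of_deriv_nonpos (convex_Ici S)
    · intro x hx
      exact (hd x hx).continuousAt.continuousWithinAt
    · intro x hx
      rw [interior_Ici] at hx
      exact (hd x (le_of_lt hx)).differentiableAt.differentiableWithinAt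
    · intro x hx
      rw [interior_Ici] at hx
      rw [(hd x (le_of_lt hx)).deriv]
      nlinarith [hD x (le_of_lt hx), Real.exp_pos (k * x)]
  have h1 := hanti (Set.mem_Ici.2 le_rfl) (Set.mem_Ici.2 ht) ht
  simp only at h1
  have h2 : Real.exp (k * t) * Real.exp (-k * t) = 1 := by rw [← Real.exp_add]; simp
  calc e t = e t * Real.exp (k * t) * Real.exp (-k * t) := by rw [mul_assoc, h2, mul_one]
    _ ≤ _ := by gcongr

/-- decay, polynomial -/
theorem rlv_poly {e D : ℝ → ℝ} {k S θ : ℝ} (hS : 0 ≤ S) (hk : 0 < k) (hθ0 : 0 < θ)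
    (hθ : θ < 1 / 2)
    (he : ∀ t ≥ (0:ℝ), HasDerivAt e (-(D t)) t) (hpos : ∀ t ≥ (0:ℝ), 0 < e t)
    (hD : ∀ t ≥ S, k * e t ^ (2 * (1 - θ)) ≤ D t) {t : ℝ} (ht : 2 * S + 1 ≤ t) :
    e t ^ θ ≤ ((1 - 2 * θ) * k / 2) ^ (-θ / (1 - 2 * θ)) * t ^ (-θ / (1 - 2 * θ)) := by
  have hq : 0 < 1 - 2 * θ := by linarith
  have hd : ∀ x ≥ S, HasDerivAt (fun x => e x ^ (2 * θ - 1) - (1 - 2 * θ) * k * x)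
      (-(D x) * (2 * θ - 1) * e x ^ (2 * θ - 1 - 1) - (1 - 2 * θ) * k * 1) x := fun x hx =>
    ((he x (hS.trans hx)).rpow_const (Or.inl (hpos x (hS.trans hx)).ne')).sub
      ((hasDerivAt_id x).const_mul _)
  have hmono : MonotoneOn (fun x => e x ^ (2 * θ - 1) - (1 - 2 * θ) * k * x) (Set.Ici S) := by
    apply monotoneOn_of_deriv_nonneg (convex_Ici S)
    · intro x hx
      exact (hd x hx).continuousAt.continuousWithinAt
    · intro x hx
      rw [interior_Ici] at hx
      exact (hd x (le_of_lt hx)).differentiableAt.differentiableWithinAt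
    · intro x hx
      rw [interior_Ici] at hx
      have hx' : S ≤ x := le_of_lt hx
      rw [(hd x hx').deriv]
      have hex := hpos x (hS.trans hx')
      have h1 : e x ^ (2 * (1 - θ)) * e x ^ (2 * θ - 1 - 1) = 1 := by
        rw [← Real.rpow_add hex]; ring_nf; simp
      have h2 : 0 < e x ^ (2 * θ - 1 - 1) := Real.rpow_pos_of_pos hex _
      have h3 : k ≤ D x * e x ^ (2 * θ - 1 - 1) := by
        have := mul_le_mul_of_nonneg_right (hD x hx') h2.le
        calc k = k * e x ^ (2 * (1 - θ)) * e x ^ (2 * θ - 1 - 1) := by rw [mul_assoc, h1, mul_one]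
          _ ≤ _ := this
      nlinarith
  have hSt : S ≤ t := by linarith
  have ht0 : 0 < t := by linarith
  have h1 := hmono (Set.mem_Ici.2 le_rfl) (Set.mem_Ici.2 hSt) hSt
  simp only at h1
  have het := hpos t ht0.le
  have h2 : 0 < e S ^ (2 * θ - 1) := Real.rpow_pos_of_pos (hpos S hS) _
  have hqk : 0 < (1 - 2 * θ) * k := by positivity
  have h3 : (1 - 2 * θ) * k / 2 * t ≤ e t ^ (2 * θ - 1) := by nlinarith
  have h4 : (e t ^ (2 * θ - 1)) ^ (-θ / (1 - 2 * θ)) = e t ^ θ := by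
    rw [← Real.rpow_mul het.le]
    congr 1
    field_simp
    ring
  rw [← h4, ← Real.mul_rpow (by positivity) ht0.le]
  exact Real.rpow_le_rpow_of_nonpos (by positivity) h3
    (div_nonpos_of_nonpos_of_nonneg (by linarith) hq.le)

theorem rlv_grad_cont {N : ℕ} {H : EuclideanSpace ℝ (Fin N) → ℝ} (hH : ContDiff ℝ 1 H) :
    Continuous (gradient H) := by
  have := hH.continuous_fderiv (by norm_num)
  unfold gradient
  exact (InnerProductSpace.toDual ℝ _).symm.continuous.comp this

theorem rlv_setup {N : ℕ}
    (H : EuclideanSpace ℝ (Fin N) → ℝ)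
    (hH : ContDiff ℝ 1 H)
    (μ ν : ℝ) (hμ : 0 < μ) (hν : 0 < ν)
    (u : ℝ → EuclideanSpace ℝ (Fin N))
    (hbdd : ∃ C, ∀ t ≥ (0:ℝ), ‖u t‖ ≤ C)
    (hode : ∀ t ≥ (0:ℝ), ∀ i, HasDerivAt (fun s => u s i)
      (-(1 / (μ + ν * (u t i)^2)) * gradient H (u t) i) t) :
    ∃ (v : ℝ → EuclideanSpace ℝ (Fin N)) (D : ℝ → ℝ) (κ K : ℝ), 0 < κ ∧ 0 < K ∧
      (∀ t ≥ (0:ℝ), HasDerivAt u (v t) t) ∧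
      (∀ t ≥ (0:ℝ), HasDerivAt (fun t => H (u t)) (-(D t)) t) ∧
      (∀ t ≥ (0:ℝ), κ * ‖gradient H (u t)‖ ^ 2 ≤ D t) ∧
      (∀ t ≥ (0:ℝ), ‖v t‖ ≤ K * ‖gradient H (u t)‖) := by
  obtain ⟨C, hC⟩ := hbdd
  have hu : ∀ t ≥ (0:ℝ), HasDerivAt u
      (WithLp.toLp 2 fun i => -(1 / (μ + ν * (u t i)^2)) * gradient H (u t) i) t := by
    intro t ht
    have h1 : HasDerivAt (fun s => (fun i => u s i : Fin N → ℝ))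
      (fun i => -(1 / (μ + ν * (u t i)^2)) * gradient H (u t) i) t :=
      hasDerivAt_pi.2 (hode t ht)
    exact ((PiLp.continuousLinearEquiv 2 ℝ (fun _ : Fin N => ℝ)).symm.toContinuousLinearMap.hasFDerivAt).comp_hasDerivAt t h1
  refine ⟨fun t => WithLp.toLp 2 fun i => -(1 / (μ + ν * (u t i)^2)) * gradient H (u t) i,
    fun t => ∑ i, (1 / (μ + ν * (u t i)^2)) * gradient H (u t) i ^ 2,
    1 / (μ + ν * C ^ 2), 1 / μ, by positivity, by positivity, hu, ?_, ?_, ?_⟩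
  · intro t ht
    have h1 : HasGradientAt H (gradient H (u t)) (u t) :=
      ((hH.differentiable (by norm_num)) (u t)).hasGradientAt
    have h2 := h1.hasFDerivAt.comp_hasDerivAt t (hu t ht)
    refine h2.congr_deriv ?_
    rw [InnerProductSpace.toDual_apply_apply, PiLp.inner_apply, ← Finset.sum_neg_distrib]
    refine Finset.sum_congr rfl fun i _ => ?_
    simp
    ring
  · intro t ht
    rw [EuclideanSpace.real_norm_sq_eq, Finset.mul_sum]
    refine Finset.sum_le_sum fun i _ => ?_
    have h1 : ‖u t i‖ ≤ ‖u t‖ := PiLp.norm_apply_le _ _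
    have h2 : (u t i) ^ 2 ≤ C ^ 2 := by
      rw [Real.norm_eq_abs] at h1
      exact sq_le_sq' (by linarith [neg_abs_le (u t i), hC t ht])
        (by linarith [le_abs_self (u t i), hC t ht])
    gcongr
  · intro t ht
    refine le_of_sq_le_sq ?_ (by positivity)
    rw [mul_pow, EuclideanSpace.real_norm_sq_eq, EuclideanSpace.real_norm_sq_eq, Finset.mul_sum]
    refine Finset.sum_le_sum fun i _ => ?_
    simp only
    rw [mul_pow, neg_sq]
    have : μ ≤ μ + ν * (u t i)^2 := by nlinarith [mul_nonneg hν.le (sq_nonneg (u t i))]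
    gcongr

/-- Convergence, with Łojasiewicz rates, of bounded solutions of the
de-singularized regularized Lotka–Volterra system
`uᵢ' = -(1/(μ̂ + ν̂uᵢ²))∇Ĥ(u)ᵢ` for a `C¹` energy `Ĥ` satisfying the Łojasiewicz
inequality at every critical point. -/
theorem regularized_lotka_volterra_convergence {N : ℕ}
    (Hhat : EuclideanSpace ℝ (Fin N) → ℝ)
    (hHhat : ContDiff ℝ 1 Hhat)
    (hLoj : ∀ a, gradient Hhat a = 0 →
      ∃ c > (0:ℝ), ∃ r > (0:ℝ), ∃ θ ∈ Set.Ioc (0:ℝ) (1/2),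
        ∀ v, ‖v - a‖ < r → c * |Hhat v - Hhat a| ^ (1 - θ) ≤ ‖gradient Hhat v‖)
    (μhat νhat : ℝ) (hμ : 0 < μhat) (hν : 0 < νhat)
    (u : ℝ → EuclideanSpace ℝ (Fin N))
    (hbdd : ∃ C, ∀ t ≥ (0:ℝ), ‖u t‖ ≤ C)
    (hode : ∀ t ≥ (0:ℝ), ∀ i, HasDerivAt (fun s => u s i)
      (-(1 / (μhat + νhat * (u t i)^2)) * gradient Hhat (u t) i) t) :
    ∃ uLim, Tendsto u atTop (𝓝 uLim) ∧ gradient Hhat uLim = 0 ∧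
      ∀ c > (0:ℝ), ∀ r > (0:ℝ), ∀ θ ∈ Set.Ioc (0:ℝ) (1/2),
        (∀ v, ‖v - uLim‖ < r →
          c * |Hhat v - Hhat uLim| ^ (1 - θ) ≤ ‖gradient Hhat v‖) →
        (θ = 1/2 → ∃ δ > (0:ℝ),
          (fun t => ‖u t - uLim‖) =O[atTop] fun t => Real.exp (-δ * t)) ∧
        (θ < 1/2 →
          (fun t => ‖u t - uLim‖) =O[atTop] fun t : ℝ => t ^ (-θ / (1 - 2*θ))) := by
  obtain ⟨v, D, κ, K, hκ, hK, hu, hh, hD, hv⟩ :=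
    rlv_setup Hhat hHhat μhat νhat hμ hν u hbdd hode
  have hgc := rlv_grad_cont hHhat
  have hHc : Continuous Hhat := hHhat.continuous
  -- cluster point
  obtain ⟨a, ha⟩ : ∃ a, MapClusterPt a atTop u := by
    obtain ⟨C, hC⟩ := hbdd
    obtain ⟨a, -, ha⟩ := (isCompact_closedBall (0 : EuclideanSpace ℝ (Fin N)) C).exists_mapClusterPt
      (f := atTop) (u := u) (by
        rw [le_principal_iff, mem_map]
        filter_upwards [eventually_ge_atTop (0:ℝ)] with t ht
        simpa using hC t ht)
    exact ⟨a, ha⟩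
  have hha : MapClusterPt (Hhat a) atTop (fun t => Hhat (u t)) :=
    ha.continuousAt_comp hHc.continuousAt
  have hanti := rlv_anti hh (fun t ht => le_trans (by positivity) (hD t ht))
  obtain ⟨hge, hlim⟩ := rlv_lim hanti hha
  have hlim0 : Tendsto (fun t => Hhat (u t) - Hhat a) atTop (𝓝 0) := by
    simpa using hlim.sub_const (Hhat a)
  have he : ∀ t ≥ (0:ℝ), HasDerivAt (fun t => Hhat (u t) - Hhat a) (-(D t)) t :=
    fun t ht => (hh t ht).sub_const _
  have dich : ∀ c > (0:ℝ), ∀ r > (0:ℝ), ∀ θ > (0:ℝ),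
      (∀ w, ‖w - a‖ < r → c * |Hhat w - Hhat a| ^ (1 - θ) ≤ ‖gradient Hhat w‖) →
      (∃ T, ∀ t ≥ T, u t = a) ∨ ((∀ t ≥ (0:ℝ), 0 < Hhat (u t) - Hhat a) ∧
        ∃ S ≥ (0:ℝ), ∀ t ≥ S, ‖u t - a‖ < r ∧
          ‖u t - a‖ ≤ (2 * K / (θ * κ * c)) * (Hhat (u t) - Hhat a) ^ θ) := by
    intro c hc r hr θ hθ hL
    exact rlv_dich hκ hK hc hθ hr hu he hD hv (fun t _ h => hL (u t) h) ha hlim0.mapClusterPt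
  -- Łojasiewicz inequality at `a`, critical or not
  have hLa : ∃ c > (0:ℝ), ∃ r > (0:ℝ), ∃ θ > (0:ℝ),
      ∀ w, ‖w - a‖ < r → c * |Hhat w - Hhat a| ^ (1 - θ) ≤ ‖gradient Hhat w‖ := by
    by_cases hcrit : gradient Hhat a = 0
    · obtain ⟨c, hc, r, hr, θ, hθ, h⟩ := hLoj a hcrit
      exact ⟨c, hc, r, hr, θ, hθ.1, h⟩
    · have hp : 0 < ‖gradient Hhat a‖ := norm_pos_iff.2 hcrit
      have h1 : ∀ᶠ w in 𝓝 a, ‖gradient Hhat a‖ / 2 < ‖gradient Hhat w‖ :=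
        (hgc.norm.tendsto a).eventually (lt_mem_nhds (by linarith))
      have h2 : ∀ᶠ w in 𝓝 a, |Hhat w - Hhat a| < 1 := by
        have : Tendsto (fun w => |Hhat w - Hhat a|) (𝓝 a) (𝓝 |Hhat a - Hhat a|) :=
          (hHc.sub continuous_const).abs.tendsto a
        exact this.eventually (gt_mem_nhds (by simp))
      obtain ⟨r, hr, h⟩ := Metric.eventually_nhds_iff.1 (h1.and h2)
      refine ⟨‖gradient Hhat a‖ / 2, by linarith, r, hr, 1 / 2, by norm_num, fun w hw => ?_⟩
      obtain ⟨h3, h4⟩ := h (y := w) (by rwa [dist_eq_norm])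
      have h5 : |Hhat w - Hhat a| ^ (1 - 1 / 2 : ℝ) ≤ 1 :=
        Real.rpow_le_one (abs_nonneg _) h4.le (by norm_num)
      nlinarith
  have hconv : Tendsto u atTop (𝓝 a) := by
    obtain ⟨c, hc, r, hr, θ, hθ, h⟩ := hLa
    rcases dich c hc r hr θ hθ h with ⟨T, hT⟩ | ⟨-, S, hS, hS2⟩
    · exact tendsto_const_nhds.congr' (by
        filter_upwards [eventually_ge_atTop T] with t ht using (hT t ht).symm)
    · rw [tendsto_iff_norm_sub_tendsto_zero]
      have h0 := (hlim0.rpow_const (p := θ) (Or.inr hθ.le)).const_mul (2 * K / (θ * κ * c))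
      rw [Real.zero_rpow hθ.ne', mul_zero] at h0
      refine squeeze_zero' (Eventually.of_forall fun t => norm_nonneg _) ?_ h0
      filter_upwards [eventually_ge_atTop S] with t ht using (hS2 t ht).2
  refine ⟨a, hconv, ?_, ?_⟩
  · by_contra hcrit
    have hp : 0 < ‖gradient Hhat a‖ := norm_pos_iff.2 hcrit
    have h1 : ∀ᶠ t in atTop, ‖gradient Hhat a‖ / 2 < ‖gradient Hhat (u t)‖ :=
      ((hgc.norm.tendsto a).comp hconv).eventually (lt_mem_nhds (by linarith))
    obtain ⟨S0, hS0⟩ := eventually_atTop.1 h1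
    set m := κ * (‖gradient Hhat a‖ / 2) ^ 2 with hm
    have hmpos : 0 < m := by positivity
    have hanti2 := rlv_anti (h := fun t => Hhat (u (t + max S0 0)) + m * t)
      (D := fun t => D (t + max S0 0) - m) (by
        intro t ht
        have h2 := (hh (t + max S0 0) (by have := le_max_right S0 0; linarith)).comp_add_const
          t (max S0 0)
        exact (h2.add ((hasDerivAt_id t).const_mul m)).congr_deriv (by ring)) (by
        intro t ht
        have h2 := hD (t + max S0 0) (by have := le_max_right S0 0; linarith)
        have h3 := hS0 (t + max S0 0) (by have := le_max_left S0 0; linarith)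
        have h4 : m ≤ κ * ‖gradient Hhat (u (t + max S0 0))‖ ^ 2 := by
          rw [hm]; gcongr
        linarith)
    have hb := hge 0 le_rfl
    set q := (Hhat (u (0 + max S0 0)) - Hhat a + 1) / m with hq
    have hq0 : 0 ≤ q := by
      have := hge (0 + max S0 0) (by simp)
      exact div_nonneg (by linarith) hmpos.le
    have h5 := hanti2 (Set.mem_Ici.2 le_rfl) (Set.mem_Ici.2 hq0) hq0
    simp only [mul_zero, add_zero] at h5
    have h6 := hge (q + max S0 0) (by have := le_max_right S0 0; linarith)
    have h7 : m * q = Hhat (u (0 + max S0 0)) - Hhat a + 1 := by rw [hq]; field_simp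
    linarith
  · intro c hc r hr θ hθ hL
    rcases dich c hc r hr θ hθ.1 hL with ⟨T, hT⟩ | ⟨hpos, S, hS, hS2⟩
    · have hz : (fun t => ‖u t - a‖) =ᶠ[atTop] fun _ => (0:ℝ) := by
        filter_upwards [eventually_ge_atTop T] with t ht
        simp [hT t ht]
      exact ⟨fun _ => ⟨1, one_pos, (isBigO_zero _ _).congr' hz.symm EventuallyEq.rfl⟩,
        fun _ => (isBigO_zero _ _).congr' hz.symm EventuallyEq.rfl⟩
    · have hDe : ∀ t ≥ S, κ * c ^ 2 * (Hhat (u t) - Hhat a) ^ (2 * (1 - θ)) ≤ D t := by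
        intro t ht
        have h0 := hpos t (hS.trans ht)
        have h1 := hL (u t) (hS2 t ht).1
        rw [abs_of_pos h0] at h1
        have h2 : (Hhat (u t) - Hhat a) ^ (2 * (1 - θ)) =
            ((Hhat (u t) - Hhat a) ^ (1 - θ)) ^ 2 := by
          rw [mul_comm, Real.rpow_mul h0.le]; norm_cast
        have h3 : 0 ≤ (Hhat (u t) - Hhat a) ^ (1 - θ) := Real.rpow_nonneg h0.le _
        calc κ * c ^ 2 * (Hhat (u t) - Hhat a) ^ (2 * (1 - θ))
            = κ * (c * (Hhat (u t) - Hhat a) ^ (1 - θ)) ^ 2 := by rw [h2]; ring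
          _ ≤ κ * ‖gradient Hhat (u t)‖ ^ 2 := by gcongr
          _ ≤ _ := hD t (hS.trans ht)
      have hθ0 := hθ.1
      constructor
      · intro hhalf
        refine ⟨κ * c ^ 2 * θ, by positivity, ?_⟩
        refine IsBigO.of_bound ((2 * K / (θ * κ * c)) *
          ((Hhat (u S) - Hhat a) * Real.exp (κ * c ^ 2 * S)) ^ θ) ?_
        filter_upwards [eventually_ge_atTop S] with t ht
        have h0 := hpos t (hS.trans ht)
        have hS0 := hpos S hS
        have h1 := rlv_exp (k := κ * c ^ 2) hS he (by
          intro t ht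
          have := hDe t ht
          have h2 : 2 * (1 - θ) = 1 := by rw [hhalf]; norm_num
          rwa [h2, Real.rpow_one] at this) ht
        rw [norm_norm, Real.norm_of_nonneg (Real.exp_pos _).le]
        have h2 : Real.exp (-(κ * c ^ 2 * θ) * t) = Real.exp (-(κ * c ^ 2) * t) ^ θ := by
          rw [← Real.exp_mul]; congr 1; ring
        rw [h2, mul_assoc, ← Real.mul_rpow (by positivity) (Real.exp_pos _).le]
        refine (hS2 t ht).2.trans ?_
        gcongr
      · intro hlt
        refine IsBigO.of_bound ((2 * K / (θ * κ * c)) *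
          ((1 - 2 * θ) * (κ * c ^ 2) / 2) ^ (-θ / (1 - 2 * θ))) ?_
        filter_upwards [eventually_ge_atTop (2 * S + 1)] with t ht
        have h1 := rlv_poly (k := κ * c ^ 2) hS (by positivity) hθ0 hlt he hpos hDe ht
        have ht0 : 0 ≤ t := by linarith
        rw [norm_norm, Real.norm_of_nonneg (Real.rpow_nonneg ht0 _), mul_assoc]
        refine (hS2 t (by linarith)).2.trans ?_
        gcongr
end

section
/- Let a, d ∈ ℝ^N_+, λ > 0, and let B ∈ ℝ^{N×N} have all entries positive with B̲ := min_{i,j} B_{ij} > 0. For ε > 0 define Ω_ε := {f ∈ ℝ^N_+ : ‖f‖_∞ ≤ (λ^{-1} + B̲^{-1})‖a‖_∞ + ε} and M_ε := max_{f ∈ closure(Ω_ε)} ‖a - Bf‖_∞. Consider the discrete-time Lotka-Volterra scheme f^{n+1}_i = f^n_i·(1 + τλd_i f^n_i + τd_i(a - Bf^n)_i)/(1 + τλd_i f^n_i). If 0 < τ < 1/(‖d‖_∞ M_ε), then Ω_ε is invariant: f^n ∈ Ω_ε implies f^{n+1} ∈ Ω_ε. -/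
/-- Feasibility of the discrete-time competitive Lotka–Volterra
scheme: for step size `0 < τ < 1/(‖d‖_∞ M_ε)`, the region `Ω_ε` is invariant.
The sup-norm on `Fin N → ℝ` is the default norm `‖·‖`. -/
theorem discrete_lotka_volterra_feasibility {N : ℕ}
    (a d : Fin N → ℝ) (ha : ∀ i, 0 < a i) (hd : ∀ i, 0 < d i)
    (lam : ℝ) (hlam : 0 < lam)
    (B : Matrix (Fin N) (Fin N) ℝ) (hBpos : ∀ i j, 0 < B i j)
    (Bmin : ℝ) (hBmin : IsLeast {x | ∃ i j, B i j = x} Bmin) (hBminpos : 0 < Bmin)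
    (ε : ℝ) (hε : 0 < ε)
    (Ω : Set (Fin N → ℝ))
    (hΩ : Ω = {f | (∀ i, 0 < f i) ∧ ‖f‖ ≤ (lam⁻¹ + Bmin⁻¹) * ‖a‖ + ε})
    (M : ℝ) (hM : IsGreatest ((fun f => ‖a - B.mulVec f‖) '' closure Ω) M)
    (τ : ℝ) (hτ : 0 < τ) (hτM : τ < 1 / (‖d‖ * M))
    (f g : Fin N → ℝ) (hf : f ∈ Ω)
    (hg : ∀ i, g i = f i * (1 + τ * lam * d i * f i + τ * d i * (a i - B.mulVec f i))
      / (1 + τ * lam * d i * f i)) :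
    g ∈ Ω := by
  subst hΩ
  obtain ⟨hfpos, hfn⟩ := hf
  have hpos : 0 < ‖d‖ * M := by
    by_contra h
    have : 1 / (‖d‖ * M) ≤ 0 := one_div_nonpos.mpr (not_lt.mp h)
    linarith
  have h1 : τ * (‖d‖ * M) < 1 := (lt_div_iff₀ hpos).mp hτM
  have hMf : ‖a - B.mulVec f‖ ≤ M := hM.2 ⟨f, subset_closure ⟨hfpos, hfn⟩, rfl⟩
  have key : ∀ i, 0 < g i ∧ g i ≤ (lam⁻¹ + Bmin⁻¹) * ‖a‖ + ε := by
    intro i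
    have hfi := hfpos i
    have hdi := hd i
    have hdn : d i ≤ ‖d‖ := (le_abs_self _).trans (norm_le_pi_norm d i)
    have han : a i ≤ ‖a‖ := (le_abs_self _).trans (norm_le_pi_norm a i)
    have hfin : f i ≤ ‖f‖ := (le_abs_self _).trans (norm_le_pi_norm f i)
    have hri : |a i - B.mulVec f i| ≤ M := (norm_le_pi_norm (a - B.mulVec f) i).trans hMf
    have hBf : Bmin * f i ≤ B.mulVec f i := by
      have h2 : B i i * f i ≤ ∑ j, B i j * f j :=
        Finset.single_le_sum (f := fun j => B i j * f j)
          (fun j _ => (mul_pos (hBpos i j) (hfpos j)).le) (Finset.mem_univ i)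
      have h3 : Bmin ≤ B i i := hBmin.2 ⟨i, i, rfl⟩
      exact (mul_le_mul_of_nonneg_right h3 hfi.le).trans h2
    have hgi := hg i
    generalize B.mulVec f i = b at *
    have hD : 0 < τ * lam * d i * f i := by positivity
    have habs : d i * |a i - b| ≤ ‖d‖ * M :=
      mul_le_mul hdn hri (abs_nonneg _) (norm_nonneg _)
    have hlow : -1 < τ * d i * (a i - b) := by
      have h4 : τ * (d i * |a i - b|) ≤ τ * (‖d‖ * M) := mul_le_mul_of_nonneg_left habs hτ.le
      have h5 : τ * d i * (-|a i - b|) ≤ τ * d i * (a i - b) :=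
        mul_le_mul_of_nonneg_left (neg_abs_le _) (by positivity)
      linarith
    rw [hgi]
    refine ⟨div_pos (mul_pos hfi (by linarith)) (by linarith), ?_⟩
    rw [div_le_iff₀ (by linarith)]
    have hq : 0 < τ * d i * f i := by positivity
    rcases le_total (a i - b) 0 with h | h
    · have h6 : τ * d i * f i * (a i - b) ≤ 0 := mul_nonpos_of_nonneg_of_nonpos hq.le h
      have h7 := mul_le_mul_of_nonneg_right (hfin.trans hfn)
        (show 0 ≤ 1 + τ * lam * d i * f i by linarith)
      linarith
    · have hb0 : 0 ≤ b := le_trans (by positivity) hBf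
      have h8 : f i ≤ Bmin⁻¹ * ‖a‖ := by
        rw [inv_mul_eq_div, le_div_iff₀ hBminpos]; linarith
      have h9 : τ * d i * f i * (a i - b) ≤ lam⁻¹ * ‖a‖ * (1 + τ * lam * d i * f i) := by
        have e : lam⁻¹ * ‖a‖ * (1 + τ * lam * d i * f i)
            = lam⁻¹ * ‖a‖ + τ * d i * f i * ‖a‖ := by field_simp
        have h10 : τ * d i * f i * (a i - b) ≤ τ * d i * f i * ‖a‖ :=
          mul_le_mul_of_nonneg_left (by linarith) hq.le
        have : 0 ≤ lam⁻¹ * ‖a‖ := by positivity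
        rw [e]; linarith
      have h7 := mul_le_mul_of_nonneg_right h8
        (show 0 ≤ 1 + τ * lam * d i * f i by linarith)
      have h11 : 0 ≤ ε * (1 + τ * lam * d i * f i) := by positivity
      linarith
  refine ⟨fun i => (key i).1, (pi_norm_le_iff_of_nonneg (by positivity)).mpr fun i => ?_⟩
  rw [Real.norm_of_nonneg (key i).1.le]
  exact (key i).2
end

section
/- Under the same assumptions as the feasibility lemma (a, d ∈ ℝ^N_+, all entries of B positive with minimum B̲ > 0, λ > 0, f^n ∈ Ω_ε := {f ∈ ℝ^N_+ : ‖f‖_∞ ≤ (λ^{-1} + B̲^{-1})‖a‖_∞ + ε}, M_ε := max_{f ∈ closure(Ω_ε)} ‖a - Bf‖_∞, and 0 < τ < 1/(‖d‖_∞ M_ε)), the discrete-time Lotka-Volterra scheme satisfies the ratio bound: for every i, 0 < 1 - τ‖d‖_∞ M_ε ≤ f^{n+1}_i/f^n_i ≤ 1 + τ‖d‖_∞ M_ε. -/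
/-- Ratio bound for the discrete-time competitive Lotka–Volterra
scheme: consecutive iterates satisfy
`0 < 1 - τ‖d‖_∞ M_ε ≤ fⁿ⁺¹ᵢ/fⁿᵢ ≤ 1 + τ‖d‖_∞ M_ε`. -/
theorem discrete_lotka_volterra_ratio_bound {N : ℕ}
    (a d : Fin N → ℝ) (ha : ∀ i, 0 < a i) (hd : ∀ i, 0 < d i)
    (lam : ℝ) (hlam : 0 < lam)
    (B : Matrix (Fin N) (Fin N) ℝ) (hBpos : ∀ i j, 0 < B i j)
    (Bmin : ℝ) (hBmin : IsLeast {x | ∃ i j, B i j = x} Bmin) (hBminpos : 0 < Bmin)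
    (ε : ℝ) (hε : 0 < ε)
    (Ω : Set (Fin N → ℝ))
    (hΩ : Ω = {f | (∀ i, 0 < f i) ∧ ‖f‖ ≤ (lam⁻¹ + Bmin⁻¹) * ‖a‖ + ε})
    (M : ℝ) (hM : IsGreatest ((fun f => ‖a - B.mulVec f‖) '' closure Ω) M)
    (τ : ℝ) (hτ : 0 < τ) (hτM : τ < 1 / (‖d‖ * M))
    (f g : Fin N → ℝ) (hf : f ∈ Ω)
    (hg : ∀ i, g i = f i * (1 + τ * lam * d i * f i + τ * d i * (a i - B.mulVec f i))
      / (1 + τ * lam * d i * f i)) :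
    0 < 1 - τ * ‖d‖ * M ∧
    ∀ i, 1 - τ * ‖d‖ * M ≤ g i / f i ∧ g i / f i ≤ 1 + τ * ‖d‖ * M := by
  have hMf : ‖a - B.mulVec f‖ ≤ M := hM.2 ⟨f, subset_closure hf, rfl⟩
  have hM0 : 0 ≤ M := (norm_nonneg _).trans hMf
  have hpos : 0 < ‖d‖ * M := by
    have h : 0 < 1 / (‖d‖ * M) := hτ.trans hτM
    exact one_div_pos.mp h
  have h1 : τ * (‖d‖ * M) < 1 := (lt_div_iff₀ hpos).mp hτM
  refine ⟨by nlinarith, fun i => ?_⟩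
  rw [hΩ] at hf
  have hfi := hf.1 i
  have hdi := hd i
  have hD : 0 < τ * lam * d i * f i := by positivity
  have hdn : d i ≤ ‖d‖ := (le_abs_self _).trans (norm_le_pi_norm d i)
  have hr : |a i - B.mulVec f i| ≤ M := (norm_le_pi_norm (a - B.mulVec f) i).trans hMf
  have hq : g i / f i - 1
      = τ * d i * (a i - B.mulVec f i) / (1 + τ * lam * d i * f i) := by
    rw [hg i]
    generalize B.mulVec f i = y
    field_simp
    ring
  have hb : |g i / f i - 1| ≤ τ * ‖d‖ * M := by
    rw [hq, abs_div, abs_mul, abs_of_pos (mul_pos hτ hdi),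
      abs_of_pos (by linarith : 0 < 1 + τ * lam * d i * f i)]
    refine (div_le_self (by positivity) (by linarith)).trans ?_
    gcongr
  have := abs_le.mp hb
  constructor <;> linarith [this.1, this.2]
end

section
/- Let a ∈ ℝ^N, d ∈ ℝ^N_+, τ > 0, and let B ∈ ℝ^{N×N} be symmetric with λI - B positive semidefinite for some λ > 0. Define E(f) := Σ_i f_i a_i - (1/2)Σ_{i,j} B_{ij} f_i f_j. If f^n ∈ ℝ^N_+ and f^{n+1} is given by the discrete-time Lotka-Volterra scheme f^{n+1}_i = f^n_i·(1 + τλd_i f^n_i + τd_i(a - Bf^n)_i)/(1 + τλd_i f^n_i), then E(f^{n+1}) - E(f^n) ≥ 0, with equality if and only if for every i either f^n_i = 0 or a_i = (Bf^n)_i. -/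
/-- Monotonicity of the energy
`E(f) = Σᵢ fᵢaᵢ - (1/2)Σᵢⱼ Bᵢⱼfᵢfⱼ` along one step of the discrete-time
Lotka–Volterra scheme, with equality iff for every `i`, either `fᵢ = 0` or
`aᵢ = (Bf)ᵢ`. -/
theorem discrete_lotka_volterra_energy_monotone {N : ℕ}
    (a : Fin N → ℝ) (d : Fin N → ℝ) (hd : ∀ i, 0 < d i)
    (τ : ℝ) (hτ : 0 < τ)
    (B : Matrix (Fin N) (Fin N) ℝ) (hB : B.IsSymm)
    (lam : ℝ) (hlam : 0 < lam)
    (hpsd : (lam • (1 : Matrix (Fin N) (Fin N) ℝ) - B).PosSemidef)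
    (E : (Fin N → ℝ) → ℝ)
    (hEdef : ∀ f, E f = ∑ i, f i * a i - (1/2) * ∑ i, ∑ j, B i j * f i * f j)
    (f g : Fin N → ℝ) (hf : ∀ i, 0 < f i)
    (hg : ∀ i, g i = f i * (1 + τ * lam * d i * f i + τ * d i * (a i - B.mulVec f i))
      / (1 + τ * lam * d i * f i)) :
    0 ≤ E g - E f ∧ (E g = E f ↔ ∀ i, f i = 0 ∨ a i = B.mulVec f i) := by
  have hE : ∀ x, E x = x ⬝ᵥ a - (1/2) * (x ⬝ᵥ B.mulVec x) := by
    intro x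
    rw [hEdef]
    simp only [dotProduct, Matrix.mulVec, Finset.mul_sum]
    congr 1
    refine Finset.sum_congr rfl fun i _ => Finset.sum_congr rfl fun j _ => ?_
    ring
  obtain ⟨h, hh⟩ : ∃ h : Fin N → ℝ, g = f + h := ⟨g - f, by simp⟩
  have hsym : f ⬝ᵥ B.mulVec h = h ⬝ᵥ B.mulVec f := by
    rw [Matrix.dotProduct_mulVec, ← Matrix.mulVec_transpose, hB.eq, dotProduct_comm]
  have hpos := hpsd.dotProduct_mulVec_nonneg h
  simp only [star_trivial, Matrix.sub_mulVec, Matrix.smul_mulVec, Matrix.one_mulVec,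
    dotProduct_sub, dotProduct_smul, smul_eq_mul] at hpos
  have hdiff : E g - E f = h ⬝ᵥ a - h ⬝ᵥ B.mulVec f - (1/2) * (h ⬝ᵥ B.mulVec h) := by
    rw [hE, hE, hh, Matrix.mulVec_add]
    simp only [add_dotProduct, dotProduct_add]
    rw [hsym]; ring
  have hterm : ∀ i, τ * d i * f i * (a i - B.mulVec f i)^2 / (2 * (1 + τ * lam * d i * f i))
      ≤ h i * a i - h i * B.mulVec f i - lam / 2 * (h i * h i) := by
    intro i
    have hD : 0 < 1 + τ * lam * d i * f i := by
      have := hd i; have := hf i; positivity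
    have hhi : h i = τ * d i * f i * (a i - B.mulVec f i) / (1 + τ * lam * d i * f i) := by
      have h1 : h i = g i - f i := by rw [hh]; simp
      rw [h1, hg, eq_div_iff hD.ne', sub_mul, div_mul_cancel₀ _ hD.ne']; ring
    rw [← sub_nonneg]
    have : h i * a i - h i * B.mulVec f i - lam / 2 * (h i * h i)
        - τ * d i * f i * (a i - B.mulVec f i)^2 / (2 * (1 + τ * lam * d i * f i))
        = τ * d i * f i * (a i - B.mulVec f i)^2 / (2 * (1 + τ * lam * d i * f i)^2) := by
      rw [hhi]; field_simp; ring
    rw [this]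
    have := hd i; have := hf i; positivity
  have hnn : ∀ i, 0 ≤ τ * d i * f i * (a i - B.mulVec f i)^2 / (2 * (1 + τ * lam * d i * f i)) := by
    intro i
    have := hd i; have := hf i; positivity
  have hsum : ∑ i, τ * d i * f i * (a i - B.mulVec f i)^2 / (2 * (1 + τ * lam * d i * f i))
      ≤ E g - E f := by
    have h1 := Finset.sum_le_sum (fun i (_ : i ∈ Finset.univ) => hterm i)
    simp only [Finset.sum_sub_distrib, ← Finset.mul_sum] at h1
    simp only [dotProduct] at hdiff hpos
    linarith
  have hs0 := Finset.sum_nonneg (fun i (_ : i ∈ Finset.univ) => hnn i)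
  refine ⟨hs0.trans hsum, fun heq i => Or.inr ?_, fun hall => ?_⟩
  · have h0 := le_antisymm (by linarith) hs0
    have := (Finset.sum_eq_zero_iff_of_nonneg (fun i _ => hnn i)).1 h0 i (Finset.mem_univ i)
    have h1 := hd i
    have h2 := hf i
    have hD : 0 < 1 + τ * lam * d i * f i := by positivity
    by_contra hne
    have h3 : a i - B.mulVec f i ≠ 0 := sub_ne_zero.2 hne
    have : 0 < τ * d i * f i * (a i - B.mulVec f i)^2 / (2 * (1 + τ * lam * d i * f i)) := by
      positivity
    linarith
  · have : g = f := by
      funext i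
      have h1 := hd i
      have h2 := hf i
      have hD : 0 < 1 + τ * lam * d i * f i := by positivity
      rcases hall i with h3 | h3
      · exact absurd h3 h2.ne'
      · rw [hg, ← h3, sub_self, mul_zero, add_zero, mul_div_assoc, div_self hD.ne', mul_one]
    rw [this]
end

section
/- Let a ∈ ℝ^N, d ∈ ℝ^N_+, τ > 0, and B ∈ ℝ^{N×N} symmetric with λI - B positive semidefinite for some λ > 0. Let E(f) := Σ_i f_i a_i - (1/2)Σ_{i,j} B_{ij} f_i f_j, and let {f^n}_{n≥0} ⊂ ℝ^N_+ follow the discrete-time Lotka-Volterra scheme f^{n+1}_i = f^n_i·(1 + τλd_i f^n_i + τd_i(a - Bf^n)_i)/(1 + τλd_i f^n_i). If E is bounded above along the sequence (so that lim_n E(f^n) exists by monotonicity), then for every k, Σ_{n=k}^∞ Σ_{i=1}^N (1/(τ d_i f^n_i))·(f^{n+1}_i - f^n_i)² ≤ lim_{n→∞} E(f^n) - E(f^k). -/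
open Filter Topology

/-- `ℓ²`-bound for the discrete-time Lotka–Volterra scheme: the
weighted sum of squared increments from step `k` onwards is bounded by the total
remaining energy increase `lim_n E(fⁿ) - E(fᵏ)`. -/
theorem discrete_lotka_volterra_l2_bound {N : ℕ}
    (a : Fin N → ℝ) (d : Fin N → ℝ) (hd : ∀ i, 0 < d i)
    (τ : ℝ) (hτ : 0 < τ)
    (B : Matrix (Fin N) (Fin N) ℝ) (hB : B.IsSymm)
    (lam : ℝ) (hlam : 0 < lam)
    (hpsd : (lam • (1 : Matrix (Fin N) (Fin N) ℝ) - B).PosSemidef)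
    (E : (Fin N → ℝ) → ℝ)
    (hEdef : ∀ f, E f = ∑ i, f i * a i - (1/2) * ∑ i, ∑ j, B i j * f i * f j)
    (f : ℕ → Fin N → ℝ) (hfpos : ∀ n i, 0 < f n i)
    (hstep : ∀ n i, f (n+1) i
      = f n i * (1 + τ * lam * d i * f n i + τ * d i * (a i - B.mulVec (f n) i))
        / (1 + τ * lam * d i * f n i))
    (hbdd : ∃ C, ∀ n, E (f n) ≤ C) :
    ∃ ℓ, Tendsto (fun n => E (f n)) atTop (𝓝 ℓ) ∧
      ∀ k, ∑' m : ℕ, ∑ i, (1 / (τ * d i * f (k + m) i)) * (f (k + m + 1) i - f (k + m) i)^2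
        ≤ ℓ - E (f k) := by
  have key : ∀ n, ∑ i, (1 / (τ * d i * f n i)) * (f (n + 1) i - f n i)^2
      ≤ E (f (n+1)) - E (f n) := by
    intro n
    set x := f n with hx
    set y := f (n+1) with hy
    have hr : ∀ i, (y i - x i) * (a i - B.mulVec x i)
        = (1 / (τ * d i * x i)) * (y i - x i)^2 + lam * (y i - x i)^2 := by
      intro i
      have h1 : 0 < x i := hfpos n i
      have h2 := hd i
      have h3 : 0 < 1 + τ * lam * d i * x i := by positivity
      have h4 : y i * (1 + τ * lam * d i * x i)
          = x i * (1 + τ * lam * d i * x i + τ * d i * (a i - B.mulVec x i)) := by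
        have h := hstep n i
        rw [eq_div_iff h3.ne'] at h
        exact h
      have h5 : a i - B.mulVec x i = (y i - x i) * (1 / (τ * d i * x i) + lam) := by
        field_simp
        linarith
      rw [h5]
      ring
    have hp : 0 ≤ lam * ∑ i, (y i - x i)^2
        - ∑ i, ∑ j, B i j * (y i - x i) * (y j - x j) := by
      have h := hpsd.dotProduct_mulVec_nonneg (y - x)
      rw [Matrix.sub_mulVec, Matrix.smul_mulVec, Matrix.one_mulVec] at h
      simp only [dotProduct, Matrix.mulVec, Pi.sub_apply, Pi.smul_apply, smul_eq_mul,
        star_trivial] at h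
      refine h.trans_eq ?_
      rw [Finset.mul_sum, ← Finset.sum_sub_distrib]
      refine Finset.sum_congr rfl fun i _ => ?_
      rw [mul_sub, Finset.mul_sum]
      congr 1
      · ring
      · exact Finset.sum_congr rfl fun j _ => by ring
    have hsw : ∑ i, ∑ j, B i j * y i * x j = ∑ i, ∑ j, B i j * x i * y j := by
      rw [Finset.sum_comm]
      refine Finset.sum_congr rfl fun i _ => Finset.sum_congr rfl fun j _ => ?_
      rw [hB.apply i j]
      ring
    have hexp : ∑ i, ∑ j, B i j * (y i - x i) * (y j - x j)
        = ∑ i, ∑ j, B i j * y i * y j - ∑ i, ∑ j, B i j * y i * x j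
          - ∑ i, ∑ j, B i j * x i * y j + ∑ i, ∑ j, B i j * x i * x j := by
      simp only [← Finset.sum_sub_distrib, ← Finset.sum_add_distrib]
      refine Finset.sum_congr rfl fun i _ => Finset.sum_congr rfl fun j _ => ?_
      ring
    have hlin : ∑ i, (y i - x i) * (a i - B.mulVec x i)
        = ∑ i, y i * a i - ∑ i, x i * a i - ∑ i, ∑ j, B i j * y i * x j
          + ∑ i, ∑ j, B i j * x i * x j := by
      simp only [← Finset.sum_sub_distrib, ← Finset.sum_add_distrib]
      refine Finset.sum_congr rfl fun i _ => ?_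
      have e : ∀ c : ℝ, ∑ j, B i j * c * x j = c * B.mulVec x i := by
        intro c
        simp only [dotProduct, Matrix.mulVec, Finset.mul_sum]
        exact Finset.sum_congr rfl fun j _ => by ring
      rw [e, e]
      ring
    have hs : ∑ i, (y i - x i) * (a i - B.mulVec x i)
        = ∑ i, (1 / (τ * d i * x i)) * (y i - x i)^2 + lam * ∑ i, (y i - x i)^2 := by
      rw [Finset.mul_sum, ← Finset.sum_add_distrib]
      exact Finset.sum_congr rfl fun i _ => hr i
    have hn : 0 ≤ lam * ∑ i, (y i - x i)^2 := by positivity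
    rw [hEdef, hEdef]
    linarith
  have hnn : ∀ n, 0 ≤ ∑ i, (1 / (τ * d i * f n i)) * (f (n + 1) i - f n i)^2 := by
    intro n
    refine Finset.sum_nonneg fun i _ => ?_
    have h1 := hfpos n i
    have h2 := hd i
    positivity
  have hmono : Monotone (fun n => E (f n)) :=
    monotone_nat_of_le_succ fun n => by linarith [key n, hnn n]
  obtain ⟨C, hC⟩ := hbdd
  have hb : BddAbove (Set.range (fun n => E (f n))) := ⟨C, by rintro _ ⟨n, rfl⟩; exact hC n⟩
  refine ⟨_, tendsto_atTop_ciSup hmono hb, fun k => ?_⟩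
  refine Real.tsum_le_of_sum_range_le (fun m => hnn (k + m)) fun M => ?_
  have h1 : ∑ m ∈ Finset.range M,
      ∑ i, (1 / (τ * d i * f (k + m) i)) * (f (k + m + 1) i - f (k + m) i)^2
      ≤ E (f (k + M)) - E (f k) := by
    induction M with
    | zero => simp
    | succ M ih =>
      rw [Finset.sum_range_succ]
      have := key (k + M)
      rw [← add_assoc]
      linarith
  have h2 := le_ciSup hb (k + M)
  linarith
end
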